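/- arXiv:math/0205157 — 4 statements merged into one kernel-verified Lean document; each statement's English description precedes it below -/
import Mathlib

section
/- Let (W,S) be a Coxeter system with S finite. Then every element of W of finite order is conjugate in W to an element of a standard parabolic subgroup ⟨S'⟩ for some subset S' ⊆ S such that the subgroup ⟨S'⟩ is finite. -/
/-- The values `U_{k-1}(cos (π / m))` of the Chebyshev polynomials of the second kind, where
`m = 0` stands for `m = ∞`. -/
noncomputable def dihedralCoeff (m k : ℕ) : ℝ :=
  if m = 0 then k else Real.sin (k * (Real.pi / m)) / Real.sin (Real.pi / m)

lemma sin_pi_div_pos {m : ℕ} (hm : 2 ≤ m) : 0 < Real.sin (Real.pi / m) := by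
  have h2 : (2 : ℝ) ≤ m := by exact_mod_cast hm
  apply Real.sin_pos_of_pos_of_lt_pi
  · have := Real.pi_pos
    positivity
  · exact div_lt_self Real.pi_pos (by linarith)

lemma dihedralCoeff_zero (m : ℕ) : dihedralCoeff m 0 = 0 := by
  simp [dihedralCoeff]

lemma dihedralCoeff_one {m : ℕ} (hm : m ≠ 1) : dihedralCoeff m 1 = 1 := by
  by_cases h : m = 0
  · simp [dihedralCoeff, h]
  · have := sin_pi_div_pos (m := m) (by omega)
    simp [dihedralCoeff, h, this.ne']

lemma dihedralCoeff_add_two {m : ℕ} (k : ℕ) :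
    dihedralCoeff m (k + 2) =
      2 * Real.cos (Real.pi / m) * dihedralCoeff m (k + 1) - dihedralCoeff m k := by
  by_cases h : m = 0
  · simp [dihedralCoeff, h]
    ring
  · simp only [dihedralCoeff, h, if_false]
    set θ := Real.pi / m
    have e : Real.sin (((k + 2 : ℕ) : ℝ) * θ) =
        2 * Real.cos θ * Real.sin (((k + 1 : ℕ) : ℝ) * θ) - Real.sin (k * θ) := by
      have h1 : ((k + 2 : ℕ) : ℝ) * θ = ((k + 1 : ℕ) : ℝ) * θ + θ := by push_cast; ring
      have h2 : (k : ℝ) * θ = ((k + 1 : ℕ) : ℝ) * θ - θ := by push_cast; ring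
      rw [h1, h2, Real.sin_add, Real.sin_sub]
      ring
    rw [e]
    ring

lemma dihedralCoeff_nonneg {m k : ℕ} (hm : m ≠ 1) (hk : m = 0 ∨ k ≤ m) :
    0 ≤ dihedralCoeff m k := by
  by_cases h : m = 0
  · simp [dihedralCoeff, h]
  · have hs := sin_pi_div_pos (m := m) (by omega)
    simp only [dihedralCoeff, h, if_false]
    have hkm : (k : ℝ) ≤ m := by exact_mod_cast hk.resolve_left h
    have hm0 : (0 : ℝ) < m := by positivity
    have hpi := Real.pi_pos
    refine div_nonneg (Real.sin_nonneg_of_nonneg_of_le_pi (by positivity) ?_) hs.le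
    calc (k : ℝ) * (Real.pi / m) ≤ m * (Real.pi / m) := by gcongr
      _ = Real.pi := by field_simp

lemma dihedralCoeff_two_mul {m : ℕ} (hm : 2 ≤ m) : dihedralCoeff m (2 * m) = 0 := by
  have h : m ≠ 0 := by omega
  have hm0 : (m : ℝ) ≠ 0 := by positivity
  have : ((2 * m : ℕ) : ℝ) * (Real.pi / m) = 2 * Real.pi := by push_cast; field_simp
  simp only [dihedralCoeff, h, if_false]
  rw [this]
  simp

lemma dihedralCoeff_two_mul_add_one {m : ℕ} (hm : 2 ≤ m) :
    dihedralCoeff m (2 * m + 1) = 1 := by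
  have h : m ≠ 0 := by omega
  have hm0 : (m : ℝ) ≠ 0 := by positivity
  have : ((2 * m + 1 : ℕ) : ℝ) * (Real.pi / m) = Real.pi / m + 2 * Real.pi := by
    push_cast; field_simp; ring
  simp only [dihedralCoeff, h, if_false]
  rw [this, Real.sin_add_two_pi]
  exact div_self (sin_pi_div_pos hm).ne'

namespace CoxeterMatrix

variable {B : Type*} [Fintype B] [DecidableEq B] (M : CoxeterMatrix B)

/-- The canonical bilinear form of a Coxeter matrix. -/
noncomputable def canonicalForm : LinearMap.BilinForm ℝ (B → ℝ) :=
  Matrix.toBilin' (Matrix.of fun i j => -Real.cos (Real.pi / M i j))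

/-- The basis vectors of the geometric representation. -/
def simpleRoot (i : B) : B → ℝ := Pi.single i 1

lemma canonicalForm_simpleRoot (i j : B) :
    M.canonicalForm (simpleRoot i) (simpleRoot j) = -Real.cos (Real.pi / M i j) := by
  simp [canonicalForm, simpleRoot, Matrix.toBilin'_single]

lemma canonicalForm_simpleRoot_self (i : B) :
    M.canonicalForm (simpleRoot i) (simpleRoot i) = 1 := by
  simp [canonicalForm_simpleRoot]

lemma canonicalForm_comm (v w : B → ℝ) : M.canonicalForm v w = M.canonicalForm w v := by
  simp only [canonicalForm, Matrix.toBilin'_apply, Matrix.of_apply]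
  rw [Finset.sum_comm]
  refine Finset.sum_congr rfl fun i _ => Finset.sum_congr rfl fun j _ => ?_
  rw [M.symmetric i j]
  ring

/-- The reflection in a simple root. -/
noncomputable def simpleReflection (i : B) : Module.End ℝ (B → ℝ) :=
  LinearMap.id - ((2 : ℝ) • M.canonicalForm (simpleRoot i)).smulRight (simpleRoot i)

lemma simpleReflection_apply (i : B) (v : B → ℝ) :
    M.simpleReflection i v = v - (2 * M.canonicalForm (simpleRoot i) v) • simpleRoot i := by
  simp [simpleReflection]

lemma simpleReflection_simpleRoot_self (i : B) :
    M.simpleReflection i (simpleRoot i) = -simpleRoot i := by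
  rw [simpleReflection_apply, canonicalForm_simpleRoot_self]
  module

lemma simpleReflection_simpleRoot (i j : B) :
    M.simpleReflection i (simpleRoot j) =
      simpleRoot j + (2 * Real.cos (Real.pi / M i j)) • simpleRoot i := by
  rw [simpleReflection_apply, canonicalForm_simpleRoot]
  module

lemma simpleReflection_apply_of_ne {i j : B} (h : j ≠ i) (v : B → ℝ) :
    M.simpleReflection i v j = v j := by
  simp [simpleReflection_apply, simpleRoot, h]

lemma simpleReflection_mul_self (i : B) : M.simpleReflection i * M.simpleReflection i = 1 := by
  refine LinearMap.ext fun v => ?_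
  rw [Module.End.mul_apply, M.simpleReflection_apply i v, map_sub, map_smul,
    simpleReflection_simpleRoot_self, simpleReflection_apply, Module.End.one_apply]
  module

lemma canonicalForm_simpleReflection (i : B) (v w : B → ℝ) :
    M.canonicalForm (M.simpleReflection i v) (M.simpleReflection i w) = M.canonicalForm v w := by
  simp only [simpleReflection_apply, map_sub, map_smul, LinearMap.sub_apply, LinearMap.smul_apply,
    smul_eq_mul, canonicalForm_simpleRoot_self, M.canonicalForm_comm v (simpleRoot i)]
  ring

/-- The action of an alternating product of two simple reflections on a simple root. -/
lemma prod_alternatingWord_simpleRoot {i j : B} (hij : i ≠ j) (k : ℕ) :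
    ((CoxeterSystem.alternatingWord i j k).map M.simpleReflection).prod (simpleRoot i) =
      if Even k then dihedralCoeff (M i j) (k + 1) • simpleRoot i +
          dihedralCoeff (M i j) k • simpleRoot j
        else dihedralCoeff (M i j) k • simpleRoot i +
          dihedralCoeff (M i j) (k + 1) • simpleRoot j := by
  have hm : M i j ≠ 1 := M.off_diagonal i j hij
  induction k with
  | zero => simp [CoxeterSystem.alternatingWord, dihedralCoeff_one hm, dihedralCoeff_zero]
  | succ k ih =>
    rw [CoxeterSystem.alternatingWord_succ', List.map_cons, List.prod_cons, Module.End.mul_apply,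
      ih]
    by_cases hk : Even k
    · have hk' : ¬ Even (k + 1) := by simpa [Nat.even_add_one] using hk
      simp only [hk, hk', if_true, if_false, map_add, map_smul, simpleReflection_simpleRoot_self,
        simpleReflection_simpleRoot, dihedralCoeff_add_two, M.symmetric j i]
      module
    · have hk' : Even (k + 1) := by simpa [Nat.even_add_one] using hk
      simp only [hk, hk', if_true, if_false, map_add, map_smul, simpleReflection_simpleRoot_self,
        simpleReflection_simpleRoot, dihedralCoeff_add_two]
      module

lemma prod_alternatingWord_two_mul (i j : B) (n : ℕ) :
    ((CoxeterSystem.alternatingWord i j (2 * n)).map M.simpleReflection).prod =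
      (M.simpleReflection i * M.simpleReflection j) ^ n := by
  induction n with
  | zero => simp [CoxeterSystem.alternatingWord]
  | succ n ih =>
    rw [show 2 * (n + 1) = 2 * n + 1 + 1 by ring, CoxeterSystem.alternatingWord_succ',
      CoxeterSystem.alternatingWord_succ']
    simp [ih, pow_succ', mul_assoc]

lemma simpleReflection_mul_pow_simpleRoot_left {i j : B} (hij : i ≠ j) (hm : M i j ≠ 0) :
    ((M.simpleReflection i * M.simpleReflection j) ^ M i j) (simpleRoot i) = simpleRoot i := by
  have h1 : M i j ≠ 1 := M.off_diagonal i j hij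
  rw [← prod_alternatingWord_two_mul, prod_alternatingWord_simpleRoot M hij]
  simp [dihedralCoeff_two_mul (m := M i j) (by omega),
    dihedralCoeff_two_mul_add_one (m := M i j) (by omega)]

lemma simpleReflection_mul_pow_simpleRoot_right {i j : B} (hij : i ≠ j) (hm : M i j ≠ 0) :
    ((M.simpleReflection i * M.simpleReflection j) ^ M i j) (simpleRoot j) = simpleRoot j := by
  have key : SemiconjBy (M.simpleReflection j) (M.simpleReflection j * M.simpleReflection i)
      (M.simpleReflection i * M.simpleReflection j) := by
    rw [SemiconjBy, ← mul_assoc, mul_assoc (M.simpleReflection i), simpleReflection_mul_self,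
      one_mul, mul_one]
  have h := M.simpleReflection_mul_pow_simpleRoot_left hij.symm (by rwa [M.symmetric])
  have h' := LinearMap.congr_fun (key.pow_right (M i j)).eq (simpleRoot j)
  rw [Module.End.mul_apply, Module.End.mul_apply, simpleReflection_simpleRoot_self, map_neg,
    ← M.symmetric j i, h, simpleReflection_simpleRoot_self, neg_inj] at h'
  rw [← M.symmetric j i, ← h']

lemma isLiftable_simpleReflection : M.IsLiftable M.simpleReflection := by
  intro i j
  by_cases hij : i = j
  · subst hij
    simp [simpleReflection_mul_self]
  by_cases hm : M i j = 0
  · simp [hm]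
  have h1 : M i j ≠ 1 := M.off_diagonal i j hij
  set g := (M.simpleReflection i * M.simpleReflection j) ^ M i j with hg
  have hi : g (simpleRoot i) = simpleRoot i := M.simpleReflection_mul_pow_simpleRoot_left hij hm
  have hj : g (simpleRoot j) = simpleRoot j := M.simpleReflection_mul_pow_simpleRoot_right hij hm
  have hperp : ∀ v, M.canonicalForm (simpleRoot i) v = 0 → M.canonicalForm (simpleRoot j) v = 0 →
      g v = v := by
    intro v hi hj
    have hfix : (M.simpleReflection i * M.simpleReflection j) v = v := by
      simp [simpleReflection_apply, hi, hj]
    rw [hg]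
    induction M i j with
    | zero => simp
    | succ n ih => rw [pow_succ, Module.End.mul_apply, hfix, ih]
  refine LinearMap.ext fun v => ?_
  rw [Module.End.one_apply]
  set c := Real.cos (Real.pi / M i j) with hc
  have hs : 0 < 1 - c ^ 2 := by
    have := sin_pi_div_pos (m := M i j) (by omega)
    have h2 := Real.sin_sq_add_cos_sq (Real.pi / M i j)
    nlinarith
  set p := M.canonicalForm (simpleRoot i) v with hp
  set q := M.canonicalForm (simpleRoot j) v with hq
  set a := (p + c * q) / (1 - c ^ 2) with ha
  set b := (q + c * p) / (1 - c ^ 2) with hb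
  have hv := hperp (v - a • simpleRoot i - b • simpleRoot j)
    (by
      simp only [map_sub, map_smul, smul_eq_mul, canonicalForm_simpleRoot_self,
        canonicalForm_simpleRoot, ← hc, ← hp, ha, hb]
      field_simp
      ring)
    (by
      simp only [map_sub, map_smul, smul_eq_mul, canonicalForm_simpleRoot_self,
        canonicalForm_simpleRoot, M.symmetric j i, ← hc, ← hq, ha, hb]
      field_simp
      ring)
  rw [map_sub, map_sub, map_smul, map_smul, hi, hj] at hv
  simpa using hv

end CoxeterMatrix

namespace CoxeterSystem

section Length

variable {B : Type*} {W : Type*} [Group W] {M : CoxeterMatrix B} (cs : CoxeterSystem M W)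

lemma length_wordProd_alternatingWord_le (i j : B) (k : ℕ) :
    cs.length (cs.wordProd (alternatingWord i j k)) ≤ k := by
  simpa using cs.length_wordProd_le (alternatingWord i j k)

/-- If the alternating word of length `k` ending in `j` is at least as long as the braid word,
its product can be shortened by `i` on the right. -/
lemma length_wordProd_alternatingWord_mul_simple_lt {i j : B} (hm : M i j ≠ 0) {k : ℕ}
    (hk : M i j ≤ k) :
    cs.length (cs.wordProd (alternatingWord i j k) * cs.simple i) < k := by
  induction k, hk using Nat.le_induction with
  | base =>
    obtain ⟨m, hm'⟩ : ∃ m, M i j = m + 1 := Nat.exists_eq_succ_of_ne_zero hm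
    have h := cs.wordProd_braidWord_eq i j
    rw [braidWord, braidWord, ← M.symmetric i j, hm', alternatingWord_succ j i,
      wordProd_concat] at h
    rw [hm', h, simple_mul_simple_cancel_right]
    exact Nat.lt_succ_of_le (cs.length_wordProd_alternatingWord_le i j m)
  | succ k hk ih =>
    rw [alternatingWord_succ', wordProd_cons, mul_assoc]
    refine (cs.length_mul_le _ _).trans_lt ?_
    rw [length_simple]
    omega

end Length

variable {B : Type*} [Fintype B] [DecidableEq B] {W : Type*} [Group W] {M : CoxeterMatrix B}
  (cs : CoxeterSystem M W)

open CoxeterMatrix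

/-- The geometric representation of a Coxeter group. -/
noncomputable def geometricRep : W →* Module.End ℝ (B → ℝ) :=
  cs.lift ⟨M.simpleReflection, M.isLiftable_simpleReflection⟩

lemma geometricRep_simple (i : B) : cs.geometricRep (cs.simple i) = M.simpleReflection i :=
  cs.lift_apply_simple M.isLiftable_simpleReflection i

lemma geometricRep_wordProd (ω : List B) :
    cs.geometricRep (cs.wordProd ω) = (ω.map M.simpleReflection).prod := by
  rw [wordProd, map_list_prod, List.map_map]
  congr 2
  exact funext cs.geometricRep_simple

lemma geometricRep_mul_apply (u v : W) (x : B → ℝ) :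
    cs.geometricRep (u * v) x = cs.geometricRep u (cs.geometricRep v x) := by
  rw [map_mul, Module.End.mul_apply]

lemma geometricRep_simple_simpleRoot (i : B) :
    cs.geometricRep (cs.simple i) (simpleRoot i) = -simpleRoot i := by
  rw [geometricRep_simple, M.simpleReflection_simpleRoot_self]

lemma geometricRep_simple_simple_apply (i : B) (x : B → ℝ) :
    cs.geometricRep (cs.simple i) (cs.geometricRep (cs.simple i) x) = x := by
  rw [← geometricRep_mul_apply, simple_mul_simple_self, map_one, Module.End.one_apply]

lemma canonicalForm_geometricRep (w : W) (x y : B → ℝ) :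
    M.canonicalForm (cs.geometricRep w x) (cs.geometricRep w y) = M.canonicalForm x y := by
  induction w using cs.simple_induction_left with
  | one => simp
  | mul_simple_left w i ih =>
    rw [geometricRep_mul_apply, geometricRep_mul_apply, geometricRep_simple,
      M.canonicalForm_simpleReflection, ih]

/-- A simple root is sent to a nonnegative vector unless the corresponding reflection is a right
descent. -/
theorem geometricRep_simpleRoot_nonneg (w : W) (i : B) (h : ¬ cs.IsRightDescent w i) :
    0 ≤ cs.geometricRep w (simpleRoot i) := by
  induction hn : cs.length w using Nat.strong_induction_on generalizing w i with
  | _ n ih =>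
  subst hn
  have hnonneg : ∀ l : B, (0 : B → ℝ) ≤ simpleRoot l := fun l => by
    simp [simpleRoot]
  by_cases hw : w = 1
  · simpa [hw] using hnonneg i
  obtain ⟨j, hj⟩ := cs.exists_rightDescent_of_ne_one hw
  have hij : i ≠ j := fun e => h (e ▸ hj)
  have hm1 : M i j ≠ 1 := M.off_diagonal i j hij
  let P : ℕ → Prop := fun k => ∃ v : W,
    w = v * cs.wordProd (alternatingWord i j k) ∧ cs.length w = cs.length v + k
  have hP1 : P 1 := by
    refine ⟨w * cs.simple j, by simp [alternatingWord], ?_⟩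
    exact (cs.isRightDescent_iff.1 hj).symm
  have hPle : ∀ k, P k → k ≤ cs.length w := fun k ⟨v, _, hv⟩ => by omega
  classical
  set k := Nat.findGreatest P (cs.length w) with hk
  have hPk : P k := Nat.findGreatest_spec (hPle 1 hP1) hP1
  have hk1 : 1 ≤ k := Nat.le_findGreatest (hPle 1 hP1) hP1
  have hPk1 : ¬ P (k + 1) := fun hP => by
    have := Nat.le_findGreatest (hPle _ hP) hP
    omega
  obtain ⟨v, hwv, hlen⟩ := hPk
  have hfst : ∀ l, l = (if Even k then j else i) → ¬ cs.IsRightDescent v l := by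
    rintro l rfl hl
    refine hPk1 ⟨v * cs.simple (if Even k then j else i), ?_, ?_⟩
    · rw [alternatingWord_succ', wordProd_cons, ← mul_assoc, simple_mul_simple_cancel_right, hwv]
    · have := cs.isRightDescent_iff.1 hl
      omega
  have hsnd : ∀ l, l = (if Even k then i else j) → ¬ cs.IsRightDescent v l := by
    rintro l rfl hl
    obtain ⟨k', hk'⟩ : ∃ k', k = k' + 1 := Nat.exists_eq_add_of_le' hk1
    have e : (if Even k' then j else i) = if Even k then i else j := by
      simp only [hk', Nat.even_add_one]
      split_ifs <;> rfl
    have hw' : w = v * cs.simple (if Even k then i else j) *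
        cs.wordProd (alternatingWord i j k') := by
      rw [hwv, ← e]
      conv_lhs => rw [hk', alternatingWord_succ', wordProd_cons]
      rw [mul_assoc]
    have h1 := cs.isRightDescent_iff.1 hl
    have h2 := cs.length_mul_le (v * cs.simple (if Even k then i else j))
      (cs.wordProd (alternatingWord i j k'))
    rw [← hw'] at h2
    have h3 := cs.length_wordProd_alternatingWord_le i j k'
    omega
  have hvi : 0 ≤ cs.geometricRep v (simpleRoot i) := by
    refine ih _ (by omega) v i ?_ rfl
    by_cases he : Even k
    · exact hsnd i (by simp [he])
    · exact hfst i (by simp [he])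
  have hvj : 0 ≤ cs.geometricRep v (simpleRoot j) := by
    refine ih _ (by omega) v j ?_ rfl
    by_cases he : Even k
    · exact hfst j (by simp [he])
    · exact hsnd j (by simp [he])
  have hkm : M i j = 0 ∨ k + 1 ≤ M i j := by
    by_contra! hcon
    have h1 := cs.length_wordProd_alternatingWord_mul_simple_lt hcon.1 (k := k) (by omega)
    apply h
    rw [IsRightDescent]
    have h2 := cs.length_mul_le v (cs.wordProd (alternatingWord i j k) * cs.simple i)
    rw [← mul_assoc, ← hwv] at h2
    omega
  have hc1 := dihedralCoeff_nonneg hm1 hkm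
  have hc0 := dihedralCoeff_nonneg (k := k) hm1 (hkm.imp_right fun h => by omega)
  rw [hwv, geometricRep_mul_apply, geometricRep_wordProd, M.prod_alternatingWord_simpleRoot hij]
  split_ifs
  · rw [map_add, map_smul, map_smul]
    exact add_nonneg (smul_nonneg hc1 hvi) (smul_nonneg hc0 hvj)
  · rw [map_add, map_smul, map_smul]
    exact add_nonneg (smul_nonneg hc0 hvi) (smul_nonneg hc1 hvj)

theorem geometricRep_simpleRoot_nonpos (w : W) (i : B) (h : cs.IsRightDescent w i) :
    cs.geometricRep w (simpleRoot i) ≤ 0 := by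
  have := cs.geometricRep_simpleRoot_nonneg (w * cs.simple i) i
    (cs.isRightDescent_iff_not_isRightDescent_mul.1 h)
  rwa [geometricRep_mul_apply, geometricRep_simple_simpleRoot, map_neg, Left.nonneg_neg_iff] at this

/-- The roots of a Coxeter system that are nonnegative combinations of simple roots. -/
def positiveRoots : Set (B → ℝ) :=
  {β | (∃ (u : W) (i : B), β = cs.geometricRep u (simpleRoot i)) ∧ 0 ≤ β}

lemma mem_or_neg_mem_positiveRoots (u : W) (i : B) :
    cs.geometricRep u (simpleRoot i) ∈ cs.positiveRoots ∨
      -cs.geometricRep u (simpleRoot i) ∈ cs.positiveRoots := by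
  by_cases h : cs.IsRightDescent u i
  · refine Or.inr ⟨⟨u * cs.simple i, i, ?_⟩, ?_⟩
    · rw [geometricRep_mul_apply, geometricRep_simple_simpleRoot, map_neg]
    · exact neg_nonneg.2 (cs.geometricRep_simpleRoot_nonpos u i h)
  · exact Or.inl ⟨⟨u, i, rfl⟩, cs.geometricRep_simpleRoot_nonneg u i h⟩

lemma canonicalForm_self_of_mem_positiveRoots {β : B → ℝ} (hβ : β ∈ cs.positiveRoots) :
    M.canonicalForm β β = 1 := by
  obtain ⟨⟨u, i, rfl⟩, -⟩ := hβ
  rw [canonicalForm_geometricRep, M.canonicalForm_simpleRoot_self]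

lemma ne_zero_of_mem_positiveRoots {β : B → ℝ} (hβ : β ∈ cs.positiveRoots) : β ≠ 0 := by
  rintro rfl
  simpa using cs.canonicalForm_self_of_mem_positiveRoots hβ

lemma simpleRoot_mem_positiveRoots (i : B) : simpleRoot i ∈ cs.positiveRoots :=
  ⟨⟨1, i, by simp⟩, by simp [simpleRoot]⟩

/-- A simple reflection permutes the positive roots other than its simple root. -/
lemma geometricRep_simple_mem_positiveRoots {β : B → ℝ} (hβ : β ∈ cs.positiveRoots) {i : B}
    (hi : β ≠ simpleRoot i) : cs.geometricRep (cs.simple i) β ∈ cs.positiveRoots := by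
  have hnorm := cs.canonicalForm_self_of_mem_positiveRoots hβ
  obtain ⟨⟨u, j, rfl⟩, hpos⟩ := hβ
  rw [← geometricRep_mul_apply]
  refine (cs.mem_or_neg_mem_positiveRoots (cs.simple i * u) j).resolve_right fun hneg => hi ?_
  set β := cs.geometricRep u (simpleRoot j) with hβ
  have hsupp : β = β i • simpleRoot i := by
    ext l
    by_cases hl : l = i
    · subst hl
      simp [simpleRoot]
    · have h1 := hneg.2 l
      rw [geometricRep_mul_apply, geometricRep_simple, ← hβ, Pi.neg_apply,
        M.simpleReflection_apply_of_ne hl, Pi.zero_apply] at h1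
      have h2 := hpos l
      rw [Pi.zero_apply] at h2
      simp only [simpleRoot, Pi.smul_apply, Pi.single_eq_of_ne hl, smul_zero]
      linarith
  rw [hsupp, map_smul, map_smul, LinearMap.smul_apply, M.canonicalForm_simpleRoot_self] at hnorm
  have hi0 : 0 ≤ β i := hpos i
  have hi1 : β i = 1 := by
    simp only [smul_eq_mul, mul_one] at hnorm
    nlinarith
  rw [hsupp, hi1, one_smul]

/-- Only finitely many positive roots are made negative by a given element. -/
lemma finite_inversionRoots (w : W) :
    {β ∈ cs.positiveRoots | ¬ 0 ≤ cs.geometricRep w β}.Finite := by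
  induction w using cs.simple_induction_right with
  | one =>
    convert Set.finite_empty
    ext β
    simp only [Set.mem_ofPred_eq, map_one, Module.End.one_apply, Set.mem_empty_iff_false, iff_false]
    exact fun h => h.2 h.1.2
  | mul_simple_right w i ih =>
    refine ((ih.image (cs.geometricRep (cs.simple i))).insert (simpleRoot i)).subset ?_
    rintro β ⟨hβ, hneg⟩
    by_cases hi : β = simpleRoot i
    · exact Or.inl hi
    · refine Or.inr ⟨cs.geometricRep (cs.simple i) β,
        ⟨cs.geometricRep_simple_mem_positiveRoots hβ hi, ?_⟩,
        cs.geometricRep_simple_simple_apply i β⟩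
      rwa [geometricRep_mul_apply] at hneg

/-- A functional that is positive on all but finitely many positive roots lies in the Tits cone:
it can be moved to the closed fundamental chamber. -/
lemma exists_forall_simpleRoot_nonneg (x : Module.Dual ℝ (B → ℝ))
    (hx : {β ∈ cs.positiveRoots | x β ≤ 0}.Finite) :
    ∃ u : W, {β ∈ cs.positiveRoots | x (cs.geometricRep u β) ≤ 0}.Finite ∧
      ∀ i, 0 ≤ x (cs.geometricRep u (simpleRoot i)) := by
  induction hn : {β ∈ cs.positiveRoots | x β ≤ 0}.ncard using Nat.strong_induction_on
    generalizing x with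
  | _ n ih =>
  by_cases hall : ∀ i, 0 ≤ x (simpleRoot i)
  · exact ⟨1, by simpa using hx, by simpa using hall⟩
  obtain ⟨i, hi⟩ := not_forall.1 hall
  rw [not_le] at hi
  set s := cs.geometricRep (cs.simple i) with hs
  have hmem : simpleRoot i ∈ {β ∈ cs.positiveRoots | x β ≤ 0} :=
    ⟨cs.simpleRoot_mem_positiveRoots i, hi.le⟩
  have hinj : Function.Injective s :=
    Function.LeftInverse.injective (cs.geometricRep_simple_simple_apply i)
  have hmaps : s '' {β ∈ cs.positiveRoots | (x ∘ₗ s) β ≤ 0} ⊆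
      {β ∈ cs.positiveRoots | x β ≤ 0} \ {simpleRoot i} := by
    rintro _ ⟨β, ⟨hβ, hxβ⟩, rfl⟩
    have hne : β ≠ simpleRoot i := by
      rintro rfl
      rw [LinearMap.comp_apply, hs, geometricRep_simple_simpleRoot, map_neg] at hxβ
      linarith
    refine ⟨⟨cs.geometricRep_simple_mem_positiveRoots hβ hne, hxβ⟩, fun he => ?_⟩
    rw [Set.mem_singleton_iff] at he
    have h1 : β = -simpleRoot i := by
      rw [← cs.geometricRep_simple_simpleRoot i, ← hs, ← he, hs,
        geometricRep_simple_simple_apply]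
    have h2 := hβ.2 i
    simp only [h1, simpleRoot, Pi.zero_apply, Pi.neg_apply, Pi.single_eq_same] at h2
    linarith
  have hfin : {β ∈ cs.positiveRoots | (x ∘ₗ s) β ≤ 0}.Finite :=
    (hx.sdiff.subset hmaps).of_finite_image hinj.injOn
  have hlt : {β ∈ cs.positiveRoots | (x ∘ₗ s) β ≤ 0}.ncard < n := by
    rw [← Set.ncard_image_of_injective _ hinj, ← hn]
    exact (Set.ncard_le_ncard hmaps hx.sdiff).trans_lt (Set.ncard_sdiff_singleton_lt_of_mem hmem hx)
  obtain ⟨u, hu, hu'⟩ := ih _ hlt (x ∘ₗ s) hfin rfl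
  refine ⟨cs.simple i * u, ?_, ?_⟩
  · simpa only [geometricRep_mul_apply, LinearMap.comp_apply] using hu
  · simpa only [geometricRep_mul_apply, LinearMap.comp_apply] using hu'

section Stabilizer

variable {y : Module.Dual ℝ (B → ℝ)}

lemma apply_geometricRep_simple {i : B} (hi : y (simpleRoot i) = 0) (v : B → ℝ) :
    y (cs.geometricRep (cs.simple i) v) = y v := by
  rw [geometricRep_simple, M.simpleReflection_apply, map_sub, map_smul, hi, smul_zero, sub_zero]

lemma dual_nonneg_of_nonneg (hy : ∀ i, 0 ≤ y (simpleRoot i)) {v : B → ℝ} (hv : 0 ≤ v) :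
    0 ≤ y v := by
  have : v = ∑ i, v i • simpleRoot i := by
    simpa [simpleRoot] using pi_eq_sum_univ' v
  rw [this, map_sum]
  refine Finset.sum_nonneg fun i _ => ?_
  rw [map_smul]
  exact mul_nonneg (hv i) (hy i)

lemma apply_simpleRoot_eq_zero_of_isRightDescent (hy : ∀ i, 0 ≤ y (simpleRoot i)) {g : W}
    (hg : ∀ v, y (cs.geometricRep g v) = y v) {i : B} (hi : cs.IsRightDescent g i) :
    y (simpleRoot i) = 0 := by
  refine le_antisymm ?_ (hy i)
  have h := dual_nonneg_of_nonneg hy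
    (neg_nonneg.2 (cs.geometricRep_simpleRoot_nonpos g i hi))
  rw [map_neg, hg] at h
  linarith

/-- The stabilizer of a point in the closed fundamental chamber is a standard parabolic subgroup. -/
lemma mem_closure_of_apply_geometricRep (hy : ∀ i, 0 ≤ y (simpleRoot i)) {g : W}
    (hg : ∀ v, y (cs.geometricRep g v) = y v) :
    g ∈ Subgroup.closure (cs.simple '' {i | y (simpleRoot i) = 0}) := by
  induction hn : cs.length g using Nat.strong_induction_on generalizing g with
  | _ n ih =>
  by_cases h1 : g = 1
  · exact h1 ▸ one_mem _
  obtain ⟨i, hi⟩ := cs.exists_rightDescent_of_ne_one h1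
  have hyi := cs.apply_simpleRoot_eq_zero_of_isRightDescent hy hg hi
  have h := ih _ (hn ▸ hi) (g := g * cs.simple i) (fun v => by
    rw [geometricRep_mul_apply, hg, cs.apply_geometricRep_simple hyi]) rfl
  rw [← cs.simple_mul_simple_cancel_right (w := g) i]
  exact mul_mem h (Subgroup.subset_closure ⟨i, hyi, rfl⟩)

lemma apply_geometricRep_of_mem_closure {g : W}
    (hg : g ∈ Subgroup.closure (cs.simple '' {i | y (simpleRoot i) = 0})) (v : B → ℝ) :
    y (cs.geometricRep g v) = y v := by
  induction hg using Subgroup.closure_induction generalizing v with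
  | mem g hg =>
    obtain ⟨i, hi, rfl⟩ := hg
    exact cs.apply_geometricRep_simple hi v
  | one => simp
  | mul a b _ _ ha hb => rw [geometricRep_mul_apply, ha, hb]
  | inv a _ ha => rw [← ha, ← geometricRep_mul_apply, mul_inv_cancel, map_one, Module.End.one_apply]

lemma finite_closure_of_finite (hy : ∀ i, 0 ≤ y (simpleRoot i))
    (hfin : {β ∈ cs.positiveRoots | y β ≤ 0}.Finite) :
    Finite (Subgroup.closure (cs.simple '' {i | y (simpleRoot i) = 0})) := by
  set N := {β ∈ cs.positiveRoots | y β ≤ 0}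
  set G := Subgroup.closure (cs.simple '' {i | y (simpleRoot i) = 0})
  have : Finite ↥(N ∪ -N) := (hfin.union hfin.neg).to_subtype
  let F : G → {i // y (simpleRoot i) = 0} → ↥(N ∪ -N) := fun g i =>
    ⟨cs.geometricRep g (simpleRoot i), by
      have h0 : y (cs.geometricRep g (simpleRoot i)) = 0 := by
        rw [cs.apply_geometricRep_of_mem_closure g.2, i.2]
      refine (cs.mem_or_neg_mem_positiveRoots g i).imp (fun h => ⟨h, h0.le⟩) fun h => ⟨h, ?_⟩
      rw [map_neg, h0, neg_zero]⟩
  refine Finite.of_injective F fun g₁ g₂ h => ?_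
  by_contra hne
  have hne' : (g₁ : W)⁻¹ * (g₂ : W) ≠ 1 := fun h => hne (Subtype.ext (inv_mul_eq_one.1 h))
  obtain ⟨i, hi⟩ := cs.exists_rightDescent_of_ne_one hne'
  have hyi := cs.apply_simpleRoot_eq_zero_of_isRightDescent hy
    (cs.apply_geometricRep_of_mem_closure (g₁⁻¹ * g₂).2) hi
  have heq : cs.geometricRep g₁ (simpleRoot i) = cs.geometricRep g₂ (simpleRoot i) :=
    congrArg Subtype.val (congrFun h ⟨i, hyi⟩)
  have h1 := cs.geometricRep_simpleRoot_nonpos _ i hi i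
  rw [geometricRep_mul_apply, ← heq, ← geometricRep_mul_apply, inv_mul_cancel, map_one,
    Module.End.one_apply] at h1
  simp only [simpleRoot, Pi.single_eq_same, Pi.zero_apply] at h1
  linarith

end Stabilizer

/-- An element of finite order fixes a functional in the interior of the Tits cone. -/
lemma exists_dual_fixed_of_isOfFinOrder {w : W} (hw : IsOfFinOrder w) :
    ∃ x : Module.Dual ℝ (B → ℝ), (∀ v, x (cs.geometricRep w v) = x v) ∧
      {β ∈ cs.positiveRoots | x β ≤ 0}.Finite := by
  let f : Module.Dual ℝ (B → ℝ) := ∑ i, LinearMap.proj i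
  have hf : ∀ v, f v = ∑ i, v i := fun v => by simp [f]
  let x : Module.Dual ℝ (B → ℝ) :=
    ∑ k ∈ Finset.range (orderOf w), f ∘ₗ cs.geometricRep (w ^ k)
  have hx : ∀ v, x v = ∑ k ∈ Finset.range (orderOf w), f (cs.geometricRep (w ^ k) v) := fun v => by
    simp [x]
  refine ⟨x, fun v => ?_, ?_⟩
  · have h1 := Finset.sum_range_succ (fun k => f (cs.geometricRep (w ^ k) v)) (orderOf w)
    rw [Finset.sum_range_succ', pow_orderOf_eq_one, pow_zero, add_left_inj] at h1
    rw [hx, hx, ← h1]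
    refine Finset.sum_congr rfl fun k _ => ?_
    rw [← geometricRep_mul_apply, pow_succ]
  · refine ((Finset.range (orderOf w)).finite_toSet.biUnion fun k _ =>
      cs.finite_inversionRoots (w ^ k)).subset ?_
    rintro β ⟨hβ, hxβ⟩
    by_contra hcon
    simp only [Set.mem_iUnion, Set.mem_ofPred_eq, not_exists, not_and, not_not] at hcon
    refine hxβ.not_gt ?_
    rw [hx]
    refine Finset.sum_pos' (fun k hk => ?_) ⟨0, Finset.mem_range.2 hw.orderOf_pos, ?_⟩
    · rw [hf]
      exact Finset.sum_nonneg fun i _ => hcon k hk hβ i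
    · rw [pow_zero, map_one, Module.End.one_apply, hf]
      refine (Finset.sum_nonneg fun i _ => hβ.2 i).lt_of_ne' fun h0 =>
        cs.ne_zero_of_mem_positiveRoots hβ (funext fun i => ?_)
      exact (Finset.sum_eq_zero_iff_of_nonneg fun i _ => hβ.2 i).1 h0 i (Finset.mem_univ i)

end CoxeterSystem

/-- Every element of finite order in a Coxeter group (with finitely many simple
reflections) is conjugate to an element of a finite standard parabolic subgroup. -/
theorem coxeter_torsion_conjugate_into_finite_parabolic
    {B : Type*} [Finite B] {W : Type*} [Group W]
    (M : CoxeterMatrix B) (cs : CoxeterSystem M W)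
    (w : W) (hw : IsOfFinOrder w) :
    ∃ S' : Set B, Finite ↥(Subgroup.closure (cs.simple '' S')) ∧
      ∃ u : W, u * w * u⁻¹ ∈ Subgroup.closure (cs.simple '' S') := by
  classical
  have := Fintype.ofFinite B
  obtain ⟨x, hx, hfin⟩ := cs.exists_dual_fixed_of_isOfFinOrder hw
  obtain ⟨u, hu, hpos⟩ := cs.exists_forall_simpleRoot_nonneg x hfin
  let y : Module.Dual ℝ (B → ℝ) := x ∘ₗ cs.geometricRep u
  refine ⟨{i | y (CoxeterMatrix.simpleRoot i) = 0},
    cs.finite_closure_of_finite (y := y) hpos hu, u⁻¹,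
    cs.mem_closure_of_apply_geometricRep (y := y) hpos fun v => ?_⟩
  simp only [y, LinearMap.comp_apply, ← cs.geometricRep_mul_apply]
  rw [show u * (u⁻¹ * w * u⁻¹⁻¹) = w * u by group, cs.geometricRep_mul_apply, hx]
end

section
/- Let p be a prime. (i) For n ≥ 1, in the Coxeter group of type Aₙ (generators s₁,…,sₙ with m(i,i+1) = 3 for 1 ≤ i ≤ n−1 and m(i,j) = 2 for |i−j| ≥ 2), the number of conjugacy classes consisting of elements of order p equals ⌊(n+1)/p⌋. (ii) For n ≥ 2, in the Coxeter group of type Bₙ (generators s₁,…,sₙ with m(i,i+1) = 3 for 1 ≤ i ≤ n−2, m(n−1,n) = 4, and m(i,j) = 2 for |i−j| ≥ 2), the number of conjugacy classes of elements of order 2 equals the number of pairs (k,m) of non-negative integers with k + m ≥ 1 and 2k + m ≤ n, and if p ≥ 3 the number of conjugacy classes of elements of order p equals ⌊n/p⌋. -/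
open Equiv Function

/-! ### Groups generated by involutions satisfying braid relations -/

theorem closure_involutions_induction {G : Type*} [Group G] {S : Set G}
    (hS : ∀ y ∈ S, y * y = 1) {P : G → Prop} (one : P 1)
    (mul_right : ∀ x, P x → ∀ y ∈ S, P (x * y)) {x : G} (hx : x ∈ Subgroup.closure S) : P x := by
  induction hx using Subgroup.closure_induction_right with
  | one => exact one
  | mul_right x _ y hy ih => exact mul_right x ih y hy
  | mul_inv_cancel x _ y hy ih =>
    rw [inv_eq_of_mul_eq_one_right (hS y hy)]
    exact mul_right x ih y hy

theorem commute_of_mem_closure {G : Type*} [Group G] {S : Set G} {g x : G}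
    (hS : ∀ y ∈ S, Commute y g) (hx : x ∈ Subgroup.closure S) : Commute x g := by
  have h : Subgroup.closure S ≤ Subgroup.centralizer {g} := by
    rw [Subgroup.closure_le]
    intro y hy
    exact Subgroup.mem_centralizer_singleton_iff.2 (hS y hy)
  exact Subgroup.mem_centralizer_singleton_iff.1 (h hx)

/-- The first `n` terms of `s` satisfy the Coxeter relations of type `A`. -/
structure TypeARelations {G : Type*} [Group G] (s : ℕ → G) (n : ℕ) : Prop where
  sq : ∀ i < n, s i * s i = 1
  comm : ∀ i j, i + 2 ≤ j → j < n → Commute (s i) (s j)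
  braid : ∀ i, i + 1 < n → s (i + 1) * s i * s (i + 1) = s i * s (i + 1) * s i

/-- The products `s (k - 1) * s (k - 2) * ⋯ * s j` with `j ≤ k`. -/
def descendingProducts {G : Type*} [Group G] (s : ℕ → G) : ℕ → Set G
  | 0 => {1}
  | k + 1 => insert 1 ((s k * ·) '' descendingProducts s k)

theorem one_mem_descendingProducts {G : Type*} [Group G] (s : ℕ → G) (k : ℕ) :
    1 ∈ descendingProducts s k := by
  cases k <;> simp [descendingProducts]

theorem finite_descendingProducts {G : Type*} [Group G] (s : ℕ → G) (k : ℕ) :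
    (descendingProducts s k).Finite := by
  induction k with
  | zero => exact Set.finite_singleton 1
  | succ k ih => exact (ih.image _).insert 1

theorem ncard_descendingProducts_le {G : Type*} [Group G] (s : ℕ → G) (k : ℕ) :
    (descendingProducts s k).ncard ≤ k + 1 := by
  induction k with
  | zero => simp [descendingProducts]
  | succ k ih =>
    calc _ ≤ ((s k * ·) '' descendingProducts s k).ncard + 1 := Set.ncard_insert_le _ _
      _ ≤ _ := by
        gcongr
        exact (Set.ncard_image_le (finite_descendingProducts s k)).trans ih

theorem descendingProducts_subset_closure {G : Type*} [Group G] (s : ℕ → G) (k : ℕ) :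
    descendingProducts s k ⊆ Subgroup.closure (s '' Set.Iio k) := by
  induction k with
  | zero => simp [descendingProducts]
  | succ k ih =>
    rintro x (rfl | ⟨u, hu, rfl⟩)
    · exact one_mem _
    · refine mul_mem (Subgroup.subset_closure ⟨k, k.lt_succ_self, rfl⟩) ?_
      exact Subgroup.closure_mono (Set.image_mono (Set.Iio_subset_Iio k.le_succ)) (ih hu)

namespace TypeARelations

variable {G : Type*} [Group G] {s : ℕ → G} {n : ℕ}

theorem exists_eq_mul (h : TypeARelations s n) {k : ℕ} (hk : k ≤ n) {x : G}
    (hx : x ∈ Subgroup.closure (s '' Set.Iio k)) :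
    ∃ a ∈ Subgroup.closure (s '' Set.Iio (k - 1)), ∃ u ∈ descendingProducts s k, x = a * u := by
  induction k generalizing x with
  | zero =>
    obtain rfl : x = 1 := by simpa using hx
    exact ⟨1, one_mem _, 1, one_mem_descendingProducts s 0, by simp⟩
  | succ k ih =>
    have hcomm : ∀ m, m + 1 ≤ k → ∀ y ∈ Subgroup.closure (s '' Set.Iio m), Commute y (s k) := by
      intro m hm y hy
      refine commute_of_mem_closure ?_ hy
      rintro _ ⟨i, hi, rfl⟩
      exact h.comm i k (by have : i < m := hi; omega) hk
    have hcomm' : ∀ y ∈ Subgroup.closure (s '' Set.Iio (k - 1)), Commute y (s k) := by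
      intro y hy
      obtain _ | k := k
      · obtain rfl : y = 1 := by simpa using hy
        exact Commute.one_left _
      · exact hcomm k le_rfl y hy
    have hle : Subgroup.closure (s '' Set.Iio (k - 1)) ≤ Subgroup.closure (s '' Set.Iio k) :=
      Subgroup.closure_mono (Set.image_mono (Set.Iio_subset_Iio (Nat.sub_le k 1)))
    refine closure_involutions_induction
      (P := fun x => ∃ a ∈ Subgroup.closure (s '' Set.Iio (k + 1 - 1)),
        ∃ u ∈ descendingProducts s (k + 1), x = a * u) ?_ ?_ ?_ hx
    · rintro _ ⟨i, hi, rfl⟩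
      exact h.sq i (lt_of_lt_of_le hi hk)
    · exact ⟨1, one_mem _, 1, one_mem_descendingProducts s _, by simp⟩
    · rintro _ ⟨a, ha, u, hu, rfl⟩ _ ⟨i, hi, rfl⟩
      simp only [Nat.add_sub_cancel] at ha ⊢
      rcases (Nat.lt_succ_iff.1 hi).lt_or_eq with hik | rfl
      · have hs : s i ∈ Subgroup.closure (s '' Set.Iio k) := Subgroup.subset_closure ⟨i, hik, rfl⟩
        rcases hu with rfl | ⟨u, hu, rfl⟩
        · exact ⟨a * s i, mul_mem ha hs, 1, one_mem_descendingProducts s _, by simp⟩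
        · obtain ⟨b, hb, v, hv, hbv⟩ := ih (Nat.le_of_succ_le hk)
            (mul_mem (descendingProducts_subset_closure s k hu) hs)
          refine ⟨a * b, mul_mem ha (hle hb), s k * v, Or.inr ⟨v, hv, rfl⟩, ?_⟩
          have := (hcomm' b hb).eq
          simp only [mul_assoc, hbv]
          rw [← mul_assoc (s k) b, ← this, mul_assoc]
      · rcases hu with rfl | ⟨u, hu, rfl⟩
        · exact ⟨a, ha, s i * 1, Or.inr ⟨1, one_mem_descendingProducts s _, rfl⟩, by simp⟩
        · obtain _ | k := i
          · obtain rfl : u = 1 := hu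
            exact ⟨a, ha, 1, one_mem_descendingProducts s _, by simp [mul_assoc, h.sq 0 hk]⟩
          · rcases hu with rfl | ⟨v, hv, rfl⟩
            · exact ⟨a, ha, 1, one_mem_descendingProducts s _, by
                simp [mul_assoc, h.sq (k + 1) hk]⟩
            · refine ⟨a * s k, mul_mem ha (Subgroup.subset_closure ⟨k, k.lt_succ_self, rfl⟩),
                s (k + 1) * (s k * v), Or.inr ⟨_, Or.inr ⟨v, hv, rfl⟩, rfl⟩, ?_⟩
              have := (hcomm k le_rfl v (descendingProducts_subset_closure s k hv)).eq
              calc a * (s (k + 1) * (s k * v)) * s (k + 1)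
                  = a * (s (k + 1) * s k * s (k + 1) * v) := by simp only [mul_assoc, this]
                _ = _ := by rw [h.braid k hk]; simp only [mul_assoc]

theorem finite_and_card_closure_le (h : TypeARelations s n) {k : ℕ} (hk : k ≤ n) :
    (Subgroup.closure (s '' Set.Iio k) : Set G).Finite ∧
      (Subgroup.closure (s '' Set.Iio k) : Set G).ncard ≤ (k + 1).factorial := by
  induction k with
  | zero => simp
  | succ k ih =>
    obtain ⟨hf, hc⟩ := ih (Nat.le_of_succ_le hk)
    have hsub : (Subgroup.closure (s '' Set.Iio (k + 1)) : Set G) ⊆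
        Set.image2 (· * ·) (Subgroup.closure (s '' Set.Iio k)) (descendingProducts s (k + 1)) := by
      intro x hx
      obtain ⟨a, ha, u, hu, rfl⟩ := h.exists_eq_mul hk hx
      exact ⟨a, ha, u, hu, rfl⟩
    have hfin := hf.image2 (· * ·) (finite_descendingProducts s (k + 1))
    refine ⟨hfin.subset hsub, (Set.ncard_le_ncard hsub hfin).trans ?_⟩
    refine (Set.natCard_mul_le).trans ?_
    rw [Nat.factorial_succ, mul_comm (k + 1 + 1)]
    exact Nat.mul_le_mul hc (ncard_descendingProducts_le s (k + 1))

end TypeARelations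

/-- The first `n` terms of `t` satisfy the Coxeter relations of type `B`, with `t 0` at the end of
the edge labelled `4`. -/
structure TypeBRelations {G : Type*} [Group G] (t : ℕ → G) (n : ℕ) : Prop where
  sq : ∀ i < n, t i * t i = 1
  comm : ∀ i j, i + 2 ≤ j → j < n → Commute (t i) (t j)
  braid : ∀ i, 1 ≤ i → i + 1 < n → t (i + 1) * t i * t (i + 1) = t i * t (i + 1) * t i
  quad : 1 < n → Commute (t 0) (t 1 * t 0 * t 1)

/-- The conjugates `t j * ⋯ * t 1 * t 0 * t 1 * ⋯ * t j`. -/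
def shortRoot {G : Type*} [Group G] (t : ℕ → G) : ℕ → G
  | 0 => t 0
  | j + 1 => t (j + 1) * shortRoot t j * t (j + 1)

namespace TypeBRelations

variable {G : Type*} [Group G] {t : ℕ → G} {n : ℕ}

theorem typeA (h : TypeBRelations t n) : TypeARelations (fun i => t (i + 1)) (n - 1) where
  sq i hi := h.sq _ (by omega)
  comm i j hij hj := h.comm _ _ (by omega) (by omega)
  braid i hi := h.braid _ (by omega) (by omega)

theorem commute_shortRoot_of_gt (h : TypeBRelations t n) {i j : ℕ} (hij : j + 2 ≤ i) (hi : i < n) :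
    Commute (t i) (shortRoot t j) := by
  induction j with
  | zero => exact (h.comm 0 i hij hi).symm
  | succ j ih =>
    have := (h.comm (j + 1) i hij hi).symm
    exact (this.mul_right (ih (by omega))).mul_right this

theorem commute_shortRoot_of_lt (h : TypeBRelations t n) {i j : ℕ} (h0 : 1 ≤ i) (hij : i < j)
    (hj : j < n) : Commute (t i) (shortRoot t j) := by
  induction j, hij using Nat.le_induction with
  | base =>
    obtain ⟨i, rfl⟩ := Nat.exists_eq_add_of_le' h0
    have h1 := h.commute_shortRoot_of_gt (j := i) (i := i + 2) le_rfl hj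
    have h2 := h.braid (i + 1) h0 hj
    change t (i + 1) * (t (i + 2) * (t (i + 1) * shortRoot t i * t (i + 1)) * t (i + 2)) =
      (t (i + 2) * (t (i + 1) * shortRoot t i * t (i + 1)) * t (i + 2)) * t (i + 1)
    calc _ = (t (i + 1) * t (i + 2) * t (i + 1)) * shortRoot t i * t (i + 1) * t (i + 2) := by
          simp only [mul_assoc]
      _ = (t (i + 2) * t (i + 1)) * (t (i + 2) * shortRoot t i) * t (i + 1) * t (i + 2) := by
          rw [← h2]; simp only [mul_assoc]
      _ = (t (i + 2) * t (i + 1)) * shortRoot t i * (t (i + 2) * t (i + 1) * t (i + 2)) := by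
          rw [h1.eq]; simp only [mul_assoc]
      _ = _ := by rw [h2]; simp only [mul_assoc]
  | succ j hij ih =>
    have := h.comm i (j + 1) (by omega) hj
    exact (this.mul_right (ih (by omega))).mul_right this

theorem shortRoot_mul_self (h : TypeBRelations t n) {j : ℕ} (hj : j < n) :
    shortRoot t j * shortRoot t j = 1 := by
  induction j with
  | zero => exact h.sq 0 hj
  | succ j ih =>
    have h1 := h.sq (j + 1) hj
    calc t (j + 1) * shortRoot t j * t (j + 1) * (t (j + 1) * shortRoot t j * t (j + 1))
        = t (j + 1) * (shortRoot t j * (t (j + 1) * t (j + 1)) * shortRoot t j) * t (j + 1) := by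
          simp only [mul_assoc]
      _ = 1 := by rw [h1, mul_one, ih (by omega), mul_one, h1]

theorem commute_shortRoot (h : TypeBRelations t n) {i j : ℕ} (hij : i < j) (hj : j < n) :
    Commute (shortRoot t i) (shortRoot t j) := by
  induction i with
  | zero =>
    induction j, hij using Nat.le_induction with
    | base => exact h.quad hj
    | succ j hij ih =>
      have := h.comm 0 (j + 1) (by omega) hj
      exact (this.mul_right (ih (by omega))).mul_right this
  | succ i ih =>
    have := h.commute_shortRoot_of_lt (Nat.succ_pos i) hij hj
    exact (this.mul_left (ih (by omega))).mul_left this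

theorem finite_and_card_closure_shortRoot_le (h : TypeBRelations t n) {k : ℕ} (hk : k ≤ n) :
    (Subgroup.closure (shortRoot t '' Set.Iio k) : Set G).Finite ∧
      (Subgroup.closure (shortRoot t '' Set.Iio k) : Set G).ncard ≤ 2 ^ k := by
  induction k with
  | zero => simp
  | succ k ih =>
    obtain ⟨hf, hc⟩ := ih (Nat.le_of_succ_le hk)
    have hsub : (Subgroup.closure (shortRoot t '' Set.Iio (k + 1)) : Set G) ⊆
        Set.image2 (· * ·) (Subgroup.closure (shortRoot t '' Set.Iio k)) {1, shortRoot t k} := by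
      intro x hx
      refine closure_involutions_induction
        (P := fun x => x ∈ Set.image2 (· * ·) _ _) ?_ ?_ ?_ hx
      · rintro _ ⟨i, hi, rfl⟩
        exact h.shortRoot_mul_self (lt_of_lt_of_le hi hk)
      · exact ⟨1, one_mem _, 1, by simp, by simp⟩
      · rintro _ ⟨a, ha, u, hu, rfl⟩ _ ⟨i, hi, rfl⟩
        rcases (Nat.lt_succ_iff.1 hi).lt_or_eq with hik | rfl
        · have hr := (h.commute_shortRoot hik hk).eq
          refine ⟨a * shortRoot t i,
            mul_mem ha (Subgroup.subset_closure ⟨i, hik, rfl⟩), u, hu, ?_⟩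
          rcases hu with rfl | rfl
          · simp
          · simp only [mul_assoc, hr]
        · rcases hu with rfl | rfl
          · exact ⟨a, ha, _, Or.inr rfl, by simp⟩
          · exact ⟨a, ha, 1, Or.inl rfl, by simp [mul_assoc, h.shortRoot_mul_self hk]⟩
    have hfin := hf.image2 (· * ·) (Set.toFinite {1, shortRoot t k})
    refine ⟨hfin.subset hsub, (Set.ncard_le_ncard hsub hfin).trans ?_⟩
    refine (Set.natCard_mul_le).trans ?_
    rw [pow_succ]
    refine Nat.mul_le_mul hc ((Set.ncard_insert_le _ _).trans ?_)
    simp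

theorem conj_mem_closure_shortRoot (h : TypeBRelations t n) {u x : G}
    (hu : u ∈ Subgroup.closure ((fun i => t (i + 1)) '' Set.Iio (n - 1)))
    (hx : x ∈ Subgroup.closure (shortRoot t '' Set.Iio n)) :
    u * x * u⁻¹ ∈ Subgroup.closure (shortRoot t '' Set.Iio n) := by
  have hgen : ∀ i, i + 1 < n → ∀ j < n,
      t (i + 1) * shortRoot t j * t (i + 1) ∈ Subgroup.closure (shortRoot t '' Set.Iio n) := by
    intro i hi j hj
    have hsq := h.sq (i + 1) hi
    rcases lt_trichotomy (i + 1) j with hij | rfl | hij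
    · rw [(h.commute_shortRoot_of_lt (Nat.succ_pos i) hij hj).eq, mul_assoc, hsq, mul_one]
      exact Subgroup.subset_closure ⟨j, hj, rfl⟩
    · refine Subgroup.subset_closure ⟨i, show i < n by omega, ?_⟩
      change _ = t (i + 1) * (t (i + 1) * shortRoot t i * t (i + 1)) * t (i + 1)
      rw [mul_assoc (t (i + 1)) (shortRoot t i), ← mul_assoc, hsq, one_mul, mul_assoc, hsq, mul_one]
    · rcases (Nat.lt_succ_iff.1 hij).lt_or_eq with hij | rfl
      · rw [(h.commute_shortRoot_of_gt (Nat.succ_le_succ hij) hi).eq, mul_assoc, hsq, mul_one]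
        exact Subgroup.subset_closure ⟨j, hj, rfl⟩
      · exact Subgroup.subset_closure ⟨j + 1, hi, rfl⟩
  have hconj : ∀ i, i + 1 < n → ∀ x ∈ Subgroup.closure (shortRoot t '' Set.Iio n),
      t (i + 1) * x * t (i + 1) ∈ Subgroup.closure (shortRoot t '' Set.Iio n) := by
    intro i hi x hx
    refine closure_involutions_induction (P := fun x => t (i + 1) * x * t (i + 1) ∈
      Subgroup.closure (shortRoot t '' Set.Iio n)) ?_ ?_ ?_ hx
    · rintro _ ⟨j, hj, rfl⟩
      exact h.shortRoot_mul_self hj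
    · rw [mul_one, h.sq _ hi]
      exact one_mem _
    · rintro x hx _ ⟨j, hj, rfl⟩
      have : t (i + 1) * (x * shortRoot t j) * t (i + 1) =
          t (i + 1) * x * t (i + 1) * (t (i + 1) * shortRoot t j * t (i + 1)) := by
        rw [mul_assoc (t (i + 1)) (shortRoot t j), ← mul_assoc _ (t (i + 1)),
          mul_assoc (t (i + 1) * x), h.sq _ hi, mul_one]
        simp only [mul_assoc]
      rw [this]
      exact mul_mem hx (hgen i hi j hj)
  refine closure_involutions_induction
    (P := fun u => ∀ x ∈ Subgroup.closure (shortRoot t '' Set.Iio n),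
      u * x * u⁻¹ ∈ Subgroup.closure (shortRoot t '' Set.Iio n)) ?_ ?_ ?_ hu x hx
  · rintro _ ⟨i, hi, rfl⟩
    exact h.sq _ (Nat.add_lt_of_lt_sub hi)
  · simp
  · rintro u ih _ ⟨i, hi, rfl⟩ x hx
    have hi' : i + 1 < n := Nat.add_lt_of_lt_sub hi
    have := ih _ (hconj i hi' x hx)
    rw [mul_inv_rev, inv_eq_of_mul_eq_one_right (h.sq _ hi')]
    simpa only [mul_assoc] using this

theorem finite_and_card_closure_le (h : TypeBRelations t n) (hn : 1 ≤ n) :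
    (Subgroup.closure (t '' Set.Iio n) : Set G).Finite ∧
      (Subgroup.closure (t '' Set.Iio n) : Set G).ncard ≤ 2 ^ n * n.factorial := by
  obtain ⟨hf, hc⟩ := h.finite_and_card_closure_shortRoot_le le_rfl
  obtain ⟨hf', hc'⟩ := h.typeA.finite_and_card_closure_le le_rfl
  have hsub : (Subgroup.closure (t '' Set.Iio n) : Set G) ⊆
      Set.image2 (· * ·) (Subgroup.closure (shortRoot t '' Set.Iio n))
        (Subgroup.closure ((fun i => t (i + 1)) '' Set.Iio (n - 1))) := by
    intro x hx
    refine closure_involutions_induction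
      (P := fun x => x ∈ Set.image2 (· * ·) _ _) ?_ ?_ ?_ hx
    · rintro _ ⟨i, hi, rfl⟩
      exact h.sq i hi
    · exact ⟨1, one_mem _, 1, one_mem _, by simp⟩
    · rintro _ ⟨a, ha, u, hu, rfl⟩ _ ⟨i, hi, rfl⟩
      obtain _ | i := i
      · refine ⟨a * (u * t 0 * u⁻¹), mul_mem ha (h.conj_mem_closure_shortRoot hu
          (Subgroup.subset_closure ⟨0, hn, rfl⟩)), u, hu, ?_⟩
        simp [mul_assoc]
      · refine ⟨a, ha, u * t (i + 1), mul_mem hu (Subgroup.subset_closure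
          ⟨i, Nat.lt_sub_of_add_lt hi, rfl⟩), ?_⟩
        simp [mul_assoc]
  have hfin := hf.image2 (· * ·) hf'
  refine ⟨hfin.subset hsub, (Set.ncard_le_ncard hsub hfin).trans ?_⟩
  refine (Set.natCard_mul_le).trans ?_
  rw [Nat.sub_add_cancel hn] at hc'
  exact Nat.mul_le_mul hc hc'

end TypeBRelations

/-! ### Identification of the Coxeter groups of types `A` and `B` -/

section CoxeterRelations

variable {G : Type*} [Group G] {a b : G}

theorem commute_of_mul_sq_eq_one (ha : a * a = 1) (hb : b * b = 1) (h : (a * b) ^ 2 = 1) :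
    Commute a b := by
  have h' : (a * b)⁻¹ = a * b := inv_eq_of_mul_eq_one_right (by rw [← sq, h])
  rw [mul_inv_rev, inv_eq_of_mul_eq_one_right ha, inv_eq_of_mul_eq_one_right hb] at h'
  exact h'.symm

theorem braid_of_mul_pow_three_eq_one (ha : a * a = 1) (hb : b * b = 1) (h : (a * b) ^ 3 = 1) :
    b * a * b = a * b * a := by
  have h' : (b * a * b)⁻¹ = a * b * a := inv_eq_of_mul_eq_one_left (by
    rw [← h]; simp only [pow_succ, pow_zero, one_mul, mul_assoc])
  rw [← h', mul_inv_rev, mul_inv_rev, inv_eq_of_mul_eq_one_right ha,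
    inv_eq_of_mul_eq_one_right hb, mul_assoc]

theorem commute_conj_of_mul_pow_four_eq_one (ha : a * a = 1) (hb : b * b = 1)
    (h : (a * b) ^ 4 = 1) : Commute a (b * a * b) := by
  refine commute_of_mul_sq_eq_one ha ?_ ?_
  · rw [show b * a * b * (b * a * b) = b * (a * (b * b) * a) * b by simp only [mul_assoc],
      hb, mul_one, ha, mul_one, hb]
  · rw [← h]; simp only [pow_succ, pow_zero, one_mul, mul_assoc]

theorem isLiftable_of_lt {n : ℕ} {M : CoxeterMatrix (Fin n)} {f : Fin n → G}
    (hsq : ∀ i, f i * f i = 1) (h : ∀ i j, i < j → (f i * f j) ^ M i j = 1) :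
    M.IsLiftable f := by
  intro i j
  rcases lt_trichotomy i j with hij | rfl | hij
  · exact h i j hij
  · simp [hsq]
  · have : f i * f j = (f j * f i)⁻¹ := by
      rw [mul_inv_rev, inv_eq_of_mul_eq_one_right (hsq i), inv_eq_of_mul_eq_one_right (hsq j)]
    rw [this, inv_pow, M.symmetric, h j i hij, inv_one]

end CoxeterRelations

theorem swap_mul_swap_pow_three {α : Type*} [DecidableEq α] [Fintype α] {a b c : α} (hab : a ≠ b)
    (hac : a ≠ c) (hbc : b ≠ c) : (swap a b * swap b c) ^ 3 = 1 := by
  rw [swap_comm a b, ← (Perm.isThreeCycle_swap_mul_swap_same hab.symm hbc hac).orderOf]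
  exact pow_orderOf_eq_one _

theorem swap_mul_swap_sq {α : Type*} [DecidableEq α] {a b c d : α}
    (h : [a, b, c, d].Nodup) : (swap a b * swap c d) ^ 2 = 1 := by
  rw [(Perm.disjoint_swap_swap h).commute.mul_pow]
  simp [sq]

namespace CoxeterMatrix

theorem A_apply {n : ℕ} (i j : Fin n) : CoxeterMatrix.A n i j =
    if i = j then 1 else (if (j : ℕ) + 1 = i ∨ (i : ℕ) + 1 = j then 3 else 2) := rfl

theorem B_apply {n : ℕ} (i j : Fin n) : CoxeterMatrix.B n i j =
    if i = j then 1 else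
      (if (i : ℕ) = n - 1 ∧ (j : ℕ) = n - 2 ∨ (j : ℕ) = n - 1 ∧ (i : ℕ) = n - 2 then 4
        else (if (j : ℕ) + 1 = i ∨ (i : ℕ) + 1 = j then 3 else 2)) := rfl

variable {n : ℕ} (M : CoxeterMatrix (Fin n))

theorem simple_mul_self (i : Fin n) : M.simple i * M.simple i = 1 :=
  M.toCoxeterSystem.simple_mul_simple_self i

theorem simple_mul_pow (i j : Fin n) : (M.simple i * M.simple j) ^ M i j = 1 :=
  M.toCoxeterSystem.simple_mul_simple_pow i j

theorem closure_range_simple : Subgroup.closure (Set.range M.simple) = ⊤ :=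
  M.toCoxeterSystem.subgroup_closure_range_simple

/-- The `i`-th simple reflection, with value `1` for `i` out of range. -/
def natSimple (i : ℕ) : M.Group := if h : i < n then M.simple ⟨i, h⟩ else 1

theorem natSimple_of_lt {i : ℕ} (h : i < n) : M.natSimple i = M.simple ⟨i, h⟩ := dif_pos h

theorem natSimple_mul_self (i : ℕ) : M.natSimple i * M.natSimple i = 1 := by
  unfold natSimple
  split_ifs
  · exact M.simple_mul_self _
  · exact one_mul 1

theorem closure_natSimple_image : Subgroup.closure (M.natSimple '' Set.Iio n) = ⊤ := by
  rw [← M.closure_range_simple]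
  congr 1
  ext x
  constructor
  · rintro ⟨i, hi, rfl⟩
    exact ⟨⟨i, hi⟩, (M.natSimple_of_lt hi).symm⟩
  · rintro ⟨i, rfl⟩
    exact ⟨i, i.2, M.natSimple_of_lt i.2⟩

theorem natSimple_mul_pow {i j : ℕ} (hi : i < n) (hj : j < n) :
    (M.natSimple i * M.natSimple j) ^ M ⟨i, hi⟩ ⟨j, hj⟩ = 1 := by
  rw [M.natSimple_of_lt hi, M.natSimple_of_lt hj, M.simple_mul_pow]

theorem typeARelations_natSimple (n : ℕ) :
    TypeARelations (CoxeterMatrix.A n).natSimple n where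
  sq i _ := natSimple_mul_self _ i
  comm i j hij hj := by
    have hi : i < n := by omega
    have h := (CoxeterMatrix.A n).natSimple_mul_pow hi hj
    rw [A_apply, if_neg (by simp; omega), if_neg (by simp; omega)] at h
    exact commute_of_mul_sq_eq_one (natSimple_mul_self _ i) (natSimple_mul_self _ j) h
  braid i hi := by
    have h := (CoxeterMatrix.A n).natSimple_mul_pow (Nat.lt_of_succ_lt hi) hi
    rw [A_apply, if_neg (by simp), if_pos (by simp)] at h
    exact braid_of_mul_pow_three_eq_one (natSimple_mul_self _ _) (natSimple_mul_self _ _) h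

theorem typeBRelations_natSimple (n : ℕ) :
    TypeBRelations (fun i => (CoxeterMatrix.B n).natSimple (n - 1 - i)) n where
  sq i _ := natSimple_mul_self _ _
  comm i j hij hj := by
    have h := (CoxeterMatrix.B n).natSimple_mul_pow (i := n - 1 - i) (j := n - 1 - j)
      (by omega) (by omega)
    rw [B_apply, if_neg (by simp; omega), if_neg (by simp; omega), if_neg (by simp; omega)] at h
    exact commute_of_mul_sq_eq_one (natSimple_mul_self _ _) (natSimple_mul_self _ _) h
  braid i h1 hi := by
    have h := (CoxeterMatrix.B n).natSimple_mul_pow (i := n - 1 - i) (j := n - 1 - (i + 1))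
      (by omega) (by omega)
    rw [B_apply, if_neg (by simp; omega), if_neg (by simp; omega), if_pos (by simp; omega)] at h
    exact braid_of_mul_pow_three_eq_one (natSimple_mul_self _ _) (natSimple_mul_self _ _) h
  quad hn := by
    have h := (CoxeterMatrix.B n).natSimple_mul_pow (i := n - 1 - 0) (j := n - 1 - 1)
      (by omega) (by omega)
    rw [B_apply, if_neg (by simp; omega), if_pos (by simp; omega)] at h
    exact commute_conj_of_mul_pow_four_eq_one (natSimple_mul_self _ _) (natSimple_mul_self _ _) h

theorem finite_and_card_A_le (n : ℕ) : Finite (CoxeterMatrix.A n).Group ∧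
    Nat.card (CoxeterMatrix.A n).Group ≤ (n + 1).factorial := by
  have h := (typeARelations_natSimple n).finite_and_card_closure_le le_rfl
  rw [closure_natSimple_image, Subgroup.coe_top, Set.ncard_univ] at h
  exact ⟨Set.finite_univ_iff.1 h.1, h.2⟩

theorem finite_and_card_B_le {n : ℕ} (hn : 1 ≤ n) : Finite (CoxeterMatrix.B n).Group ∧
    Nat.card (CoxeterMatrix.B n).Group ≤ 2 ^ n * n.factorial := by
  have h := (typeBRelations_natSimple n).finite_and_card_closure_le hn
  have himage : (fun i => (CoxeterMatrix.B n).natSimple (n - 1 - i)) '' Set.Iio n =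
      (CoxeterMatrix.B n).natSimple '' Set.Iio n := by
    ext x
    constructor
    · rintro ⟨i, hi, rfl⟩
      exact ⟨n - 1 - i, show n - 1 - i < n by omega, rfl⟩
    · rintro ⟨i, hi, rfl⟩
      have hi : i < n := hi
      exact ⟨n - 1 - i, show n - 1 - i < n by omega, by
        simp only [show n - 1 - (n - 1 - i) = i by omega]⟩
  rw [himage, closure_natSimple_image, Subgroup.coe_top, Set.ncard_univ] at h
  exact ⟨Set.finite_univ_iff.1 h.1, h.2⟩

theorem isLiftable_A (n : ℕ) : (CoxeterMatrix.A n).IsLiftable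
    fun i : Fin n => (swap i.castSucc i.succ : Perm (Fin (n + 1))) := by
  refine isLiftable_of_lt (fun i => swap_mul_self _ _) fun i j hij => ?_
  have hij' : (i : ℕ) < j := hij
  rw [A_apply, if_neg hij.ne]
  split_ifs with h
  · have : j.castSucc = i.succ := by ext; simp; omega
    rw [this]
    refine swap_mul_swap_pow_three ?_ ?_ ?_ <;> simp [Fin.ext_iff] <;> omega
  · refine swap_mul_swap_sq ?_
    simp [Fin.ext_iff]
    omega

/-- The Coxeter group of type `Aₙ` is the symmetric group on `n + 1` letters. -/
theorem nonempty_mulEquiv_A (n : ℕ) :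
    Nonempty ((CoxeterMatrix.A n).Group ≃* Perm (Fin (n + 1))) := by
  let φ := (CoxeterMatrix.A n).toCoxeterSystem.lift ⟨_, isLiftable_A n⟩
  have hφ (i : Fin n) : φ ((CoxeterMatrix.A n).toCoxeterSystem.simple i) =
      swap i.castSucc i.succ := CoxeterSystem.lift_apply_simple _ _ i
  have hsurj : Surjective φ := by
    rw [← MonoidHom.mrange_eq_top, ← top_le_iff, ← Perm.mclosure_swap_castSucc_succ,
      Submonoid.closure_le]
    rintro _ ⟨i, rfl⟩
    exact ⟨_, hφ i⟩
  obtain ⟨hf, hc⟩ := finite_and_card_A_le n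
  refine ⟨MulEquiv.ofBijective φ (hsurj.bijective_of_nat_card_le ?_)⟩
  simpa [Nat.card_eq_fintype_card, Fintype.card_perm] using hc

end CoxeterMatrix

/-- The group of signed permutations of `α`. -/
abbrev SignedPerm (α : Type*) : Type _ :=
  (α → ℤˣ) ⋊[(mulAutArrow : Perm α →* MulAut (α → ℤˣ))] Perm α

namespace SignedPerm

open SemidirectProduct

variable {α : Type*}

theorem mulAutArrow_apply (σ : Perm α) (a : α → ℤˣ) (i : α) :
    (mulAutArrow : Perm α →* MulAut (α → ℤˣ)) σ a i = a (σ⁻¹ i) := rfl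

theorem inl_mul_self (a : α → ℤˣ) : (inl a * inl a : SignedPerm α) = 1 := by
  rw [← map_mul, show a * a = 1 from funext fun i => Int.units_mul_self (a i), map_one]

theorem inr_mul_inl_sq {σ : Perm α} (hσ : σ * σ = 1) (a : α → ℤˣ) :
    (inr σ * inl a : SignedPerm α) ^ 2 = inl (mulAutArrow σ a * a) := by
  rw [map_mul, inl_aut, inv_eq_of_mul_eq_one_right hσ, sq, ← mul_assoc]

theorem nat_card (n : ℕ) : Nat.card (SignedPerm (Fin n)) = 2 ^ n * n.factorial := by
  rw [SemidirectProduct.card]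
  simp [Nat.card_eq_fintype_card, Fintype.card_perm]

end SignedPerm

namespace CoxeterMatrix

open SemidirectProduct SignedPerm

/-- The image in `SignedPerm (Fin n)` of the `i`-th simple reflection of type `Bₙ`. -/
def signedSimple {n : ℕ} (i : Fin n) : SignedPerm (Fin n) :=
  if h : (i : ℕ) + 1 < n then inr (swap i ⟨i + 1, h⟩) else inl (Pi.mulSingle i (-1))

theorem isLiftable_B (n : ℕ) : (CoxeterMatrix.B n).IsLiftable
    (signedSimple : Fin n → SignedPerm (Fin n)) := by
  refine isLiftable_of_lt (fun i => ?_) fun i j hij => ?_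
  · unfold signedSimple
    split_ifs with h
    · rw [← map_mul, swap_mul_self, map_one]
    · exact inl_mul_self _
  · have hij' : (i : ℕ) < j := hij
    have hi : (i : ℕ) + 1 < n := by omega
    have hi_eq : signedSimple i = inr (swap i ⟨i + 1, hi⟩) := dif_pos hi
    rw [B_apply, if_neg hij.ne, hi_eq]
    by_cases hj : (j : ℕ) + 1 < n
    · have hj_eq : signedSimple j = inr (swap j ⟨j + 1, hj⟩) := dif_pos hj
      rw [if_neg (by omega), hj_eq, ← map_mul, ← map_pow]
      split_ifs with h
      · have : j = ⟨i + 1, hi⟩ := by ext; simp; omega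
        rw [← this, swap_mul_swap_pow_three, map_one] <;> simp [Fin.ext_iff] <;> omega
      · rw [swap_mul_swap_sq, map_one]
        simp [Fin.ext_iff]
        omega
    · have hj_eq : signedSimple j = inl (Pi.mulSingle j (-1)) := dif_neg hj
      rw [hj_eq]
      split_ifs with h h'
      · rw [pow_mul _ 2 2, inr_mul_inl_sq (swap_mul_self _ _), sq, inl_mul_self]
      · omega
      · rw [inr_mul_inl_sq (swap_mul_self _ _)]
        have : mulAutArrow (swap i ⟨i + 1, hi⟩) (Pi.mulSingle j (-1) : Fin n → ℤˣ) =
            Pi.mulSingle j (-1) := by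
          funext k
          rw [mulAutArrow_apply, swap_inv]
          by_cases hk : k = j
          · subst hk
            rw [swap_apply_of_ne_of_ne] <;> simp [Fin.ext_iff] <;> omega
          · rw [Pi.mulSingle_eq_of_ne hk, Pi.mulSingle_eq_of_ne]
            rw [Ne, swap_apply_eq_iff, swap_apply_of_ne_of_ne] <;>
              simp [Fin.ext_iff] at hk ⊢ <;> omega
        rw [this, map_mul, inl_mul_self]

/-- The Coxeter group of type `Bₙ` is the group of signed permutations of `n` letters. -/
theorem nonempty_mulEquiv_B {n : ℕ} (hn : 1 ≤ n) :
    Nonempty ((CoxeterMatrix.B n).Group ≃* SignedPerm (Fin n)) := by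
  obtain ⟨n, rfl⟩ := Nat.exists_eq_add_of_le' hn
  let φ := (CoxeterMatrix.B (n + 1)).toCoxeterSystem.lift ⟨_, isLiftable_B (n + 1)⟩
  have hφ (i : Fin (n + 1)) : φ ((CoxeterMatrix.B (n + 1)).toCoxeterSystem.simple i) =
      signedSimple i := CoxeterSystem.lift_apply_simple _ _ i
  have hinr (σ : Perm (Fin (n + 1))) : (inr σ : SignedPerm (Fin (n + 1))) ∈ MonoidHom.mrange φ := by
    have : (⊤ : Submonoid (Perm (Fin (n + 1)))) ≤
        (MonoidHom.mrange φ).comap (inr : Perm (Fin (n + 1)) →* SignedPerm (Fin (n + 1))) := by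
      rw [← Perm.mclosure_swap_castSucc_succ, Submonoid.closure_le]
      rintro _ ⟨i, rfl⟩
      exact ⟨_, (hφ i.castSucc).trans (dif_pos (by simp))⟩
    exact this (Submonoid.mem_top σ)
  have hsingle (i : Fin (n + 1)) :
      (inl (Pi.mulSingle i (-1)) : SignedPerm (Fin (n + 1))) ∈ MonoidHom.mrange φ := by
    have hlast :
        (inl (Pi.mulSingle (Fin.last n) (-1)) : SignedPerm (Fin (n + 1))) ∈ MonoidHom.mrange φ :=
      ⟨_, (hφ (Fin.last n)).trans (dif_neg (by simp))⟩
    have hconj := mul_mem (mul_mem (hinr (swap i (Fin.last n))) hlast)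
      (hinr (swap i (Fin.last n))⁻¹)
    rw [← inl_aut] at hconj
    convert hconj using 2
    funext k
    rw [mulAutArrow_apply, swap_inv]
    by_cases hk : k = i
    · simp [hk]
    · rw [Pi.mulSingle_eq_of_ne hk, Pi.mulSingle_eq_of_ne]
      rwa [Ne, swap_apply_eq_iff, swap_apply_right]
  have hinl (a : Fin (n + 1) → ℤˣ) : (inl a : SignedPerm (Fin (n + 1))) ∈ MonoidHom.mrange φ := by
    rw [← Finset.univ_prod_mulSingle a]
    refine Submonoid.prod_mem ((MonoidHom.mrange φ).comap
      (inl : (Fin (n + 1) → ℤˣ) →* SignedPerm (Fin (n + 1)))) fun i _ => ?_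
    rcases Int.units_eq_one_or (a i) with h | h
    · simp [h]
    · rw [h]; exact hsingle i
  have hsurj : Surjective φ := by
    intro g
    rw [← inl_left_mul_inr_right g]
    exact mul_mem (hinl g.left) (hinr g.right)
  obtain ⟨hf, hc⟩ := finite_and_card_B_le hn
  exact ⟨MulEquiv.ofBijective φ (hsurj.bijective_of_nat_card_le (hc.trans_eq (nat_card _).symm))⟩

end CoxeterMatrix

/-! ### Counting conjugacy classes of elements of prime order -/

theorem card_conjClasses_orderOf_eq {G H β : Type*} [Group G] [Group H] (e : G ≃* H) {d : ℕ}
    {f : H → β} {S : Set β} (hS : f '' {h | orderOf h = d} = S)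
    (hf : ∀ g h : H, orderOf g = d → orderOf h = d → (IsConj g h ↔ f g = f h)) :
    Nat.card {c : ConjClasses G // ∃ g, ConjClasses.mk g = c ∧ orderOf g = d} = Nat.card S := by
  have hconj (g h : G) : IsConj g h ↔ IsConj (e g) (e h) :=
    ⟨e.toMonoidHom.map_isConj, fun hc => by simpa using e.symm.toMonoidHom.map_isConj hc⟩
  choose r hr using fun c : {c : ConjClasses G // ∃ g, ConjClasses.mk g = c ∧ orderOf g = d} => c.2
  have hord (c) : orderOf (e (r c)) = d := (e.orderOf_eq _).trans (hr c).2
  refine Nat.card_eq_of_bijective (fun c => ⟨f (e (r c)), hS ▸ ⟨_, hord c, rfl⟩⟩) ⟨?_, ?_⟩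
  · intro c c' hcc
    have h := (hf _ _ (hord c) (hord c')).2 (congrArg Subtype.val hcc)
    apply Subtype.ext
    rw [← (hr c).1, ← (hr c').1, ConjClasses.mk_eq_mk_iff_isConj, hconj]
    exact h
  · rintro ⟨y, hy⟩
    obtain ⟨h, hd, rfl⟩ := hS ▸ hy
    have hd' : orderOf (e.symm h) = d := (e.symm.orderOf_eq h).trans hd
    let c : {c : ConjClasses G // ∃ g, ConjClasses.mk g = c ∧ orderOf g = d} :=
      ⟨ConjClasses.mk (e.symm h), _, rfl, hd'⟩
    refine ⟨c, Subtype.ext ((hf _ _ (hord c) hd).1 ?_)⟩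
    have := (hconj _ _).1 (ConjClasses.mk_eq_mk_iff_isConj.1 (hr c).1)
    rwa [e.apply_symm_apply] at this

namespace Equiv.Perm

variable {α : Type*} [Fintype α] [DecidableEq α] {p : ℕ}

theorem isConj_iff_card_cycleType_of_orderOf_eq_prime (hp : p.Prime) {σ τ : Perm α}
    (hσ : orderOf σ = p) (hτ : orderOf τ = p) :
    IsConj σ τ ↔ σ.cycleType.card = τ.cycleType.card := by
  have := Fact.mk hp
  rw [isConj_iff_cycleType_eq]
  refine ⟨congrArg _, fun h => ?_⟩
  have hσ' : σ ^ p = 1 := hσ ▸ pow_orderOf_eq_one σ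
  have hτ' : τ ^ p = 1 := hτ ▸ pow_orderOf_eq_one τ
  exact (cycleType_of_pow_prime_eq_one hσ').trans (h ▸ (cycleType_of_pow_prime_eq_one hτ').symm)

theorem card_cycleType_mul_of_pow_prime_eq_one (hp : p.Prime) {σ : Perm α} (hσ : σ ^ p = 1) :
    σ.cycleType.card * p = σ.support.card := by
  have := Fact.mk hp
  rw [← sum_cycleType, cycleType_of_pow_prime_eq_one hσ]
  simp

theorem exists_pow_prime_eq_one (hp : p.Prime) {k : ℕ} (hk : k * p ≤ Fintype.card α) :
    ∃ σ : Perm α, σ ^ p = 1 ∧ σ.cycleType.card = k := by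
  have := Fact.mk hp
  obtain ⟨σ, hσ⟩ := (exists_with_cycleType_iff (α := α) (m := Multiset.replicate k p)).2
    ⟨by simpa using hk, fun a ha => by rw [Multiset.eq_of_mem_replicate ha]; exact hp.two_le⟩
  refine ⟨σ, pow_prime_eq_one_iff.2 fun c hc => ?_, by simp [hσ]⟩
  exact Multiset.eq_of_mem_replicate (hσ ▸ hc)

theorem image_card_cycleType_orderOf_eq_prime (hp : p.Prime) :
    (fun σ : Perm α => σ.cycleType.card) '' {σ | orderOf σ = p} =
      Set.Icc 1 (Fintype.card α / p) := by
  have := Fact.mk hp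
  ext k
  constructor
  · rintro ⟨σ, hσ, rfl⟩
    have hσ : orderOf σ = p := hσ
    refine ⟨card_cycleType_pos.2 ?_, (Nat.le_div_iff_mul_le hp.pos).2 ?_⟩
    · rintro rfl
      exact hp.one_lt.ne (orderOf_one.symm.trans hσ)
    · rw [card_cycleType_mul_of_pow_prime_eq_one hp (hσ ▸ pow_orderOf_eq_one σ)]
      exact Finset.card_le_univ _
  · rintro ⟨h1, hk⟩
    obtain ⟨σ, hσ, rfl⟩ := exists_pow_prime_eq_one hp ((Nat.le_div_iff_mul_le hp.pos).1 hk)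
    exact ⟨σ, orderOf_eq_prime hσ (card_cycleType_pos.1 h1), rfl⟩

theorem exists_commute_mem_iff (σ : Perm α) {A B : Finset α} (hA : ∀ i ∈ A, σ i = i)
    (hB : ∀ i ∈ B, σ i = i) (hcard : A.card = B.card) :
    ∃ τ : Perm α, Commute τ σ ∧ ∀ i, τ i ∈ B ↔ i ∈ A := by
  let e : {x : {x // σ x = x} // x.1 ∈ A} ≃ {x : {x // σ x = x} // x.1 ∈ B} :=
    (subtypeSubtypeEquivSubtype fun {x} => hA x).trans
      ((Finset.equivOfCardEq hcard).trans (subtypeSubtypeEquivSubtype fun {x} => hB x).symm)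
  have hfix {x : α} (hx : σ x = x) :
      ofSubtype e.extendSubtype x = e.extendSubtype ⟨x, hx⟩ :=
    ofSubtype_apply_of_mem (p := fun x => σ x = x) _ hx
  have hmove {x : α} (hx : σ x ≠ x) : ofSubtype e.extendSubtype x = x :=
    ofSubtype_apply_of_not_mem _ hx
  refine ⟨ofSubtype e.extendSubtype, Equiv.ext fun x => ?_, fun x => ?_⟩
  · simp only [Perm.mul_apply]
    by_cases hx : σ x = x
    · rw [hx, hfix hx, (e.extendSubtype ⟨x, hx⟩).2]
    · rw [hmove hx, hmove (fun h => hx (σ.injective h))]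
  · by_cases hx : σ x = x
    · rw [hfix hx]
      refine ⟨fun h => ?_, fun h => e.extendSubtype_mem ⟨x, hx⟩ h⟩
      by_contra h'
      exact e.extendSubtype_not_mem ⟨x, hx⟩ h' h
    · rw [hmove hx]
      exact ⟨fun h => absurd (hB x h) hx, fun h => absurd (hA x h) hx⟩

end Equiv.Perm

namespace SignedPerm

open SemidirectProduct

variable {α : Type*}

theorem left_mul_apply (g h : SignedPerm α) (i : α) :
    (g * h).left i = g.left i * h.left (g.right⁻¹ i) := rfl

theorem left_conj_apply (g h : SignedPerm α) (i : α) :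
    (h * g * h⁻¹).left i = h.left i * g.left (h.right⁻¹ i) *
      h.left (h.right (g.right⁻¹ (h.right⁻¹ i))) := by
  rw [left_mul_apply, left_mul_apply, inv_left, mulAutArrow_apply, Pi.inv_apply,
    Int.units_inv_eq_self]
  simp [mul_inv_rev]

theorem exists_left_pow_eq (g : SignedPerm α) (m : ℕ) :
    ∃ b : α → ℤˣ, ∀ i, (g ^ (2 * m + 1)).left i = b i * b (g.right⁻¹ i) * g.left i := by
  induction m with
  | zero => exact ⟨1, by simp⟩
  | succ m ih =>
    obtain ⟨b, hb⟩ := ih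
    refine ⟨fun i => b i * g.left ((g ^ (2 * m + 1)).right⁻¹ i), fun i => ?_⟩
    rw [show 2 * (m + 1) + 1 = 2 * m + 1 + 1 + 1 by ring, pow_succ, pow_succ, left_mul_apply,
      left_mul_apply, hb]
    have hright (k : ℕ) : (g ^ k).right = g.right ^ k := map_pow rightHom g k
    have : (g ^ (2 * m + 1) * g).right⁻¹ i = (g ^ (2 * m + 1)).right⁻¹ (g.right⁻¹ i) := by
      rw [← pow_succ, hright, hright, pow_succ', mul_inv_rev, Perm.mul_apply]
    rw [this]
    dsimp only
    ac_rfl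

theorem isConj_inr_right_of_pow_eq_one {g : SignedPerm α} {p : ℕ} (hp : Odd p) (hg : g ^ p = 1) :
    IsConj g (inr g.right) := by
  obtain ⟨m, rfl⟩ := hp
  obtain ⟨b, hb⟩ := exists_left_pow_eq g m
  refine isConj_iff.2 ⟨inl b, ?_⟩
  ext1
  · funext i
    have := hb i
    rw [hg] at this
    rw [left_conj_apply]
    simp only [left_inl, right_inl, inv_one, Perm.one_apply, left_inr]
    rw [mul_right_comm]
    exact this.symm
  · simp

theorem orderOf_right_eq_of_odd {g : SignedPerm α} {p : ℕ} (hp : Odd p) (hg : orderOf g = p) :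
    orderOf g.right = p := by
  rw [← hg, ← orderOf_injective (inr : Perm α →* SignedPerm α) inr_injective]
  obtain ⟨c, hc⟩ := isConj_iff.1 (isConj_inr_right_of_pow_eq_one hp (hg ▸ pow_orderOf_eq_one g))
  rw [← hc]
  exact orderOf_injective (MulAut.conj c).toMonoidHom (MulAut.conj c).injective g

theorem isConj_iff_of_odd [Fintype α] [DecidableEq α] {p : ℕ} (hp : p.Prime) (hodd : Odd p)
    {g h : SignedPerm α} (hg : orderOf g = p) (hh : orderOf h = p) :
    IsConj g h ↔ g.right.cycleType.card = h.right.cycleType.card := by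
  rw [← Perm.isConj_iff_card_cycleType_of_orderOf_eq_prime hp (orderOf_right_eq_of_odd hodd hg)
    (orderOf_right_eq_of_odd hodd hh)]
  refine ⟨(rightHom : SignedPerm α →* Perm α).map_isConj, fun hc => ?_⟩
  exact (isConj_inr_right_of_pow_eq_one hodd (hg ▸ pow_orderOf_eq_one g)).trans
    (((inr : Perm α →* SignedPerm α).map_isConj hc).trans
      (isConj_inr_right_of_pow_eq_one hodd (hh ▸ pow_orderOf_eq_one h)).symm)

theorem image_card_cycleType_of_odd [Fintype α] [DecidableEq α] {p : ℕ} (hp : p.Prime)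
    (hodd : Odd p) :
    (fun g : SignedPerm α => g.right.cycleType.card) '' {g | orderOf g = p} =
      Set.Icc 1 (Fintype.card α / p) := by
  rw [← Perm.image_card_cycleType_orderOf_eq_prime hp]
  ext k
  constructor
  · rintro ⟨g, hg, rfl⟩
    exact ⟨g.right, orderOf_right_eq_of_odd hodd hg, rfl⟩
  · rintro ⟨σ, hσ, rfl⟩
    exact ⟨inr σ, (orderOf_injective _ inr_injective σ).trans hσ, rfl⟩

theorem sq_eq_one_iff {g : SignedPerm α} :
    g ^ 2 = 1 ↔ g.right ^ 2 = 1 ∧ ∀ i, g.left (g.right i) = g.left i := by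
  rw [sq, sq, SemidirectProduct.ext_iff, and_comm, funext_iff]
  refine and_congr_right fun h => forall_congr' fun i => ?_
  rw [left_mul_apply, inv_eq_of_mul_eq_one_right h, one_left, Pi.one_apply, mul_eq_one_iff_eq_inv,
    Int.units_inv_eq_self, eq_comm]

section Involutions

variable [Fintype α] [DecidableEq α]

/-- The points fixed by the underlying permutation whose sign is negative. -/
def negFixed (g : SignedPerm α) : Finset α :=
  Finset.univ.filter fun i => g.right i = i ∧ g.left i = -1

theorem mem_negFixed {g : SignedPerm α} {i : α} :
    i ∈ negFixed g ↔ g.right i = i ∧ g.left i = -1 := by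
  simp [negFixed]

theorem card_negFixed_eq_of_isConj {g h : SignedPerm α} (hc : IsConj g h) :
    (negFixed g).card = (negFixed h).card := by
  obtain ⟨c, rfl⟩ := isConj_iff.1 hc
  refine Finset.card_equiv c.right fun i => ?_
  rw [mem_negFixed, mem_negFixed, left_conj_apply]
  have : (c * g * c⁻¹).right (c.right i) = c.right i ↔ g.right i = i := by simp
  rw [this]
  refine and_congr_right fun hi => ?_
  have : g.right⁻¹ i = i := Perm.inv_eq_iff_eq.2 hi.symm
  rw [show c.right⁻¹ (c.right i) = i from c.right.symm_apply_apply i, this]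
  rw [mul_right_comm, Int.units_mul_self, one_mul]

theorem isConj_normalForm {g : SignedPerm α} (hg : g ^ 2 = 1) :
    IsConj g ⟨fun i => if i ∈ negFixed g then -1 else 1, g.right⟩ := by
  classical
  let : LinearOrder α := LinearOrder.lift' _ (Fintype.equivFin α).injective
  obtain ⟨hr, hl⟩ := sq_eq_one_iff.1 hg
  rw [sq] at hr
  refine isConj_iff.2 ⟨inl fun i => if i < g.right i then g.left i else 1, ?_⟩
  ext1
  · funext i
    rw [left_conj_apply]
    simp only [left_inl, right_inl, inv_one, Perm.one_apply, inv_eq_of_mul_eq_one_right hr,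
      mem_negFixed, hl, show g.right (g.right i) = i from DFunLike.congr_fun hr i]
    rcases lt_trichotomy i (g.right i) with h | h | h
    · simp [h, h.not_gt, h.ne', Int.units_mul_self]
    · rcases Int.units_eq_one_or (g.left i) with h' | h' <;> simp [← h, h']
    · simp [h, h.not_gt, h.ne, Int.units_mul_self]
  · simp

theorem isConj_of_right_eq {g h : SignedPerm α} (hg : g ^ 2 = 1) (hh : h ^ 2 = 1)
    (hr : g.right = h.right) (hc : (negFixed g).card = (negFixed h).card) : IsConj g h := by
  refine (isConj_normalForm hg).trans (IsConj.trans ?_ (isConj_normalForm hh).symm)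
  obtain ⟨τ, hτ, hmem⟩ := g.right.exists_commute_mem_iff
    (fun i hi => (mem_negFixed.1 hi).1) (fun i hi => hr ▸ (mem_negFixed.1 hi).1) hc
  refine isConj_iff.2 ⟨inr τ, ?_⟩
  ext1
  · funext i
    have : τ.symm i ∈ negFixed g ↔ i ∈ negFixed h := by
      rw [← hmem, τ.apply_symm_apply]
    rw [left_conj_apply]
    simp [this]
  · simpa [hr] using mul_inv_eq_of_eq_mul (hr ▸ hτ.eq)

theorem isConj_iff_of_orderOf_eq_two {g h : SignedPerm α} (hg : orderOf g = 2)
    (hh : orderOf h = 2) : IsConj g h ↔ (g.right.cycleType.card, (negFixed g).card) =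
      (h.right.cycleType.card, (negFixed h).card) := by
  have := Fact.mk Nat.prime_two
  have hg : g ^ 2 = 1 := hg ▸ pow_orderOf_eq_one g
  have hh : h ^ 2 = 1 := hh ▸ pow_orderOf_eq_one h
  rw [Prod.mk.injEq]
  constructor
  · intro hc
    refine ⟨?_, card_negFixed_eq_of_isConj hc⟩
    exact congrArg _
      (Perm.isConj_iff_cycleType_eq.1 ((rightHom : SignedPerm α →* Perm α).map_isConj hc))
  · rintro ⟨h1, h2⟩
    have hconj : IsConj g.right h.right := by
      rw [Perm.isConj_iff_cycleType_eq,
        Perm.cycleType_of_pow_prime_eq_one (sq_eq_one_iff.1 hg).1,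
        Perm.cycleType_of_pow_prime_eq_one (sq_eq_one_iff.1 hh).1, h1]
    obtain ⟨τ, hτ⟩ := isConj_iff.1 hconj
    have hc : IsConj g (inr τ * g * (inr τ)⁻¹) := isConj_iff.2 ⟨_, rfl⟩
    refine hc.trans (isConj_of_right_eq ?_ hh ?_ ?_)
    · rw [conj_pow, hg, mul_one, mul_inv_cancel]
    · simpa using hτ
    · rw [← card_negFixed_eq_of_isConj hc, h2]

theorem image_card_of_orderOf_eq_two :
    (fun g : SignedPerm α => (g.right.cycleType.card, (negFixed g).card)) '' {g | orderOf g = 2} =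
      {km | 1 ≤ km.1 + km.2 ∧ 2 * km.1 + km.2 ≤ Fintype.card α} := by
  have := Fact.mk Nat.prime_two
  ext ⟨k, m⟩
  constructor
  · rintro ⟨g, hg, hkm⟩
    have hg : orderOf g = 2 := hg
    have hg2 : g ^ 2 = 1 := hg ▸ pow_orderOf_eq_one g
    obtain ⟨rfl, rfl⟩ := Prod.mk.inj hkm
    refine ⟨?_, ?_⟩
    · by_contra h
      obtain ⟨h1, h2⟩ := Nat.add_eq_zero_iff.1 (Nat.lt_one_iff.1 (not_le.1 h))
      replace h1 : g.right = 1 := Perm.card_cycleType_eq_zero.1 h1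
      replace h2 : negFixed g = ∅ := Finset.card_eq_zero.1 h2
      have : g = 1 := by
        ext1
        · funext i
          refine (Int.units_eq_one_or _).resolve_right fun hi => ?_
          exact Finset.notMem_empty i (h2 ▸ mem_negFixed.2 ⟨by simp [h1], hi⟩)
        · exact h1
      simp [this] at hg
    · have := Perm.card_cycleType_mul_of_pow_prime_eq_one Nat.prime_two (sq_eq_one_iff.1 hg2).1
      have hsub : negFixed g ⊆ g.right.supportᶜ := fun i hi => by
        simpa using (mem_negFixed.1 hi).1
      have := Finset.card_le_card hsub
      rw [Finset.card_compl] at this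
      have := Finset.card_le_univ g.right.support
      change 2 * g.right.cycleType.card + (negFixed g).card ≤ _
      omega
  · rintro ⟨h1, h2⟩
    simp only at h1 h2
    obtain ⟨σ, hσ, rfl⟩ := Perm.exists_pow_prime_eq_one (α := α) Nat.prime_two (k := k) (by omega)
    have hcard := Perm.card_cycleType_mul_of_pow_prime_eq_one Nat.prime_two hσ
    obtain ⟨A, hA, rfl⟩ := Finset.exists_subset_card_eq (s := σ.supportᶜ) (n := m) (by
      rw [Finset.card_compl]; omega)
    have hfix : ∀ i ∈ A, σ i = i := fun i hi => by simpa using hA hi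
    let g : SignedPerm α := ⟨fun i => if i ∈ A then -1 else 1, σ⟩
    have hneg : negFixed g = A := by
      ext i
      rw [mem_negFixed]
      by_cases hi : i ∈ A <;> simp [g, hi, hfix]
    refine ⟨g, orderOf_eq_prime (sq_eq_one_iff.2 ⟨hσ, fun i => ?_⟩) ?_, by simp only [hneg]; rfl⟩
    · have : σ i ∈ A ↔ i ∈ A :=
        ⟨fun hi => σ.injective (hfix _ hi) ▸ hi, fun hi => (hfix i hi).symm ▸ hi⟩
      simp [g, this]
    · intro hg1
      have h3 : σ = 1 := congrArg SemidirectProduct.right hg1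
      have h4 : A = ∅ := by
        rw [← hneg, hg1]
        ext i
        simp [mem_negFixed]
      simp [h3, h4] at h1

end Involutions

end SignedPerm

/-- Counting conjugacy classes of elements of prime order `p` in the Coxeter groups of
types `Aₙ` and `Bₙ`. -/
theorem conjClasses_prime_order_typeA_typeB (p : ℕ) (hp : p.Prime) :
    (∀ n : ℕ, 1 ≤ n →
      Nat.card {c : ConjClasses (CoxeterMatrix.Aₙ n).Group //
        ∃ g, ConjClasses.mk g = c ∧ orderOf g = p} = (n + 1) / p) ∧
    (∀ n : ℕ, 2 ≤ n →
      (Nat.card {c : ConjClasses (CoxeterMatrix.Bₙ n).Group //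
          ∃ g, ConjClasses.mk g = c ∧ orderOf g = 2}
        = Nat.card {km : ℕ × ℕ // 1 ≤ km.1 + km.2 ∧ 2 * km.1 + km.2 ≤ n}) ∧
      (3 ≤ p →
        Nat.card {c : ConjClasses (CoxeterMatrix.Bₙ n).Group //
          ∃ g, ConjClasses.mk g = c ∧ orderOf g = p} = n / p)) := by
  refine ⟨fun n _ => ?_, fun n hn => ?_⟩
  · obtain ⟨e⟩ := CoxeterMatrix.nonempty_mulEquiv_A n
    refine (card_conjClasses_orderOf_eq e (Perm.image_card_cycleType_orderOf_eq_prime hp)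
      fun g h => Perm.isConj_iff_card_cycleType_of_orderOf_eq_prime hp).trans ?_
    simp
  · obtain ⟨e⟩ := CoxeterMatrix.nonempty_mulEquiv_B (Nat.one_le_of_lt hn)
    refine ⟨?_, fun h3 => ?_⟩
    · refine (card_conjClasses_orderOf_eq e SignedPerm.image_card_of_orderOf_eq_two
        fun g h => SignedPerm.isConj_iff_of_orderOf_eq_two).trans ?_
      rw [Fintype.card_fin]
      rfl
    · have hodd : Odd p := hp.odd_of_ne_two (by omega)
      refine (card_conjClasses_orderOf_eq e (SignedPerm.image_card_cycleType_of_odd hp hodd)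
        fun g h => SignedPerm.isConj_iff_of_odd hp hodd).trans ?_
      simp
end

section
/- For n ≥ 4, consider the Coxeter group of type Dₙ (generators s₁,…,sₙ with m(i,i+1) = 3 for 1 ≤ i ≤ n−2, m(n−2,n) = 3, and m(i,j) = 2 for all other pairs i ≠ j). The number of conjugacy classes of elements of order 2 equals N + 1 if n is even and equals N if n is odd, where N is the number of pairs (k,m) of non-negative integers with k + m ≥ 1 and 2(k + m) ≤ n. For every odd prime p, the number of conjugacy classes of elements of order p equals ⌊n/p⌋. -/
/-- The Coxeter matrix of type `Dₙ` (`1`-indexed generators `s₁, …, sₙ`, here `0`-indexed):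
`m(i,i+1) = 3` for `1 ≤ i ≤ n−2`, `m(n−2,n) = 3`, and `m(i,j) = 2` otherwise. -/
def typeDMatrix (n : ℕ) : CoxeterMatrix (Fin n) where
  M := Matrix.of fun i j : Fin n ↦
    if i = j then 1
    else if ((i : ℕ) + 1 = j ∧ (j : ℕ) + 1 < n) ∨ ((j : ℕ) + 1 = i ∧ (i : ℕ) + 1 < n) ∨
            ((i : ℕ) + 1 = n ∧ (j : ℕ) + 3 = n) ∨ ((j : ℕ) + 1 = n ∧ (i : ℕ) + 3 = n) then 3
    else 2
  isSymm := by
    unfold Matrix.IsSymm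
    ext i j
    simp only [Matrix.transpose_apply, Matrix.of_apply]
    split_ifs <;> first | rfl | tauto
  diagonal := by intro i; simp
  off_diagonal := by
    intro i j h
    simp only [Matrix.of_apply, if_neg h]
    split_ifs <;> simp


/-- Signed permutations of a type `ι`: the element `g` sends the basis vector `e i` to
`g.sign i • e (g.perm i)`. -/
@[ext]
structure SignedPerm_s11 (ι : Type*) where
  /-- The underlying permutation. -/
  perm : Equiv.Perm ι
  /-- The sign attached to each source index. -/
  sign : ι → ℤˣ

namespace SignedPerm_s11

variable {ι : Type*}

instance : Mul (SignedPerm_s11 ι) := ⟨fun g h ↦ ⟨g.perm * h.perm, fun i ↦ h.sign i * g.sign (h.perm i)⟩⟩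

instance : One (SignedPerm_s11 ι) := ⟨⟨1, 1⟩⟩

instance : Inv (SignedPerm_s11 ι) := ⟨fun g ↦ ⟨g.perm⁻¹, fun i ↦ g.sign (g.perm⁻¹ i)⟩⟩

@[simp] lemma perm_mul (g h : SignedPerm_s11 ι) : (g * h).perm = g.perm * h.perm := rfl

@[simp] lemma sign_mul (g h : SignedPerm_s11 ι) (i : ι) :
    (g * h).sign i = h.sign i * g.sign (h.perm i) := rfl

@[simp] lemma perm_one : (1 : SignedPerm_s11 ι).perm = 1 := rfl

@[simp] lemma sign_one (i : ι) : (1 : SignedPerm_s11 ι).sign i = 1 := rfl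

@[simp] lemma perm_inv (g : SignedPerm_s11 ι) : g⁻¹.perm = g.perm⁻¹ := rfl

@[simp] lemma sign_inv (g : SignedPerm_s11 ι) (i : ι) : g⁻¹.sign i = g.sign (g.perm⁻¹ i) := rfl

lemma ext_apply {g h : SignedPerm_s11 ι} (h1 : ∀ i, g.perm i = h.perm i)
    (h2 : ∀ i, g.sign i = h.sign i) : g = h :=
  SignedPerm_s11.ext (Equiv.ext h1) (funext h2)

instance : Group (SignedPerm_s11 ι) :=
  Group.ofLeftAxioms
    (fun a b c ↦ ext_apply (fun _ ↦ rfl) fun i ↦ by simp [mul_assoc])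
    (fun a ↦ ext_apply (fun _ ↦ rfl) fun i ↦ by simp)
    (fun a ↦ ext_apply (fun i ↦ by simp) fun i ↦ by simp)

/-- Permutation matrices as signed permutations. -/
def ofPerm : Equiv.Perm ι →* SignedPerm_s11 ι where
  toFun σ := ⟨σ, 1⟩
  map_one' := rfl
  map_mul' σ τ := ext_apply (fun _ ↦ rfl) fun i ↦ by simp

@[simp] lemma perm_ofPerm (σ : Equiv.Perm ι) : (ofPerm σ).perm = σ := rfl

@[simp] lemma sign_ofPerm (σ : Equiv.Perm ι) (i : ι) : (ofPerm σ).sign i = 1 := rfl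

/-- Diagonal sign matrices as signed permutations. -/
def ofSign : (ι → ℤˣ) →* SignedPerm_s11 ι where
  toFun ε := ⟨1, ε⟩
  map_one' := rfl
  map_mul' ε δ := ext_apply (fun _ ↦ rfl) fun i ↦ by simp [mul_comm]

@[simp] lemma perm_ofSign (ε : ι → ℤˣ) : (ofSign ε).perm = 1 := rfl

@[simp] lemma sign_ofSign (ε : ι → ℤˣ) (i : ι) : (ofSign ε).sign i = ε i := rfl

/-- The underlying permutation, as a homomorphism. -/
def permHom : SignedPerm_s11 ι →* Equiv.Perm ι where
  toFun := perm
  map_one' := rfl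
  map_mul' _ _ := rfl

lemma ofPerm_mul_ofSign (g : SignedPerm_s11 ι) : ofPerm g.perm * ofSign g.sign = g :=
  ext_apply (fun _ ↦ rfl) fun i ↦ by simp

lemma ofPerm_injective : Function.Injective (ofPerm (ι := ι)) := fun σ τ h ↦ by
  simpa using congr_arg perm h

/-- The action on signed indices. -/
def act (g : SignedPerm_s11 ι) (x : ι × ℤˣ) : ι × ℤˣ := (g.perm x.1, g.sign x.1 * x.2)

@[simp] lemma act_one (x : ι × ℤˣ) : act 1 x = x := by simp [act]

lemma act_mul (g h : SignedPerm_s11 ι) (x : ι × ℤˣ) : act (g * h) x = act g (act h x) := by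
  simp [act, mul_comm, mul_assoc]

lemma ofSign_inv (δ : ι → ℤˣ) : (ofSign δ)⁻¹ = ofSign δ := by
  rw [← map_inv]
  congr 1
  ext i
  simp

lemma ofSign_conj_sign (δ : ι → ℤˣ) (g : SignedPerm_s11 ι) (i : ι) :
    (ofSign δ * g * (ofSign δ)⁻¹).sign i = δ i * g.sign i * δ (g.perm i) := by
  simp [ofSign_inv, mul_assoc]

lemma ofSign_conj_perm (δ : ι → ℤˣ) (g : SignedPerm_s11 ι) :
    (ofSign δ * g * (ofSign δ)⁻¹).perm = g.perm := by
  simp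

lemma sign_pow_succ (g : SignedPerm_s11 ι) (m : ℕ) (i : ι) :
    (g ^ (m + 1)).sign i = g.sign i * (g ^ m).sign (g.perm i) := by
  rw [pow_succ, sign_mul]

lemma perm_pow (g : SignedPerm_s11 ι) (m : ℕ) : (g ^ m).perm = g.perm ^ m :=
  map_pow permHom g m

/-- A sign vector conjugating an element of odd order to its underlying permutation. -/
lemma exists_ofSign_conj_of_odd {g : SignedPerm_s11 ι} {p : ℕ} (hp : Odd p) (hg : g ^ p = 1) :
    ∃ δ : ι → ℤˣ, ofSign δ * g * (ofSign δ)⁻¹ = ofPerm g.perm := by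
  refine ⟨fun i ↦ ∏ m ∈ Finset.range p, (g ^ m).sign i, ext_apply (fun i ↦ by simp) fun i ↦ ?_⟩
  rw [ofSign_conj_sign, sign_ofPerm]
  have h1 : ∏ m ∈ Finset.range p, (g ^ (m + 1)).sign i =
      ∏ m ∈ Finset.range p, (g ^ m).sign i := by
    have := Finset.prod_range_succ (fun m ↦ (g ^ m).sign i) p
    rw [Finset.prod_range_succ'] at this
    simpa [hg] using this
  simp only [sign_pow_succ, Finset.prod_mul_distrib, Finset.prod_const, Finset.card_range] at h1
  obtain ⟨c, rfl⟩ := hp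
  rw [pow_succ, pow_mul, Int.units_sq, one_pow, one_mul] at h1
  rw [mul_assoc, h1, Int.units_mul_self]

lemma orderOf_perm_of_odd {g : SignedPerm_s11 ι} {p : ℕ} (hp : Odd p) (hg : g ^ p = 1) :
    orderOf g.perm = orderOf g := by
  obtain ⟨δ, hδ⟩ := exists_ofSign_conj_of_odd hp hg
  rw [← orderOf_injective ofPerm ofPerm_injective, ← hδ]
  exact (MulAut.conj (ofSign δ)).orderOf_eq g

/-- The signed permutation with underlying permutation `σ` and minus signs exactly on `F`. -/
def signedOn [DecidableEq ι] (σ : Equiv.Perm ι) (F : Finset ι) : SignedPerm_s11 ι :=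
  ⟨σ, fun i ↦ if i ∈ F then -1 else 1⟩

lemma signedOn_empty [DecidableEq ι] (σ : Equiv.Perm ι) : signedOn σ ∅ = ofPerm σ :=
  ext_apply (fun _ ↦ rfl) fun i ↦ by simp [signedOn]

section Fintype

variable [Fintype ι]

/-- The product of the signs of a signed permutation. -/
def parity : SignedPerm_s11 ι →* ℤˣ where
  toFun g := ∏ i, g.sign i
  map_one' := by simp
  map_mul' g h := by
    simp only [sign_mul, Finset.prod_mul_distrib]
    rw [Equiv.prod_comp h.perm g.sign, mul_comm]

lemma parity_apply (g : SignedPerm_s11 ι) : parity g = ∏ i, g.sign i := rfl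

@[simp] lemma parity_ofPerm (σ : Equiv.Perm ι) : parity (ofPerm σ) = 1 := by
  simp [parity_apply]

@[simp] lemma parity_ofSign (ε : ι → ℤˣ) : parity (ofSign ε) = ∏ i, ε i := rfl

/-- Conjugacy by a signed permutation with an even number of minus signs. -/
def EvenConj (g h : SignedPerm_s11 ι) : Prop := ∃ x, parity x = 1 ∧ x * g * x⁻¹ = h

lemma EvenConj.symm {g h : SignedPerm_s11 ι} (H : EvenConj g h) : EvenConj h g := by
  obtain ⟨x, hx, rfl⟩ := H
  exact ⟨x⁻¹, by simp [hx], by group⟩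

lemma EvenConj.trans {g h k : SignedPerm_s11 ι} (H : EvenConj g h) (H' : EvenConj h k) :
    EvenConj g k := by
  obtain ⟨x, hx, rfl⟩ := H
  obtain ⟨y, hy, rfl⟩ := H'
  exact ⟨y * x, by simp [hx, hy], by group⟩

lemma EvenConj.orderOf_eq {g h : SignedPerm_s11 ι} (H : EvenConj g h) : orderOf g = orderOf h := by
  obtain ⟨x, -, rfl⟩ := H
  exact (MulAut.conj x).orderOf_eq g |>.symm

variable [DecidableEq ι]

lemma EvenConj.cycleType_eq {g h : SignedPerm_s11 ι} (H : EvenConj g h) :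
    g.perm.cycleType = h.perm.cycleType := by
  obtain ⟨x, -, rfl⟩ := H
  simp [Equiv.Perm.cycleType_conj]

lemma evenConj_ofPerm {σ τ : Equiv.Perm ι} (h : σ.cycleType = τ.cycleType) :
    EvenConj (ofPerm σ) (ofPerm τ) := by
  obtain ⟨π, hπ⟩ := isConj_iff.1 (Equiv.Perm.isConj_iff_cycleType_eq.2 h)
  exact ⟨ofPerm π, by simp, by rw [← hπ]; simp⟩

/-! ### Elements of odd prime order -/

lemma evenConj_ofPerm_perm {g : SignedPerm_s11 ι} {p : ℕ} (hp : p.Prime) (hodd : Odd p)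
    (hg : orderOf g = p) : EvenConj g (ofPerm g.perm) := by
  have hgp : g ^ p = 1 := hg ▸ pow_orderOf_eq_one g
  obtain ⟨δ, hδ⟩ := exists_ofSign_conj_of_odd hodd hgp
  rcases Int.units_eq_one_or (∏ i, δ i) with h1 | h1
  · exact ⟨ofSign δ, h1, hδ⟩
  have hperm : orderOf g.perm = p := (orderOf_perm_of_odd hodd hgp).trans hg
  obtain ⟨i, hi⟩ : ∃ i, g.perm i ≠ i := by
    by_contra! h
    have : g.perm = 1 := Equiv.ext h
    rw [this, orderOf_one] at hperm
    exact hp.one_lt.ne hperm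
  set c := g.perm.cycleOf i with hc
  have hcyc : c.IsCycle := Equiv.Perm.isCycle_cycleOf _ hi
  have hcard : c.support.card = p := by
    rw [← hcyc.orderOf]
    exact ((hp.eq_one_or_self_of_dvd _ (hperm ▸ Equiv.Perm.orderOf_cycleOf_dvd_orderOf _ _)
      ).resolve_left fun h ↦ hcyc.ne_one (orderOf_eq_one_iff.1 h))
  set η : ι → ℤˣ := fun j ↦ if j ∈ c.support then -1 else 1 with hη
  have hηg : ∀ j, η (g.perm j) = η j := by
    intro j
    simp only [hη, hc, Equiv.Perm.mem_support_cycleOf_iff' hi,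
      Equiv.Perm.sameCycle_apply_right]
  have hηprod : ∏ j, η j = -1 := by
    rw [hη, Finset.prod_ite_mem, Finset.univ_inter, Finset.prod_const, hcard, hodd.neg_one_pow]
  refine ⟨ofSign (η * δ), ?_, ?_⟩
  · simp [hηprod, h1]
  · rw [map_mul, mul_inv_rev, mul_assoc, mul_assoc, ← mul_assoc g, ← mul_assoc (ofSign δ),
      ← mul_assoc (ofSign δ), hδ, ← mul_assoc]
    refine ext_apply (fun i ↦ by simp) fun j ↦ ?_
    rw [ofSign_conj_sign, perm_ofPerm, hηg, sign_ofPerm, mul_one, Int.units_mul_self]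

lemma cycleType_eq_replicate {σ : Equiv.Perm ι} {p : ℕ} (hp : p.Prime) (hσ : σ ^ p = 1) :
    σ.cycleType = Multiset.replicate (Multiset.card σ.cycleType) p := by
  have := Fact.mk hp
  exact Multiset.eq_replicate_card.2 (Equiv.Perm.pow_prime_eq_one_iff.1 hσ)

lemma card_support_of_pow_prime {σ : Equiv.Perm ι} {p : ℕ} (hp : p.Prime) (hσ : σ ^ p = 1) :
    σ.support.card = Multiset.card σ.cycleType * p := by
  rw [← Equiv.Perm.sum_cycleType, cycleType_eq_replicate hp hσ]
  simp

lemma evenConj_iff_of_odd {g h : SignedPerm_s11 ι} {p : ℕ} (hp : p.Prime) (hodd : Odd p)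
    (hg : orderOf g = p) (hh : orderOf h = p) :
    EvenConj g h ↔ Multiset.card g.perm.cycleType = Multiset.card h.perm.cycleType := by
  refine ⟨fun H ↦ by rw [H.cycleType_eq], fun H ↦ ?_⟩
  have hgp : g.perm ^ p = 1 := by rw [← perm_pow, ← hg, pow_orderOf_eq_one, perm_one]
  have hhp : h.perm ^ p = 1 := by rw [← perm_pow, ← hh, pow_orderOf_eq_one, perm_one]
  refine ((evenConj_ofPerm_perm hp hodd hg).trans (evenConj_ofPerm ?_)).trans
    (evenConj_ofPerm_perm hp hodd hh).symm
  rw [cycleType_eq_replicate hp hgp, cycleType_eq_replicate hp hhp, H]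

lemma exists_orderOf_eq_prime_iff {p : ℕ} (hp : p.Prime) (hodd : Odd p) (k : ℕ) :
    (∃ g : SignedPerm_s11 ι, parity g = 1 ∧ orderOf g = p ∧ Multiset.card g.perm.cycleType = k) ↔
      k ∈ Finset.Icc 1 (Fintype.card ι / p) := by
  rw [Finset.mem_Icc, Nat.le_div_iff_mul_le hp.pos]
  constructor
  · rintro ⟨g, -, hg, rfl⟩
    have hperm : orderOf g.perm = p :=
      (orderOf_perm_of_odd hodd (hg ▸ pow_orderOf_eq_one g)).trans hg
    refine ⟨Equiv.Perm.card_cycleType_pos.2 fun h ↦ ?_, ?_⟩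
    · rw [h, orderOf_one] at hperm
      exact hp.one_lt.ne hperm
    · rw [← card_support_of_pow_prime hp (hperm ▸ pow_orderOf_eq_one g.perm)]
      exact Finset.card_le_univ _
  · rintro ⟨h1, h2⟩
    obtain ⟨σ, hσ⟩ := (Equiv.Perm.exists_with_cycleType_iff ι (m := Multiset.replicate k p)).2
      ⟨by simpa using h2, fun a ha ↦ Multiset.eq_of_mem_replicate ha ▸ hp.two_le⟩
    refine ⟨ofPerm σ, by simp, ?_, by simp [hσ]⟩
    rw [orderOf_injective ofPerm ofPerm_injective, ← Equiv.Perm.lcm_cycleType, hσ]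
    refine Nat.dvd_antisymm (Multiset.lcm_dvd.2 fun a ha ↦ ?_) (Multiset.dvd_lcm ?_)
    · rw [Multiset.eq_of_mem_replicate ha]
    · exact Multiset.mem_replicate.2 ⟨by omega, rfl⟩

/-! ### Involutions -/

/-- The indices `i` for which `e i` is sent to `- e i`. -/
def negFix (g : SignedPerm_s11 ι) : Finset ι := {i | g.perm i = i ∧ g.sign i = -1}

lemma mem_negFix {g : SignedPerm_s11 ι} {i : ι} :
    i ∈ negFix g ↔ g.perm i = i ∧ g.sign i = -1 := by
  simp [negFix]

lemma disjoint_support_negFix (g : SignedPerm_s11 ι) : Disjoint g.perm.support (negFix g) := by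
  rw [Finset.disjoint_left]
  intro i hi hi'
  exact Equiv.Perm.mem_support.1 hi (mem_negFix.1 hi').1

lemma EvenConj.card_negFix_eq {g h : SignedPerm_s11 ι} (H : EvenConj g h) :
    (negFix g).card = (negFix h).card := by
  obtain ⟨x, -, rfl⟩ := H
  refine Finset.card_equiv x.perm fun i ↦ ?_
  simp only [mem_negFix, perm_mul, perm_inv, Equiv.Perm.mul_apply, Equiv.Perm.inv_def,
    Equiv.symm_apply_apply, EmbeddingLike.apply_eq_iff_eq, sign_mul, sign_inv]
  refine and_congr_right fun hi ↦ ?_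
  rw [hi, mul_left_comm, Int.units_mul_self, mul_one]

lemma parity_signedOn (σ : Equiv.Perm ι) (F : Finset ι) :
    parity (signedOn σ F) = (-1) ^ F.card := by
  rw [parity_apply, signedOn, Finset.prod_ite_mem, Finset.univ_inter, Finset.prod_const]

lemma exists_ofSign_conj_of_sq {g : SignedPerm_s11 ι} (hg : g ^ 2 = 1) :
    ∃ δ : ι → ℤˣ, ofSign δ * g * (ofSign δ)⁻¹ = signedOn g.perm (negFix g) ∧
      ((∃ i, g.perm i = i) → ∏ i, δ i = 1) := by
  have hperm : ∀ i, g.perm (g.perm i) = i := fun i ↦ by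
    simpa [pow_two] using congr_arg (fun x ↦ x.perm i) hg
  have hsign : ∀ i, g.sign (g.perm i) = g.sign i := fun i ↦ by
    have := congr_arg (fun x ↦ g.sign i * x.sign i) hg
    simpa [pow_two, ← mul_assoc] using this
  have key : ∀ δ : ι → ℤˣ, (∀ i, g.perm i ≠ i → δ i * g.sign i * δ (g.perm i) = 1) →
      ofSign δ * g * (ofSign δ)⁻¹ = signedOn g.perm (negFix g) := by
    refine fun δ hδ ↦ ext_apply (fun i ↦ by simp [signedOn]) fun i ↦ ?_
    rw [ofSign_conj_sign]
    by_cases hi : g.perm i = i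
    · rw [hi, mul_right_comm, Int.units_mul_self, one_mul]
      rcases Int.units_eq_one_or (g.sign i) with h | h <;> simp [signedOn, mem_negFix, hi, h]
    · rw [hδ i hi]
      simp [signedOn, mem_negFix, hi]
  set e := Fintype.equivFin ι
  set δ : ι → ℤˣ := fun i ↦ if e i < e (g.perm i) then g.sign i else 1 with hδdef
  have hδ : ∀ i, g.perm i ≠ i → δ i * g.sign i * δ (g.perm i) = 1 := by
    intro i hi
    simp only [hδdef, hperm, hsign]
    rcases lt_or_gt_of_ne (e.injective.ne hi) with h | h
    · simp [h, h.le]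
    · simp [h, h.le]
  by_cases hfix : ∃ i, g.perm i = i
  · obtain ⟨i, hi⟩ := hfix
    refine ⟨δ * Pi.mulSingle i (∏ j, δ j), key _ fun j hj ↦ ?_, fun _ ↦ ?_⟩
    · have h1 : j ≠ i := by rintro rfl; exact hj hi
      have h2 : g.perm j ≠ i := by
        intro h
        rw [← hperm j, h, hi] at h1
        exact h1 rfl
      simpa [h1, h2] using hδ j hj
    · simp [Finset.prod_mul_distrib]
  · exact ⟨δ, key δ hδ, fun h ↦ absurd h hfix⟩

lemma even_card_negFix {g : SignedPerm_s11 ι} (hg : g ^ 2 = 1) (hpar : parity g = 1) :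
    Even (negFix g).card := by
  obtain ⟨δ, hδ, -⟩ := exists_ofSign_conj_of_sq hg
  have := congr_arg parity hδ
  rw [parity_signedOn, map_mul, map_mul, map_inv, hpar, mul_one, mul_inv_cancel] at this
  by_contra h
  rw [(Nat.not_even_iff_odd.1 h).neg_one_pow] at this
  exact absurd this (by decide)

lemma exists_perm_conj_signedOn {σ τ : Equiv.Perm ι} {F F' : Finset ι}
    (h : σ.cycleType = τ.cycleType) (hF : ∀ i ∈ F, σ i = i) (hF' : ∀ i ∈ F', τ i = i)
    (hcard : F.card = F'.card) :
    ∃ π : Equiv.Perm ι, ofPerm π * signedOn σ F * (ofPerm π)⁻¹ = signedOn τ F' := by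
  obtain ⟨π, hπ⟩ := isConj_iff.1 (Equiv.Perm.isConj_iff_cycleType_eq.2 h)
  set E : Finset ι := F.map π.toEmbedding with hE
  have hEτ : ∀ i ∈ E, τ i = i := by
    intro i hi
    obtain ⟨j, hj, rfl⟩ := Finset.mem_map.1 hi
    simp [← hπ, hF j hj]
  obtain ⟨ρ, hρτ, hρ⟩ : ∃ ρ : Equiv.Perm ι, Commute ρ τ ∧ ∀ i, ρ i ∈ F' ↔ i ∈ E := by
    have hcard' : Fintype.card {x : {x // τ x = x} // x.1 ∈ E} =
        Fintype.card {x : {x // τ x = x} // x.1 ∈ F'} := by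
      rw [Fintype.card_congr (Equiv.subtypeSubtypeEquivSubtype (q := (· ∈ E)) fun {x} hx ↦ hEτ x hx),
        Fintype.card_congr (Equiv.subtypeSubtypeEquivSubtype (q := (· ∈ F')) fun {x} hx ↦ hF' x hx)]
      simp only [Fintype.card_coe, hE, Finset.card_map, hcard]
    set ρ₀ : Equiv.Perm {x // τ x = x} :=
      Equiv.extendSubtype (Fintype.equivOfCardEq hcard') with hρ₀
    refine ⟨Equiv.Perm.ofSubtype ρ₀, ?_, fun i ↦ ?_⟩
    · refine Equiv.Perm.Disjoint.commute fun i ↦ ?_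
      by_cases hi : τ i = i
      · exact Or.inr hi
      · exact Or.inl (Equiv.Perm.ofSubtype_apply_of_not_mem _ hi)
    · by_cases hi : τ i = i
      · rw [Equiv.Perm.ofSubtype_apply_of_mem ρ₀ hi]
        by_cases hiE : i ∈ E
        · simpa [hiE] using Equiv.extendSubtype_mem (Fintype.equivOfCardEq hcard') ⟨i, hi⟩ hiE
        · simpa [hiE] using Equiv.extendSubtype_not_mem (Fintype.equivOfCardEq hcard') ⟨i, hi⟩ hiE
      · rw [Equiv.Perm.ofSubtype_apply_of_not_mem ρ₀ hi]
        exact iff_of_false (fun h ↦ hi (hF' i h)) (fun h ↦ hi (hEτ i h))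
  have hperm : (ρ * π) * σ * (ρ * π)⁻¹ = τ := by
    calc (ρ * π) * σ * (ρ * π)⁻¹ = ρ * (π * σ * π⁻¹) * ρ⁻¹ := by group
      _ = τ := by rw [hπ, hρτ.eq, mul_inv_cancel_right]
  refine ⟨ρ * π, SignedPerm_s11.ext hperm (funext fun i ↦ ?_)⟩
  obtain ⟨j, rfl⟩ := (ρ * π).surjective i
  have : ρ (π j) ∈ F' ↔ j ∈ F := by rw [hρ, hE]; simp
  simp [signedOn, this]

/-- The fixed-point-free involutions which are not evenly conjugate to a permutation. -/
def IsTwisted (g : SignedPerm_s11 ι) : Prop :=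
  Multiset.card g.perm.cycleType * 2 = Fintype.card ι ∧ ¬ EvenConj g (ofPerm g.perm)

lemma EvenConj.isTwisted {g h : SignedPerm_s11 ι} (H : EvenConj g h) (hg : IsTwisted g) :
    IsTwisted h :=
  ⟨H.cycleType_eq ▸ hg.1, fun H' ↦ hg.2
    ((H.trans H').trans (evenConj_ofPerm H.cycleType_eq.symm))⟩

lemma negFix_eq_empty {g : SignedPerm_s11 ι} (hg : g ^ 2 = 1)
    (h : Multiset.card g.perm.cycleType * 2 = Fintype.card ι) : negFix g = ∅ := by
  have hp : g.perm ^ 2 = 1 := by rw [← perm_pow, hg, perm_one]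
  rw [← card_support_of_pow_prime Nat.prime_two hp, Finset.card_eq_iff_eq_univ] at h
  have hd := disjoint_support_negFix g
  rw [h, ← Finset.top_eq_univ, top_disjoint] at hd
  exact hd

lemma evenConj_iff_of_sq {g h : SignedPerm_s11 ι} (hg : g ^ 2 = 1) (hh : h ^ 2 = 1) :
    EvenConj g h ↔ Multiset.card g.perm.cycleType = Multiset.card h.perm.cycleType ∧
      (negFix g).card = (negFix h).card ∧ (IsTwisted g ↔ IsTwisted h) := by
  refine ⟨fun H ↦ ⟨by rw [H.cycleType_eq], H.card_negFix_eq, H.isTwisted, H.symm.isTwisted⟩, ?_⟩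
  rintro ⟨h1, h2, h3⟩
  have hgp : g.perm ^ 2 = 1 := by rw [← perm_pow, hg, perm_one]
  have hhp : h.perm ^ 2 = 1 := by rw [← perm_pow, hh, perm_one]
  have hct : g.perm.cycleType = h.perm.cycleType := by
    rw [cycleType_eq_replicate Nat.prime_two hgp, cycleType_eq_replicate Nat.prime_two hhp, h1]
  obtain ⟨π, hπ⟩ := exists_perm_conj_signedOn hct (fun i hi ↦ (mem_negFix.1 hi).1)
    (fun i hi ↦ (mem_negFix.1 hi).1) h2
  obtain ⟨δ, hδ, hδfix⟩ := exists_ofSign_conj_of_sq hg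
  obtain ⟨η, hη, hηfix⟩ := exists_ofSign_conj_of_sq hh
  have key (hδη : ∏ i, δ i = ∏ i, η i) : EvenConj g h := by
    refine ⟨(ofSign η)⁻¹ * ofPerm π * ofSign δ, ?_, ?_⟩
    · simp [hδη]
    · rw [← hδ, ← hη] at hπ
      calc _ = (ofSign η)⁻¹ * (ofPerm π * (ofSign δ * g * (ofSign δ)⁻¹) * (ofPerm π)⁻¹) *
            ofSign η := by group
        _ = h := by rw [hπ]; group
  have hfix {k : SignedPerm_s11 ι} (hk : k.perm ^ 2 = 1)
      (hne : Multiset.card k.perm.cycleType * 2 ≠ Fintype.card ι) : ∃ i, k.perm i = i := by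
    by_contra! hall
    apply hne
    rw [← card_support_of_pow_prime Nat.prime_two hk, Finset.card_eq_iff_eq_univ]
    ext i
    simp [hall]
  by_cases hn : Multiset.card g.perm.cycleType * 2 = Fintype.card ι
  · have hn' := h1 ▸ hn
    rw [negFix_eq_empty hg hn, signedOn_empty] at hδ
    rw [negFix_eq_empty hh hn', signedOn_empty] at hη
    by_cases ht : IsTwisted g
    · have hδ1 : ∏ i, δ i = -1 := (Int.units_eq_one_or _).resolve_left
        fun h ↦ ht.2 ⟨ofSign δ, h, hδ⟩
      have hη1 : ∏ i, η i = -1 := (Int.units_eq_one_or _).resolve_left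
        fun h ↦ (h3.1 ht).2 ⟨ofSign η, h, hη⟩
      exact key (hδ1.trans hη1.symm)
    · have ht' := mt h3.2 ht
      simp only [IsTwisted, hn, hn', true_and, not_not] at ht ht'
      exact (ht.trans (evenConj_ofPerm hct)).trans ht'.symm
  · exact key ((hδfix (hfix hgp hn)).trans (hηfix (hfix hhp (h1 ▸ hn))).symm)

/-- A fixed-point-free involution with a single negative two-cycle is twisted. -/
lemma isTwisted_conj {σ : Equiv.Perm ι} (hσ : σ ^ 2 = 1)
    (hn : Multiset.card σ.cycleType * 2 = Fintype.card ι) {δ : ι → ℤˣ} (hδ : ∏ i, δ i = -1) :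
    IsTwisted (ofSign δ * ofPerm σ * (ofSign δ)⁻¹) := by
  have hsupp : σ.support = Finset.univ := by
    rw [← Finset.card_eq_iff_eq_univ, card_support_of_pow_prime Nat.prime_two hσ, hn]
  refine ⟨by simpa using hn, ?_⟩
  rintro ⟨x, hx, hx'⟩
  set y := x * ofSign δ with hy
  have hy1 : parity y = -1 := by simp [hy, hx, hδ]
  have hyσ : y * ofPerm σ = ofPerm σ * y := by
    rw [ofSign_conj_perm, perm_ofPerm] at hx'
    rw [← mul_inv_eq_iff_eq_mul, hy]
    refine Eq.trans ?_ hx'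
    group
  have hinv : ∀ i, y.sign (σ i) = y.sign i := fun i ↦ by
    simpa using congr_arg (fun z ↦ z.sign i) hyσ
  have : parity y = 1 := by
    refine Finset.prod_involution (fun i _ ↦ σ i) (fun i _ ↦ ?_) (fun i _ _ ↦ ?_)
      (fun _ _ ↦ Finset.mem_univ _) fun i _ ↦ ?_
    · rw [hinv, Int.units_mul_self]
    · exact Equiv.Perm.mem_support.1 (hsupp ▸ Finset.mem_univ i)
    · simpa [pow_two] using congr_arg (fun z : Equiv.Perm ι ↦ z i) hσ
  rw [this] at hy1
  exact absurd hy1 (by decide)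

lemma exists_involution_iff (k m : ℕ) (q : Prop) :
    (∃ g : SignedPerm_s11 ι, parity g = 1 ∧ orderOf g = 2 ∧ Multiset.card g.perm.cycleType = k ∧
      (negFix g).card / 2 = m ∧ (IsTwisted g ↔ q)) ↔
      1 ≤ k + m ∧ 2 * (k + m) ≤ Fintype.card ι ∧ (q → 2 * k = Fintype.card ι) := by
  constructor
  · rintro ⟨g, hpar, hg, rfl, rfl, hq⟩
    rw [orderOf_eq_prime_iff] at hg
    have hgp : g.perm ^ 2 = 1 := by rw [← perm_pow, hg.1, perm_one]
    have hsupp := card_support_of_pow_prime Nat.prime_two hgp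
    obtain ⟨m, hm⟩ := even_card_negFix hg.1 hpar
    have hle := Finset.card_le_univ (g.perm.support ∪ negFix g)
    rw [Finset.card_union_of_disjoint (disjoint_support_negFix g)] at hle
    refine ⟨?_, by omega, fun h ↦ by rw [mul_comm]; exact (hq.2 h).1⟩
    by_contra h
    have h0 : Multiset.card g.perm.cycleType = 0 := by omega
    have hm0 : negFix g = ∅ := Finset.card_eq_zero.1 (by omega)
    rw [Multiset.card_eq_zero, Equiv.Perm.cycleType_eq_zero] at h0
    refine hg.2 (ext_apply (fun i ↦ by simp [h0]) fun i ↦ ?_)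
    refine (Int.units_eq_one_or _).resolve_right fun hi ↦ ?_
    have : i ∈ negFix g := mem_negFix.2 ⟨by simp [h0], hi⟩
    simp [hm0] at this
  · rintro ⟨h1, h2, hq⟩
    obtain ⟨σ, hσ⟩ := (Equiv.Perm.exists_with_cycleType_iff ι (m := Multiset.replicate k 2)).2
      ⟨by simp; omega, fun a ha ↦ (Multiset.eq_of_mem_replicate ha).ge⟩
    have hσ2 : σ ^ 2 = 1 :=
      Equiv.Perm.pow_prime_eq_one_iff.2 fun c hc ↦ Multiset.eq_of_mem_replicate (hσ ▸ hc)
    have hσk : Multiset.card σ.cycleType = k := by simp [hσ]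
    have hσσ : ∀ i, σ (σ i) = i := fun i ↦ by
      simpa [pow_two] using congr_arg (fun z : Equiv.Perm ι ↦ z i) hσ2
    by_cases hq' : q
    · have hn : Multiset.card σ.cycleType * 2 = Fintype.card ι := by rw [hσk, ← hq hq', mul_comm]
      have hk : 0 < Fintype.card ι := by have := hq hq'; omega
      obtain ⟨i⟩ := Fintype.card_pos_iff.1 hk
      have hord : orderOf (ofSign (Pi.mulSingle i (-1)) * ofPerm σ *
          (ofSign (Pi.mulSingle i (-1)))⁻¹) = 2 := by
        refine ((MulAut.conj (ofSign (Pi.mulSingle i (-1)))).orderOf_eq (ofPerm σ)).trans ?_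
        rw [orderOf_injective ofPerm ofPerm_injective, orderOf_eq_prime_iff]
        refine ⟨hσ2, fun h ↦ ?_⟩
        rw [h] at hσk
        simp at hσk
        have := hq hq'
        omega
      refine ⟨_, ?_, hord, ?_, ?_, iff_of_true (isTwisted_conj hσ2 hn ?_) hq'⟩
      · simp
      · simpa using hσk
      · rw [negFix_eq_empty (orderOf_eq_prime_iff.1 hord).1 (by simpa using hn)]
        have := hq hq'
        simp
        omega
      · simp
    · have hcard : 2 * m ≤ σ.supportᶜ.card := by
        rw [Finset.card_compl, card_support_of_pow_prime Nat.prime_two hσ2, hσk]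
        omega
      obtain ⟨F, hF, hFm⟩ := Finset.exists_subset_card_eq hcard
      have hFσ : ∀ i ∈ F, σ i = i := fun i hi ↦ by simpa using hF hi
      have hFσ' : ∀ i, σ i ∈ F ↔ i ∈ F := fun i ↦
        ⟨fun hi ↦ by rwa [← hσσ i, hFσ _ hi], fun hi ↦ by rwa [hFσ _ hi]⟩
      have hneg : negFix (signedOn σ F) = F := by
        ext i
        by_cases hi : i ∈ F
        · simp [mem_negFix, signedOn, hi, hFσ i hi]
        · simp [mem_negFix, signedOn, hi]
      refine ⟨signedOn σ F, ?_, ?_, hσk, by rw [hneg, hFm]; omega, iff_of_false ?_ hq'⟩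
      · rw [parity_signedOn, hFm, pow_mul, Int.units_sq, one_pow]
      · rw [orderOf_eq_prime_iff]
        refine ⟨ext_apply (fun i ↦ ?_) fun i ↦ ?_, fun h ↦ ?_⟩
        · simpa [pow_two, signedOn] using hσσ i
        · by_cases hi : i ∈ F <;> simp [pow_two, signedOn, hFσ', hi]
        · have hk0 : σ = 1 := congr_arg perm h
          have hm0 : F = ∅ := by
            rw [← hneg, h]
            ext i
            simp [mem_negFix]
          subst hk0 hm0
          simp at hσk hFm
          omega
      · rintro ⟨hn, htw⟩
        have hn' : k * 2 = Fintype.card ι := hσk ▸ hn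
        have hm0 : F = ∅ := Finset.card_eq_zero.1 (by omega)
        subst hm0
        exact htw ⟨1, by simp, by simp [signedOn_empty]⟩

end Fintype

end SignedPerm_s11

/-- The relations of type `D` among `t 0, …, t k`: the nodes `1, 2, …, k` form a path and
the node `0` is joined to the node `2` only. -/
structure TypeDRelations {W : Type*} [Group W] (t : ℕ → W) (k : ℕ) : Prop where
  sq : ∀ i ≤ k, t i * t i = 1
  comm_zero_one : 1 ≤ k → t 0 * t 1 = t 1 * t 0
  comm_zero : ∀ j, 3 ≤ j → j ≤ k → t 0 * t j = t j * t 0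
  comm : ∀ i j, 1 ≤ i → i + 2 ≤ j → j ≤ k → t i * t j = t j * t i
  braid_zero : 2 ≤ k → t 0 * t 2 * t 0 = t 2 * t 0 * t 2
  braid : ∀ i, 1 ≤ i → i + 1 ≤ k → t i * t (i + 1) * t i = t (i + 1) * t i * t (i + 1)

namespace TypeDRelations

variable {W : Type*} [Group W] {t : ℕ → W} {k : ℕ}

lemma mono (h : TypeDRelations t k) {l : ℕ} (hl : l ≤ k) : TypeDRelations t l where
  sq i hi := h.sq i (hi.trans hl)
  comm_zero_one h1 := h.comm_zero_one (h1.trans hl)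
  comm_zero j hj hjl := h.comm_zero j hj (hjl.trans hl)
  comm i j hi hij hj := h.comm i j hi hij (hj.trans hl)
  braid_zero h2 := h.braid_zero (h2.trans hl)
  braid i hi hil := h.braid i hi (hil.trans hl)

/-- The element `t (j + 1) * ⋯ * t k`, which sends `e k` to `e j`. -/
def posRep (t : ℕ → W) (k j : ℕ) : W := ((List.range' (j + 1) (k - j)).map t).prod

/-- An element which sends `e k` to `- e j`. -/
def negRep (t : ℕ → W) (k : ℕ) : ℕ → W
  | 0 => t 0 * posRep t k 1
  | 1 => t 0 * posRep t k 0
  | j + 2 => t (j + 2) * negRep t k (j + 1)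

/-- The action of the `i`-th generator on signed indices. -/
def genAct (i : ℕ) (x : ℕ × ℤˣ) : ℕ × ℤˣ :=
  if i = 0 then
    if x.1 = 0 then (1, -x.2) else if x.1 = 1 then (0, -x.2) else x
  else if x.1 + 1 = i then (i, x.2) else if x.1 = i then (i - 1, x.2) else x

/-- A coset representative sending `e k` to the signed basis vector `x`. -/
def rep (t : ℕ → W) (k : ℕ) (x : ℕ × ℤˣ) : W :=
  if x.2 = 1 then posRep t k x.1 else negRep t k x.1

lemma posRep_self : posRep t k k = 1 := by simp [posRep]

lemma posRep_of_lt {j : ℕ} (hj : j < k) : posRep t k j = t (j + 1) * posRep t k (j + 1) := by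
  obtain ⟨d, rfl⟩ := Nat.exists_eq_add_of_lt hj
  simp only [posRep, show j + d + 1 - j = d + 1 by omega,
    show j + d + 1 - (j + 1) = d by omega, List.range'_succ, List.map_cons, List.prod_cons]

lemma mul_self_mul (h : TypeDRelations t k) {i : ℕ} (hi : i ≤ k) (g : W) :
    t i * (t i * g) = g := by rw [← mul_assoc, h.sq i hi, one_mul]

lemma mul_comm_mul (h : TypeDRelations t k) {i j : ℕ} (hi : 1 ≤ i) (hij : i + 2 ≤ j)
    (hj : j ≤ k) (g : W) : t i * (t j * g) = t j * (t i * g) := by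
  rw [← mul_assoc, h.comm i j hi hij hj, mul_assoc]

lemma zero_mul_comm_mul (h : TypeDRelations t k) {j : ℕ} (hj3 : 3 ≤ j)
    (hj : j ≤ k) (g : W) : t 0 * (t j * g) = t j * (t 0 * g) := by
  rw [← mul_assoc, h.comm_zero j hj3 hj, mul_assoc]

lemma zero_mul_one_mul (h : TypeDRelations t k) (hk : 1 ≤ k) (g : W) :
    t 0 * (t 1 * g) = t 1 * (t 0 * g) := by
  rw [← mul_assoc, h.comm_zero_one hk, mul_assoc]

lemma braid_mul (h : TypeDRelations t k) {i : ℕ} (hi : 1 ≤ i) (hik : i + 1 ≤ k) (g : W) :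
    t i * (t (i + 1) * (t i * g)) = t (i + 1) * (t i * (t (i + 1) * g)) := by
  simpa only [mul_assoc] using congr_arg (· * g) (h.braid i hi hik)

lemma braid_zero_mul (h : TypeDRelations t k) (hk : 2 ≤ k) (g : W) :
    t 0 * (t 2 * (t 0 * g)) = t 2 * (t 0 * (t 2 * g)) := by
  simpa only [mul_assoc] using congr_arg (· * g) (h.braid_zero hk)

lemma mul_posRep_of_lt (h : TypeDRelations t k) {i j : ℕ} (hi : 1 ≤ i) (hij : i < j)
    (hj : j ≤ k) : t i * posRep t k j = posRep t k j * t i := by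
  induction hj using Nat.decreasingInduction with
  | self => simp [posRep_self]
  | of_succ j hjk ih =>
    rw [posRep_of_lt hjk, h.mul_comm_mul hi (by omega) (by omega), ih (by omega), mul_assoc]

lemma zero_mul_posRep (h : TypeDRelations t k) {j : ℕ} (h2 : 2 ≤ j)
    (hj : j ≤ k) : t 0 * posRep t k j = posRep t k j * t 0 := by
  induction hj using Nat.decreasingInduction with
  | self => simp [posRep_self]
  | of_succ j hjk ih =>
    rw [posRep_of_lt hjk, h.zero_mul_comm_mul (by omega) (by omega), ih (by omega), mul_assoc]

lemma mul_posRep_of_gt (h : TypeDRelations t k) {i j : ℕ} (hij : j + 1 ≤ i)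
    (hi : i + 1 ≤ k) : t (i + 1) * posRep t k j = posRep t k j * t i := by
  have hj : j ≤ i - 1 := by omega
  induction hj using Nat.decreasingInduction with
  | self =>
    obtain ⟨i, rfl⟩ : ∃ l, i = l + 1 := ⟨i - 1, by omega⟩
    simp only [Nat.add_sub_cancel]
    rw [posRep_of_lt (by omega), posRep_of_lt (by omega), ← h.braid_mul (by omega) (by omega),
      h.mul_posRep_of_lt (by omega) (by omega) (by omega)]
    simp only [mul_assoc]
  | of_succ j hjk ih =>
    rw [posRep_of_lt (by omega), ← h.mul_comm_mul (by omega) (by omega) (by omega),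
      ih (by omega) , mul_assoc]

/-- The subgroup generated by `t 0, …, t k`. -/
def initial (t : ℕ → W) (k : ℕ) : Subgroup W := Subgroup.closure (t '' Set.Iic k)

lemma mem_initial {i : ℕ} (hi : i ≤ k) : t i ∈ initial t k :=
  Subgroup.subset_closure ⟨i, hi, rfl⟩

lemma exists_mul_posRep (h : TypeDRelations t k) (hk : 2 ≤ k) {i j : ℕ} (hi : i ≤ k) (hj : j ≤ k)
    (hfix : genAct i (j, 1) = (j, 1)) :
    ∃ l ∈ initial t (k - 1), t i * posRep t k j = posRep t k j * l := by
  rcases Nat.eq_zero_or_pos i with rfl | hi0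
  · have h2 : 2 ≤ j := by
      by_contra h2
      interval_cases j <;> simp [genAct] at hfix
    exact ⟨_, mem_initial (by omega), h.zero_mul_posRep h2 hj⟩
  · have h1 : j + 1 ≠ i := by rintro rfl; simp [genAct] at hfix
    have h2 : j ≠ i := by rintro rfl; simp [genAct, hi0.ne'] at hfix; omega
    rcases lt_or_ge i j with hij | hij
    · exact ⟨_, mem_initial (by omega), h.mul_posRep_of_lt hi0 hij hj⟩
    · obtain ⟨i, rfl⟩ : ∃ l, i = l + 1 := ⟨i - 1, by omega⟩
      exact ⟨_, mem_initial (by omega), h.mul_posRep_of_gt (by omega) hi⟩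

lemma negRep_zero : negRep t k 0 = t 0 * posRep t k 1 := rfl

lemma negRep_one : negRep t k 1 = t 0 * posRep t k 0 := rfl

lemma negRep_add_two (j : ℕ) : negRep t k (j + 2) = t (j + 2) * negRep t k (j + 1) := rfl

lemma one_mul_negRep_zero (h : TypeDRelations t k) (hk : 1 ≤ k) :
    t 1 * negRep t k 0 = negRep t k 1 := by
  rw [negRep_zero, negRep_one, ← h.zero_mul_one_mul hk, posRep_of_lt (j := 0) hk]

lemma negRep_succ (h : TypeDRelations t k) {j : ℕ} (hj : j + 1 ≤ k) :
    negRep t k (j + 1) = t (j + 1) * negRep t k j := by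
  cases j with
  | zero => exact (h.one_mul_negRep_zero hj).symm
  | succ j => rfl

lemma exists_mul_negRep (h : TypeDRelations t k) (hk : 2 ≤ k) {i j : ℕ} (hi : i ≤ k) (hj : j ≤ k)
    (hfix : genAct i (j, 1) = (j, 1)) :
    ∃ l ∈ initial t (k - 1), t i * negRep t k j = negRep t k j * l := by
  induction j using Nat.strong_induction_on generalizing i with
  | _ j ih =>
  have h01 : i = 0 → 2 ≤ j := by
    rintro rfl
    by_contra h2
    interval_cases j <;> simp [genAct] at hfix
  have h1 : j + 1 ≠ i := by rintro rfl; simp [genAct] at hfix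
  have h2 : j ≠ i := by
    rintro rfl
    rcases Nat.eq_zero_or_pos j with rfl | h0
    · exact absurd (h01 rfl) (by omega)
    · simp [genAct, h0.ne'] at hfix; omega
  match j with
  | 0 =>
    obtain ⟨i, rfl⟩ : ∃ l, i = l + 2 := ⟨i - 2, by omega⟩
    rcases Nat.eq_zero_or_pos i with rfl | hi0
    · refine ⟨t 0, mem_initial (by omega), ?_⟩
      rw [negRep_zero, posRep_of_lt (by omega), zero_add, ← h.braid_zero_mul hk,
        h.zero_mul_posRep le_rfl hk]
      simp only [mul_assoc]
    · refine ⟨t (i + 1), mem_initial (by omega), ?_⟩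
      rw [negRep_zero, ← h.zero_mul_comm_mul (by omega) hi,
        h.mul_posRep_of_gt (by omega) hi, mul_assoc]
  | 1 =>
    obtain ⟨i, rfl⟩ : ∃ l, i = l + 3 := ⟨i - 3, by omega⟩
    refine ⟨t (i + 2), mem_initial (by omega), ?_⟩
    rw [negRep_one, ← h.zero_mul_comm_mul (by omega) hi,
        h.mul_posRep_of_gt (by omega) hi, mul_assoc]
  | j + 2 =>
    rcases Nat.eq_zero_or_pos i with rfl | hi0
    · rcases Nat.eq_zero_or_pos j with rfl | hj0
      · refine ⟨t 1, mem_initial (by omega), ?_⟩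
        rw [negRep_add_two, zero_add, negRep_one, h.braid_zero_mul hk,
          h.mul_posRep_of_gt le_rfl hk]
        simp only [mul_assoc]
      · obtain ⟨l, hl, hl'⟩ := ih (j + 1) (by omega) hi (by omega)
          (by simp [genAct, hj0.ne'])
        refine ⟨l, hl, ?_⟩
        rw [negRep_add_two, h.zero_mul_comm_mul (by omega) hj, hl', mul_assoc]
    · rcases lt_trichotomy i (j + 1) with hij | rfl | hij
      · obtain ⟨l, hl, hl'⟩ := ih (j + 1) (by omega) hi (by omega)
          (by simp only [genAct, hi0.ne', ↓reduceIte]; grind)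
        refine ⟨l, hl, ?_⟩
        rw [negRep_add_two, h.mul_comm_mul (by omega) (by omega) hj, hl', mul_assoc]
      · obtain ⟨l, hl, hl'⟩ := ih j (by omega) hj (by omega)
          (by simp [genAct])
        refine ⟨l, hl, ?_⟩
        rw [negRep_add_two, h.negRep_succ hi, h.braid_mul (by omega) hj, hl']
        simp only [mul_assoc]
      · obtain ⟨l, hl, hl'⟩ := ih (j + 1) (by omega) hi (by omega)
          (by simp only [genAct, hi0.ne', ↓reduceIte]; grind)
        refine ⟨l, hl, ?_⟩
        rw [negRep_add_two, ← h.mul_comm_mul (by omega) (by omega) hi, hl', mul_assoc]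

lemma exists_mul_rep (h : TypeDRelations t k) (hk : 2 ≤ k) {i : ℕ} {x : ℕ × ℤˣ} (hi : i ≤ k)
    (hx : x.1 ≤ k) :
    ∃ l ∈ initial t (k - 1), t i * rep t k x = rep t k (genAct i x) * l := by
  by_cases hfix : genAct i x = x
  · obtain ⟨j, e⟩ := x
    have hfix' : genAct i (j, 1) = (j, 1) := by
      simp only [genAct] at hfix ⊢
      grind
    rw [hfix]
    unfold rep
    split_ifs
    · exact h.exists_mul_posRep hk hi hx hfix'
    · exact h.exists_mul_negRep hk hi hx hfix'
  · refine ⟨1, one_mem _, ?_⟩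
    rw [mul_one]
    obtain ⟨j, e⟩ := x
    simp only [genAct] at hfix ⊢
    rcases Nat.eq_zero_or_pos i with rfl | hi0
    · rcases Int.units_eq_one_or e with rfl | rfl
      · match j with
        | 0 => simp [rep, negRep_one]
        | 1 => simp [rep, negRep_zero]
        | j + 2 => simp at hfix
      · match j with
        | 0 => simp [rep, negRep_zero, h.mul_self_mul]
        | 1 => simp [rep, negRep_one, h.mul_self_mul]
        | j + 2 => simp at hfix
    · by_cases h1 : j + 1 = i
      · subst h1
        rcases Int.units_eq_one_or e with rfl | rfl
        · simp [rep, posRep_of_lt (Nat.lt_of_succ_le hi), h.mul_self_mul hi]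
        · simp [rep, h.negRep_succ hi]
      · have h2 : j = i := by by_contra h2; simp [h1, h2, hi0.ne'] at hfix
        subst h2
        obtain ⟨j, rfl⟩ : ∃ l, j = l + 1 := ⟨j - 1, by omega⟩
        rcases Int.units_eq_one_or e with rfl | rfl
        · simp [rep, posRep_of_lt (Nat.lt_of_succ_le hi)]
        · simp [rep, h.negRep_succ hi, h.mul_self_mul hi]

end TypeDRelations

/-! ### The signed permutation representation of the Coxeter group of type `D` -/

section TwoInvolutions

variable {G : Type*} [Group G] {a b : G}

lemma mul_pow_two_eq_one_iff (ha : a * a = 1) (hb : b * b = 1) :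
    (a * b) ^ 2 = 1 ↔ a * b = b * a := by
  rw [pow_two, ← eq_inv_iff_mul_eq_one, mul_inv_rev, inv_eq_of_mul_eq_one_left ha,
    inv_eq_of_mul_eq_one_left hb]

lemma mul_pow_three_eq_one_iff (ha : a * a = 1) (hb : b * b = 1) :
    (a * b) ^ 3 = 1 ↔ a * b * a = b * a * b := by
  have : (a * b) ^ 3 = (a * b * a) * (b * a * b) := by simp only [pow_succ, pow_zero]; group
  rw [this, ← eq_inv_iff_mul_eq_one, mul_inv_rev, mul_inv_rev, inv_eq_of_mul_eq_one_left ha,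
    inv_eq_of_mul_eq_one_left hb, ← mul_assoc]

end TwoInvolutions

lemma typeDMatrix_rev {n a b : ℕ} (hn : 3 ≤ n) (hab : a < b) (hb : b < n) :
    (typeDMatrix n).M (Fin.rev ⟨a, hab.trans hb⟩) (Fin.rev ⟨b, hb⟩) =
      if (1 ≤ a ∧ a + 1 = b) ∨ (a = 0 ∧ b = 2) then 3 else 2 := by
  have h1 : Fin.rev ⟨a, hab.trans hb⟩ ≠ Fin.rev ⟨b, hb⟩ := by
    rw [Ne, Fin.rev_inj, Fin.mk.injEq]
    exact hab.ne
  simp only [typeDMatrix, Matrix.of_apply, if_neg h1, Fin.val_rev]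
  exact if_congr (by omega) rfl rfl

lemma TypeDRelations.isLiftable {W : Type*} [Group W] {t : ℕ → W} {n : ℕ} (hn : 3 ≤ n)
    (h : TypeDRelations t (n - 1)) :
    (typeDMatrix n).IsLiftable fun i ↦ t (Fin.rev i) := by
  have key : ∀ a b (hab : a < b) (hb : b < n),
      (t a * t b) ^ (typeDMatrix n).M (Fin.rev ⟨a, hab.trans hb⟩) (Fin.rev ⟨b, hb⟩) = 1 := by
    intro a b hab hb
    have ha2 := h.sq a (by omega)
    have hb2 := h.sq b (by omega)
    rw [typeDMatrix_rev hn hab]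
    split_ifs with hadj
    · rw [mul_pow_three_eq_one_iff ha2 hb2]
      rcases hadj with ⟨h1, rfl⟩ | ⟨rfl, rfl⟩
      · exact h.braid a h1 (by omega)
      · exact h.braid_zero (by omega)
    · rw [mul_pow_two_eq_one_iff ha2 hb2]
      rcases Nat.eq_zero_or_pos a with rfl | ha
      · rcases (show b = 1 ∨ 3 ≤ b by omega) with rfl | hb3
        · exact h.comm_zero_one (by omega)
        · exact h.comm_zero b hb3 (by omega)
      · exact h.comm a b ha (by omega) (by omega)
  intro i j
  obtain ⟨a, rfl⟩ := Fin.rev_surjective i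
  obtain ⟨b, rfl⟩ := Fin.rev_surjective j
  simp only [Fin.rev_rev]
  rcases lt_trichotomy a b with hab | rfl | hab
  · exact key a b hab b.2
  · rw [(typeDMatrix n).diagonal, pow_one, h.sq _ (by omega)]
  · have := key b a hab a.2
    have hinv : t a * t b = (t b * t a)⁻¹ := by
      rw [mul_inv_rev, inv_eq_of_mul_eq_one_left (h.sq a (by omega)),
        inv_eq_of_mul_eq_one_left (h.sq b (by omega))]
    rw [hinv, inv_pow, inv_eq_one, (typeDMatrix n).symmetric]
    exact this

lemma typeDRelations_simple {W : Type*} [Group W] {n : ℕ} [NeZero n] (hn : 3 ≤ n)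
    (cs : CoxeterSystem (typeDMatrix n) W) :
    TypeDRelations (fun j ↦ cs.simple (Fin.rev (Fin.ofNat n j))) (n - 1) := by
  have hofNat {a : ℕ} (ha : a < n) : Fin.ofNat n a = ⟨a, ha⟩ := Fin.ext (Nat.mod_eq_of_lt ha)
  have key : ∀ {a b : ℕ}, a < b → b ≤ n - 1 →
      (cs.simple (Fin.rev (Fin.ofNat n a)) * cs.simple (Fin.rev (Fin.ofNat n b))) ^
        (if (1 ≤ a ∧ a + 1 = b) ∨ (a = 0 ∧ b = 2) then 3 else 2) = 1 := by
    intro a b hab hb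
    have hb' : b < n := by omega
    rw [← typeDMatrix_rev hn hab hb', hofNat hb', hofNat (hab.trans hb')]
    exact cs.simple_mul_simple_pow _ _
  have hsq := cs.simple_mul_simple_self
  have hcomm : ∀ {a b : ℕ}, a < b → b ≤ n - 1 → ¬ ((1 ≤ a ∧ a + 1 = b) ∨ (a = 0 ∧ b = 2)) →
      cs.simple (Fin.rev (Fin.ofNat n a)) * cs.simple (Fin.rev (Fin.ofNat n b)) =
        cs.simple (Fin.rev (Fin.ofNat n b)) * cs.simple (Fin.rev (Fin.ofNat n a)) := by
    intro a b hab hb hadj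
    have := key hab hb
    rwa [if_neg hadj, mul_pow_two_eq_one_iff (hsq _) (hsq _)] at this
  have hbraid : ∀ {a b : ℕ}, a < b → b ≤ n - 1 → ((1 ≤ a ∧ a + 1 = b) ∨ (a = 0 ∧ b = 2)) →
      cs.simple (Fin.rev (Fin.ofNat n a)) * cs.simple (Fin.rev (Fin.ofNat n b)) *
        cs.simple (Fin.rev (Fin.ofNat n a)) =
      cs.simple (Fin.rev (Fin.ofNat n b)) * cs.simple (Fin.rev (Fin.ofNat n a)) *
        cs.simple (Fin.rev (Fin.ofNat n b)) := by
    intro a b hab hb hadj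
    have := key hab hb
    rwa [if_pos hadj, mul_pow_three_eq_one_iff (hsq _) (hsq _)] at this
  exact
    { sq := fun i _ ↦ hsq _
      comm_zero_one := fun h ↦ hcomm (by omega) (by omega) (by omega)
      comm_zero := fun j hj hjn ↦ hcomm (by omega) hjn (by omega)
      comm := fun i j hi hij hj ↦ hcomm (by omega) hj (by omega)
      braid_zero := fun h ↦ hbraid (by omega) h (by omega)
      braid := fun i hi hin ↦ hbraid (by omega) hin (by omega) }

namespace SignedPerm_s11

variable {n : ℕ} [NeZero n]

/-- The adjacent transposition `(i - 1, i)`. -/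
def adjSwap (n : ℕ) [NeZero n] (i : ℕ) : Equiv.Perm (Fin n) :=
  Equiv.swap (Fin.ofNat n (i - 1)) (Fin.ofNat n i)

/-- The sign change of `e 0`. -/
def signZero (n : ℕ) [NeZero n] : SignedPerm_s11 (Fin n) := ofSign (Pi.mulSingle 0 (-1))

/-- The generators of type `D`: adjacent transpositions, and for `i = 0` the reflection
exchanging `e 0` and `- e 1`. -/
def gen (n : ℕ) [NeZero n] (i : ℕ) : SignedPerm_s11 (Fin n) :=
  if i = 0 then signZero n * ofPerm (adjSwap n 1) * (signZero n)⁻¹ else ofPerm (adjSwap n i)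

lemma ofNat_ne {i j : ℕ} (hi : i < n) (hj : j < n) (h : i ≠ j) :
    Fin.ofNat n i ≠ Fin.ofNat n j := fun H ↦ h (by
  simpa [Nat.mod_eq_of_lt hi, Nat.mod_eq_of_lt hj] using congr_arg Fin.val H)

lemma adjSwap_mul_self (i : ℕ) : adjSwap n i * adjSwap n i = 1 := Equiv.swap_mul_self _ _

lemma adjSwap_comm {i j : ℕ} (hi : 1 ≤ i) (hij : i + 2 ≤ j) (hj : j < n) :
    adjSwap n i * adjSwap n j = adjSwap n j * adjSwap n i := by
  refine (Equiv.Perm.disjoint_swap_swap ?_).commute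
  simp only [List.nodup_cons, List.mem_cons, List.not_mem_nil, or_false, not_or, not_false_eq_true,
    List.nodup_nil, and_true]
  refine ⟨⟨?_, ?_, ?_⟩, ⟨?_, ?_⟩, ?_⟩ <;> exact ofNat_ne (by omega) (by omega) (by omega)

lemma adjSwap_braid {i : ℕ} (hi : 1 ≤ i) (hin : i + 1 < n) :
    adjSwap n i * adjSwap n (i + 1) * adjSwap n i =
      adjSwap n (i + 1) * adjSwap n i * adjSwap n (i + 1) := by
  have h1 := ofNat_ne (n := n) (i := i - 1) (j := i) (by omega) (by omega) (by omega)
  have h2 := ofNat_ne (n := n) (i := i) (j := i + 1) (by omega) (by omega) (by omega)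
  have h3 := ofNat_ne (n := n) (i := i - 1) (j := i + 1) (by omega) (by omega) (by omega)
  simp only [adjSwap, Nat.add_sub_cancel]
  rw [Equiv.swap_mul_swap_mul_swap h1 h3, Equiv.swap_comm (Fin.ofNat n (i - 1)),
    Equiv.swap_comm (Fin.ofNat n i) (Fin.ofNat n (i + 1)),
    Equiv.swap_mul_swap_mul_swap h2.symm h3.symm, Equiv.swap_comm]

lemma signZero_comm {j : ℕ} (hj : 2 ≤ j) (hjn : j < n) :
    signZero n * ofPerm (adjSwap n j) = ofPerm (adjSwap n j) * signZero n := by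
  refine ext_apply (fun i ↦ by simp [signZero]) fun i ↦ ?_
  have h1 := ofNat_ne (n := n) (i := j - 1) (j := 0) (by omega) (by omega) (by omega)
  have h2 := ofNat_ne (n := n) (i := j) (j := 0) (by omega) (by omega) (by omega)
  have h0 : Fin.ofNat n 0 = 0 := rfl
  rw [h0] at h1 h2
  have h3 : adjSwap n j i = 0 ↔ i = 0 := by
    rw [adjSwap, Equiv.swap_apply_eq_iff, Equiv.swap_apply_of_ne_of_ne h1.symm h2.symm]
  by_cases hi : i = 0
  · subst hi
    simp [signZero, h3.2 rfl]
  · simp [signZero, hi, h3]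

lemma gen_zero : gen n 0 = signZero n * ofPerm (adjSwap n 1) * (signZero n)⁻¹ := rfl

lemma gen_of_pos {i : ℕ} (hi : 1 ≤ i) : gen n i = ofPerm (adjSwap n i) :=
  if_neg (by omega)

/-- The generators other than the first two commute with the sign change of `e 0`. -/
lemma gen_eq_conj {j : ℕ} (hj : 2 ≤ j) (hjn : j < n) :
    gen n j = signZero n * ofPerm (adjSwap n j) * (signZero n)⁻¹ := by
  rw [signZero_comm hj hjn, mul_inv_cancel_right, gen_of_pos (by omega)]

lemma val_act_gen {i : ℕ} (hi : i < n) (hn : 2 ≤ n) (x : Fin n × ℤˣ) :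
    (((gen n i).act x).1.val, ((gen n i).act x).2) =
      TypeDRelations.genAct i (x.1.val, x.2) := by
  obtain ⟨j, e⟩ := x
  have hsw : ∀ {i : ℕ}, 1 ≤ i → i < n → ∀ j : Fin n, (adjSwap n i j).val =
      if j.val + 1 = i then i else if j.val = i then i - 1 else j.val := by
    intro i hi1 hi j
    rw [adjSwap, Equiv.swap_apply_def]
    simp only [apply_ite Fin.val, Fin.ext_iff, Fin.val_ofNat, Nat.mod_eq_of_lt hi,
      Nat.mod_eq_of_lt (show i - 1 < n by omega)]
    split_ifs <;> omega
  rcases Nat.eq_zero_or_pos i with rfl | hi0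
  · have h1 := hsw le_rfl (by omega) j
    have h2 : adjSwap n 1 j = 0 ↔ j.val = 1 := by
      rw [Fin.ext_iff, Fin.val_zero]
      split_ifs at h1 <;> omega
    have h3 : j = 0 ↔ j.val = 0 := by rw [Fin.ext_iff, Fin.val_zero]
    simp only [act, gen_zero, signZero, ofSign_conj_sign, perm_ofPerm, sign_ofPerm, mul_one,
      ofSign_conj_perm, TypeDRelations.genAct, h1, Pi.mulSingle_apply, h2, h3]
    by_cases j0 : j.val = 0
    · simp [j0]
    · by_cases j1 : j.val = 1 <;> simp [j0, j1]
  · simp only [act, gen_of_pos hi0, perm_ofPerm, sign_ofPerm, one_mul, hsw hi0 hi,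
      TypeDRelations.genAct, hi0.ne', if_false]
    grind

lemma gen_zero_mul_gen_one (hn : 2 ≤ n) :
    gen n 0 * gen n 1 = ofSign (Pi.mulSingle 0 (-1) * Pi.mulSingle (Fin.ofNat n 1) (-1)) := by
  have h0 : Fin.ofNat n 0 = 0 := rfl
  have h1 : adjSwap n 1 = Equiv.swap 0 (Fin.ofNat n 1) := rfl
  have hne := ofNat_ne (n := n) (i := 0) (j := 1) (by omega) (by omega) (by omega)
  rw [h0] at hne
  rw [gen_zero, gen_of_pos le_rfl, h1]
  refine ext_apply (fun i ↦ by simp [signZero]) fun i ↦ ?_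
  simp only [signZero, ofSign_inv, sign_mul, sign_ofPerm, sign_ofSign, perm_ofSign, perm_ofPerm,
    Equiv.Perm.one_apply, Equiv.swap_apply_self, one_mul,
    Pi.mul_apply, Pi.mulSingle_apply, Equiv.swap_apply_eq_iff, Equiv.swap_apply_left]
  exact mul_comm _ _

lemma gen_mul_self (i : ℕ) : gen n i * gen n i = 1 := by
  have h (j : ℕ) : ofPerm (adjSwap n j) * ofPerm (adjSwap n j) = 1 := by
    rw [← map_mul, adjSwap_mul_self, map_one]
  rcases Nat.eq_zero_or_pos i with rfl | hi
  · rw [gen_zero, conj_mul, h, mul_one, mul_inv_cancel]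
  · rw [gen_of_pos hi, h]

lemma typeDRelations_gen (hn : 2 ≤ n) : TypeDRelations (gen n) (n - 1) where
  sq i _ := gen_mul_self i
  comm_zero_one _ := by
    have h2 : (gen n 0 * gen n 1) ^ 2 = 1 := by
      rw [gen_zero_mul_gen_one hn, ← map_pow]
      convert map_one ofSign
      ext i
      simp
    exact (mul_pow_two_eq_one_iff (gen_mul_self 0) (gen_mul_self 1)).1 h2
  comm_zero j hj hjn := by
    rw [gen_zero, gen_eq_conj (by omega) (by omega), conj_mul, conj_mul, ← map_mul, ← map_mul,
      adjSwap_comm le_rfl (by omega) (by omega)]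
  comm i j hi hij hj := by
    rw [gen_of_pos hi, gen_of_pos (by omega), ← map_mul, ← map_mul,
      adjSwap_comm hi hij (by omega)]
  braid_zero h := by
    rw [gen_zero, gen_eq_conj le_rfl (by omega)]
    simp only [conj_mul, ← map_mul]
    rw [adjSwap_braid le_rfl (by omega)]
  braid i hi hin := by
    rw [gen_of_pos hi, gen_of_pos (by omega)]
    simp only [← map_mul]
    rw [adjSwap_braid hi (by omega)]

lemma parity_gen (i : ℕ) : parity (gen n i) = 1 := by
  rw [gen]
  split_ifs <;> simp

lemma mem_of_parity_eq_one (hn : 2 ≤ n) {R : Subgroup (SignedPerm_s11 (Fin n))}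
    (hR : ∀ i < n, gen n i ∈ R) {g : SignedPerm_s11 (Fin n)} (hg : parity g = 1) : g ∈ R := by
  have hperm : ∀ σ : Equiv.Perm (Fin n), ofPerm σ ∈ R := by
    obtain ⟨m, rfl⟩ : ∃ m, n = m + 1 := ⟨n - 1, by omega⟩
    intro σ
    have hle : Submonoid.closure (Set.range fun i : Fin m ↦ Equiv.swap i.castSucc i.succ) ≤
        (R.comap ofPerm).toSubmonoid := by
      rw [Submonoid.closure_le]
      rintro _ ⟨i, rfl⟩
      have := hR (i + 1) (by omega)
      rw [gen_of_pos (by omega), adjSwap] at this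
      have hc : Fin.ofNat (m + 1) (i.val + 1 - 1) = i.castSucc :=
        Fin.ext (Nat.mod_eq_of_lt (by omega))
      have hs : Fin.ofNat (m + 1) (i.val + 1) = i.succ := Fin.ext (Nat.mod_eq_of_lt (by omega))
      rw [hc, hs] at this
      exact this
    rw [Equiv.Perm.mclosure_swap_castSucc_succ] at hle
    exact hle (Submonoid.mem_top σ)
  have hpair : ∀ i : Fin n, i ≠ 0 → ofSign (Pi.mulSingle 0 (-1) * Pi.mulSingle i (-1)) ∈ R := by
    intro i hi
    have h0 : Fin.ofNat n 0 = 0 := rfl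
    have hne := ofNat_ne (n := n) (i := 0) (j := 1) (by omega) (by omega) (by omega)
    rw [h0] at hne
    have h := R.mul_mem (R.mul_mem (hperm (Equiv.swap (Fin.ofNat n 1) i))
      (R.mul_mem (hR 0 (by omega)) (hR 1 (by omega))))
      (R.inv_mem (hperm (Equiv.swap (Fin.ofNat n 1) i)))
    rw [gen_zero_mul_gen_one hn] at h
    generalize Fin.ofNat n 1 = o at h hne
    convert h using 1
    refine ext_apply (fun j ↦ by simp) fun j ↦ ?_
    simp [Pi.mulSingle_apply, Equiv.swap_apply_eq_iff,
      Equiv.swap_apply_of_ne_of_ne hne hi.symm]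
  have hsign : ∀ ε : Fin n → ℤˣ, ∏ i, ε i = 1 → ofSign ε ∈ R := by
    intro ε hε
    have hprod : ε = ∏ i, (Pi.mulSingle 0 (ε i) * Pi.mulSingle i (ε i)) := by
      rw [Finset.prod_mul_distrib, Finset.univ_prod_mulSingle]
      have : ∏ i, (Pi.mulSingle 0 (ε i) : Fin n → ℤˣ) = Pi.mulSingle 0 (∏ i, ε i) :=
        (map_prod (MonoidHom.mulSingle (fun _ : Fin n ↦ ℤˣ) 0) ε Finset.univ).symm
      rw [this, hε, Pi.mulSingle_one, one_mul]
    rw [← Subgroup.mem_comap, hprod]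
    refine (R.comap ofSign).prod_mem fun i _ ↦ ?_
    rw [Subgroup.mem_comap]
    rcases Int.units_eq_one_or (ε i) with h | h <;> rw [h]
    · simp
    · by_cases hi : i = 0
      · subst hi
        rw [← Pi.mulSingle_mul]
        simp
      · exact hpair i hi
  rw [← ofPerm_mul_ofSign g]
  exact R.mul_mem (hperm _) (hsign _ hg)

end SignedPerm_s11

namespace TypeDRelations

open SignedPerm_s11

variable {W : Type*} [Group W] {t : ℕ → W} {n : ℕ} [NeZero n]

lemma genAct_fst_le {i k : ℕ} (hi : i ≤ k) (hk : 1 ≤ k) {x : ℕ × ℤˣ} (hx : x.1 ≤ k) :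
    (genAct i x).1 ≤ k := by
  unfold genAct
  split_ifs <;> (try dsimp only) <;> omega

/-- An element of the subgroup generated by `t 0, …, t k` moves the representative of `x` to the
coset of the representative of the image of `x`. -/
lemma exists_initial_mul_rep (h : TypeDRelations t (n - 1)) {φ : W →* SignedPerm_s11 (Fin n)}
    (hφ : ∀ i < n, φ (t i) = gen n i) {k : ℕ} (hk : 2 ≤ k) (hkn : k < n) {g : W}
    (hg : g ∈ initial t k) (x : Fin n × ℤˣ) (hx : x.1.val ≤ k) :
    ((φ g).act x).1.val ≤ k ∧ ∃ l ∈ initial t (k - 1),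
      g * rep t k (x.1.val, x.2) = rep t k (((φ g).act x).1.val, ((φ g).act x).2) * l := by
  have hgen : ∀ i ≤ k, ∀ y : W, (((φ y).act x).1.val ≤ k ∧ ∃ l ∈ initial t (k - 1),
      y * rep t k (x.1.val, x.2) = rep t k (((φ y).act x).1.val, ((φ y).act x).2) * l) →
      ((φ (t i * y)).act x).1.val ≤ k ∧ ∃ l ∈ initial t (k - 1), (t i * y) *
        rep t k (x.1.val, x.2) =
          rep t k (((φ (t i * y)).act x).1.val, ((φ (t i * y)).act x).2) * l := by
    rintro i hi y ⟨hy, l, hl, hl'⟩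
    have hact := val_act_gen (n := n) (i := i) (by omega) (by omega) ((φ y).act x)
    rw [map_mul, act_mul, hφ i (by omega), hact]
    refine ⟨?_, ?_⟩
    · have hact' := congr_arg Prod.fst hact
      dsimp only at hact'
      rw [hact']
      exact genAct_fst_le hi (by omega) hy
    · obtain ⟨l', hl₁, hl₂⟩ := (h.mono (l := k) (by omega)).exists_mul_rep hk
        (x := (((φ y).act x).1.val, ((φ y).act x).2)) hi hy
      exact ⟨l' * l, mul_mem hl₁ hl, by rw [mul_assoc, hl', ← mul_assoc, hl₂, mul_assoc]⟩
  induction hg using Subgroup.closure_induction_left with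
  | one => exact ⟨by simpa using hx, 1, one_mem _, by simp⟩
  | mul_left z hz y _ ih =>
    obtain ⟨i, hi, rfl⟩ := hz
    exact hgen i hi y ih
  | inv_mul_cancel z hz y _ ih =>
    obtain ⟨i, hi, rfl⟩ := hz
    rw [inv_eq_of_mul_eq_one_left (h.sq i (by have := Set.mem_Iic.1 hi; omega))]
    exact hgen i hi y ih

lemma eq_of_mem_initial_one (h : TypeDRelations t 1) {g : W} (hg : g ∈ initial t 1) :
    g = 1 ∨ g = t 0 ∨ g = t 1 ∨ g = t 0 * t 1 := by
  have hgen : ∀ i ≤ 1, ∀ y : W, (y = 1 ∨ y = t 0 ∨ y = t 1 ∨ y = t 0 * t 1) →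
      (t i * y = 1 ∨ t i * y = t 0 ∨ t i * y = t 1 ∨ t i * y = t 0 * t 1) := by
    intro i hi y hy
    have h0 := h.sq 0 (by omega)
    have h1 := h.sq 1 le_rfl
    have h01 := h.comm_zero_one le_rfl
    have h001 : t 0 * (t 0 * t 1) = t 1 := by rw [← mul_assoc, h0, one_mul]
    have h101 : t 1 * (t 0 * t 1) = t 0 := by rw [h01, ← mul_assoc, h1, one_mul]
    interval_cases i <;> rcases hy with rfl | rfl | rfl | rfl <;>
      simp [h0, h1, h001, h101, ← h01]
  induction hg using Subgroup.closure_induction_left with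
  | one => exact Or.inl rfl
  | mul_left z hz y _ ih =>
    obtain ⟨i, hi, rfl⟩ := hz
    exact hgen i hi y ih
  | inv_mul_cancel z hz y _ ih =>
    obtain ⟨i, hi, rfl⟩ := hz
    rw [inv_eq_of_mul_eq_one_left (h.sq i hi)]
    exact hgen i hi y ih

lemma eq_one_of_mem_initial (h : TypeDRelations t (n - 1)) {φ : W →* SignedPerm_s11 (Fin n)}
    (hφ : ∀ i < n, φ (t i) = gen n i) {k : ℕ} (hk : 1 ≤ k) (hkn : k < n) {g : W}
    (hg : g ∈ initial t k) (hg1 : φ g = 1) : g = 1 := by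
  induction k, hk using Nat.le_induction with
  | base =>
    have hv (i : ℕ) (hi : i ≤ 1) (x) := val_act_gen (n := n) (i := i) (by omega) (by omega) x
    have hact : (φ g).act (0, 1) = (0, 1) := by rw [hg1, act_one]
    replace hact := congr_arg (fun x ↦ (x.1.val, x.2)) hact
    rcases (h.mono (by omega)).eq_of_mem_initial_one hg with rfl | rfl | rfl | rfl
    · rfl
    · simp only [hφ 0 (by omega), hv 0 (by omega)] at hact
      simp [genAct] at hact
    · simp only [hφ 1 (by omega), hv 1 (by omega)] at hact
      simp [genAct] at hact
    · simp only [map_mul, act_mul, hφ 0 (by omega), hφ 1 (by omega), hv 0 (by omega),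
        hv 1 (by omega)] at hact
      simp [genAct] at hact
  | succ k hk ih =>
    obtain ⟨-, l, hl, hl'⟩ := h.exists_initial_mul_rep hφ (by omega) hkn hg
      (⟨k + 1, hkn⟩, 1) le_rfl
    rw [hg1, act_one] at hl'
    simp only [rep, if_true, posRep_self, mul_one, one_mul] at hl'
    subst hl'
    exact ih (by omega) hl

end TypeDRelations

/-- The Coxeter group of type `D` is the group of signed permutations with an even number of
minus signs. -/
lemma exists_signedPerm_hom {n : ℕ} (hn : 4 ≤ n) :
    ∃ φ : (typeDMatrix n).Group →* SignedPerm_s11 (Fin n), Function.Injective φ ∧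
      ∀ g, g ∈ φ.range ↔ SignedPerm_s11.parity g = 1 := by
  have : NeZero n := ⟨by omega⟩
  set cs := (typeDMatrix n).toCoxeterSystem with hcs
  have hlift := (SignedPerm_s11.typeDRelations_gen (n := n) (by omega)).isLiftable (by omega)
  set φ := cs.lift ⟨_, hlift⟩ with hφ
  have hsimple : ∀ i, φ (cs.simple i) = SignedPerm_s11.gen n (Fin.rev i) :=
    fun i ↦ cs.lift_apply_simple hlift i
  have hgen : ∀ i < n, φ (cs.simple (Fin.rev (Fin.ofNat n i))) = SignedPerm_s11.gen n i := by
    intro i hi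
    rw [hsimple, Fin.rev_rev, Fin.val_ofNat, Nat.mod_eq_of_lt hi]
  refine ⟨φ, (injective_iff_map_eq_one φ).2 fun g hg ↦ ?_, fun g ↦ ⟨?_, fun hg ↦ ?_⟩⟩
  · refine (typeDRelations_simple (by omega) cs).eq_one_of_mem_initial hgen
      (k := n - 1) (by omega) (by omega) ?_ hg
    have htop : g ∈ Subgroup.closure (Set.range cs.simple) := by
      rw [cs.subgroup_closure_range_simple]
      trivial
    refine Subgroup.closure_mono ?_ htop
    rintro _ ⟨i, rfl⟩
    refine ⟨Fin.rev i, by simp; omega, ?_⟩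
    have hi : Fin.ofNat n (Fin.rev i).val = Fin.rev i :=
      Fin.ext (Nat.mod_eq_of_lt (Fin.rev i).2)
    dsimp only
    rw [hi, Fin.rev_rev]
  · rintro ⟨w, rfl⟩
    induction w using cs.simple_induction with
    | simple i => rw [hsimple, SignedPerm_s11.parity_gen]
    | one => simp
    | mul w w' h h' => rw [map_mul, map_mul, h, h', one_mul]
  · exact SignedPerm_s11.mem_of_parity_eq_one (R := φ.range) (by omega) (fun i hi ↦ ⟨_, hgen i hi⟩) hg

/-! ### Counting conjugacy classes -/

lemma card_conjClasses_eq {G α : Type*} [Group G] {P : G → Prop} {f : G → α} {T : Set α}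
    (hf : ∀ g h, P g → P h → (IsConj g h ↔ f g = f h)) (hT : ∀ a, (∃ g, P g ∧ f g = a) ↔ a ∈ T) :
    Nat.card {c : ConjClasses G // ∃ g, ConjClasses.mk g = c ∧ P g} = Nat.card T := by
  choose r hr hr' using fun a : T ↦ (hT a).2 a.2
  refine (Nat.card_congr (Equiv.ofBijective
    (fun a ↦ ⟨ConjClasses.mk (r a), r a, rfl, hr a⟩) ⟨fun a b hab ↦ ?_, ?_⟩)).symm
  · have := ConjClasses.mk_eq_mk_iff_isConj.1 (Subtype.ext_iff.1 hab)
    rw [hf _ _ (hr a) (hr b), hr', hr'] at this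
    exact Subtype.ext this
  · rintro ⟨_, g, rfl, hg⟩
    refine ⟨⟨f g, (hT _).1 ⟨g, hg, rfl⟩⟩, Subtype.ext ?_⟩
    exact ConjClasses.mk_eq_mk_iff_isConj.2 ((hf _ _ (hr _) hg).2 (hr' _))

lemma card_conjClasses_orderOf_eq_s11 {W α ι : Type*} [Group W] [Fintype ι]
    {φ : W →* SignedPerm_s11 ι} (hinj : Function.Injective φ)
    (hrange : ∀ g, g ∈ φ.range ↔ SignedPerm_s11.parity g = 1) {d : ℕ} {f : SignedPerm_s11 ι → α}
    {T : Set α}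
    (hf : ∀ g h, SignedPerm_s11.parity g = 1 → SignedPerm_s11.parity h = 1 → orderOf g = d →
      orderOf h = d → (SignedPerm_s11.EvenConj g h ↔ f g = f h))
    (hT : ∀ a, (∃ g, SignedPerm_s11.parity g = 1 ∧ orderOf g = d ∧ f g = a) ↔ a ∈ T) :
    Nat.card {c : ConjClasses W // ∃ g, ConjClasses.mk g = c ∧ orderOf g = d} = Nat.card T := by
  have hpar : ∀ w, SignedPerm_s11.parity (φ w) = 1 := fun w ↦ (hrange _).1 ⟨w, rfl⟩
  have hord : ∀ w, orderOf (φ w) = orderOf w := orderOf_injective φ hinj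
  refine card_conjClasses_eq (f := f ∘ φ) (fun g h hg hh ↦ ?_) fun a ↦ ?_
  · rw [Function.comp_apply, Function.comp_apply,
      ← hf _ _ (hpar g) (hpar h) ((hord g).trans hg) ((hord h).trans hh), isConj_iff]
    constructor
    · rintro ⟨c, rfl⟩
      exact ⟨φ c, hpar c, by simp⟩
    · rintro ⟨x, hx, hxg⟩
      obtain ⟨c, rfl⟩ := (hrange x).2 hx
      exact ⟨c, hinj (by simpa using hxg)⟩
  · rw [← hT]
    constructor
    · rintro ⟨w, hw, rfl⟩
      exact ⟨φ w, hpar w, (hord w).trans hw, rfl⟩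
    · rintro ⟨g, hg, hgd, rfl⟩
      obtain ⟨w, rfl⟩ := (hrange g).2 hg
      exact ⟨w, (hord w).symm.trans hgd, rfl⟩

lemma card_involution_invariants {n : ℕ} (hn : 2 ≤ n) :
    Nat.card {x : ℕ × ℕ × Prop | 1 ≤ x.1 + x.2.1 ∧ 2 * (x.1 + x.2.1) ≤ n ∧ (x.2.2 → 2 * x.1 = n)} =
      Nat.card {km : ℕ × ℕ // 1 ≤ km.1 + km.2 ∧ 2 * (km.1 + km.2) ≤ n} +
        (if Even n then 1 else 0) := by
  set S : Set (ℕ × ℕ) := {km | 1 ≤ km.1 + km.2 ∧ 2 * (km.1 + km.2) ≤ n} with hS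
  have hSfin : S.Finite := by
    refine ((Set.finite_Iic n).prod (Set.finite_Iic n)).subset fun x hx ↦ ?_
    simp only [hS, Set.mem_ofPred_eq, Set.mem_prod, Set.mem_Iic] at hx ⊢
    omega
  set U : Set (ℕ × ℕ × Prop) := if Even n then {(n / 2, 0, True)} else ∅ with hU
  have hTU : {x : ℕ × ℕ × Prop | 1 ≤ x.1 + x.2.1 ∧ 2 * (x.1 + x.2.1) ≤ n ∧
      (x.2.2 → 2 * x.1 = n)} = (fun km : ℕ × ℕ ↦ (km.1, km.2, False)) '' S ∪ U := by
    ext ⟨k, m, q⟩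
    by_cases hq : q
    · simp only [hq, hU, hS, Set.mem_ofPred_eq, Set.mem_union, Set.mem_image, Prod.mk.injEq,
        forall_true_left]
      split_ifs with he
      · obtain ⟨c, rfl⟩ := he
        simp
        omega
      · have : 2 * k ≠ n := fun h ↦ he ⟨k, by omega⟩
        simp [this]
    · simp only [hq, hU, hS, Set.mem_ofPred_eq, Set.mem_union, Set.mem_image, Prod.mk.injEq]
      split_ifs <;> simp
  have hdisj : Disjoint ((fun km : ℕ × ℕ ↦ (km.1, km.2, False)) '' S) U := by
    rw [Set.disjoint_left]
    rintro _ ⟨km, -, rfl⟩ h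
    simp only [hU] at h
    split_ifs at h <;> simp at h
  have hUcard : U.ncard = if Even n then 1 else 0 := by
    rw [hU]
    split_ifs <;> simp
  have hUfin : U.Finite := by
    rw [hU]
    split_ifs <;> simp
  rw [hTU, Nat.card_coe_set_eq, Set.ncard_union_eq hdisj (hSfin.image _) hUfin, hUcard,
    Set.ncard_image_of_injective]
  · rfl
  · rintro ⟨a, b⟩ ⟨c, d⟩ h
    simpa using h

/-- Counting conjugacy classes of elements of prime order in the Coxeter group of
type `Dₙ`, `n ≥ 4`. -/
theorem conjClasses_prime_order_typeD (n : ℕ) (hn : 4 ≤ n) :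
    (Nat.card {c : ConjClasses (typeDMatrix n).Group //
        ∃ g, ConjClasses.mk g = c ∧ orderOf g = 2}
      = Nat.card {km : ℕ × ℕ // 1 ≤ km.1 + km.2 ∧ 2 * (km.1 + km.2) ≤ n} +
        (if Even n then 1 else 0)) ∧
    (∀ p : ℕ, p.Prime → Odd p →
      Nat.card {c : ConjClasses (typeDMatrix n).Group //
        ∃ g, ConjClasses.mk g = c ∧ orderOf g = p} = n / p) := by
  obtain ⟨φ, hinj, hrange⟩ := exists_signedPerm_hom hn
  refine ⟨?_, fun p hp hodd ↦ ?_⟩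
  · rw [← card_involution_invariants (by omega)]
    refine card_conjClasses_orderOf_eq_s11 hinj hrange
      (f := fun g ↦ (Multiset.card g.perm.cycleType, g.negFix.card / 2, g.IsTwisted))
      (fun g h hg hh hg2 hh2 ↦ ?_) fun ⟨k, m, q⟩ ↦ ?_
    · have hg2' := (orderOf_eq_prime_iff.1 hg2).1
      have hh2' := (orderOf_eq_prime_iff.1 hh2).1
      rw [SignedPerm_s11.evenConj_iff_of_sq hg2' hh2', Prod.mk.injEq, Prod.mk.injEq, eq_iff_iff]
      obtain ⟨a, ha⟩ := SignedPerm_s11.even_card_negFix hg2' hg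
      obtain ⟨b, hb⟩ := SignedPerm_s11.even_card_negFix hh2' hh
      refine and_congr_right fun _ ↦ and_congr_left fun _ ↦ ?_
      omega
    · simpa only [Set.mem_ofPred_eq, Prod.mk.injEq, eq_iff_iff, Fintype.card_fin] using
        SignedPerm_s11.exists_involution_iff (ι := Fin n) k m q
  · rw [card_conjClasses_orderOf_eq_s11 hinj hrange
      (f := fun g ↦ Multiset.card g.perm.cycleType) (T := ↑(Finset.Icc 1 (n / p)))
      (fun g h _ _ ↦ SignedPerm_s11.evenConj_iff_of_odd hp hodd) fun k ↦ ?_]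
    · simp
    · simpa using SignedPerm_s11.exists_orderOf_eq_prime_iff (ι := Fin n) hp hodd k
end

section
/- Let W be the Coxeter group of type H₃, with generators x₁, x₂, x₃ and relations determined by m(1,2) = 3, m(2,3) = 5, m(1,3) = 2 (and x_i² = 1). Then the six elements x₁, x₁x₃, (x₂x₁x₃)⁵, x₁x₂, x₂x₃, (x₂x₃)² are pairwise non-conjugate in W; the first three have order 2, the fourth has order 3, and the last two have order 5; and every element of W of prime order is conjugate to exactly one of these six elements. -/
namespace H3Reps

/-- The Coxeter group of type `H₃`. -/
abbrev W : Type := CoxeterMatrix.H₃.Group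

/-- The simple reflections `x₁, x₂, x₃` of the Coxeter group of type `H₃`
(`x i` is `xᵢ₊₁`). -/
def x (i : Fin 3) : W := CoxeterMatrix.H₃.simple i

/-- The list of representatives `x₁, x₁x₃, (x₂x₁x₃)⁵, x₁x₂, x₂x₃, (x₂x₃)²`. -/
def reps : List W :=
  [x 0, x 0 * x 2, (x 1 * x 0 * x 2) ^ 5, x 0 * x 1, x 1 * x 2, (x 1 * x 2) ^ 2]

/-- Minimal left coset representatives of the parabolic subgroup generated by `s 1` and `s 2`. -/
def cosetRep {G : Type*} [Group G] (s : Fin 3 → G) : Fin 12 → G :=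
  ![1,
    s 0,
    s 1 * s 0,
    s 2 * (s 1 * s 0),
    s 1 * (s 2 * (s 1 * s 0)),
    s 2 * (s 1 * (s 2 * (s 1 * s 0))),
    s 0 * (s 1 * (s 2 * (s 1 * s 0))),
    s 0 * (s 2 * (s 1 * (s 2 * (s 1 * s 0)))),
    s 1 * (s 0 * (s 2 * (s 1 * (s 2 * (s 1 * s 0))))),
    s 2 * (s 1 * (s 0 * (s 2 * (s 1 * (s 2 * (s 1 * s 0)))))),
    s 1 * (s 2 * (s 1 * (s 0 * (s 2 * (s 1 * (s 2 * (s 1 * s 0))))))),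
    s 0 * (s 1 * (s 2 * (s 1 * (s 0 * (s 2 * (s 1 * (s 2 * (s 1 * s 0))))))))]

/-- A coset representative times an element of the dihedral group generated by `s 1` and `s 2`. -/
def normalForm {G : Type*} [Group G] (s : Fin 3 → G) (p : Fin 12 × Fin 5 × Fin 2) : G :=
  cosetRep s p.1 * ((s 1 * s 2) ^ p.2.1.val * s 1 ^ p.2.2.val)

theorem map_normalForm {G H : Type*} [Group G] [Group H] (φ : G →* H) (s : Fin 3 → G)
    (p : Fin 12 × Fin 5 × Fin 2) : φ (normalForm s p) = normalForm (φ ∘ s) p := by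
  obtain ⟨i, k, e⟩ := p
  have h : φ (cosetRep s i) = cosetRep (φ ∘ s) i := by
    fin_cases i <;> simp [cosetRep]
  simp [normalForm, h]

theorem x_mul_self (i : Fin 3) : x i * x i = 1 :=
  CoxeterMatrix.H₃.toCoxeterSystem.simple_mul_simple_self i

theorem x_mul_cancel_left (i : Fin 3) (w : W) : x i * (x i * w) = w :=
  CoxeterMatrix.H₃.toCoxeterSystem.simple_mul_simple_cancel_left i

theorem x_inv (i : Fin 3) : (x i)⁻¹ = x i :=
  inv_eq_of_mul_eq_one_left (x_mul_self i)

theorem x_zero_mul_x_one_pow : (x 0 * x 1) ^ 3 = 1 :=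
  CoxeterMatrix.H₃.toCoxeterSystem.simple_mul_simple_pow 0 1

theorem x_one_mul_x_two_pow : (x 1 * x 2) ^ 5 = 1 :=
  CoxeterMatrix.H₃.toCoxeterSystem.simple_mul_simple_pow 1 2

theorem x_zero_mul_x_two_pow : (x 0 * x 2) ^ 2 = 1 :=
  CoxeterMatrix.H₃.toCoxeterSystem.simple_mul_simple_pow 0 2

theorem x_zero_mul_x_two : x 0 * x 2 = x 2 * x 0 := by
  have h := eq_inv_of_mul_eq_one_left ((pow_two _).symm.trans x_zero_mul_x_two_pow)
  simpa [x_inv] using h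

theorem braid_zero_one : x 0 * (x 1 * x 0) = x 1 * (x 0 * x 1) := by
  have h : (x 0 * x 1 * x 0) * (x 1 * x 0 * x 1) = 1 := by
    simpa [pow_succ, mul_assoc] using x_zero_mul_x_one_pow
  simpa [x_inv, mul_assoc] using eq_inv_of_mul_eq_one_left h

theorem braid_one_two :
    x 1 * (x 2 * (x 1 * (x 2 * x 1))) = x 2 * (x 1 * (x 2 * (x 1 * x 2))) := by
  have h : (x 1 * x 2 * x 1 * x 2 * x 1) * (x 2 * x 1 * x 2 * x 1 * x 2) = 1 := by
    simpa [pow_succ, mul_assoc] using x_one_mul_x_two_pow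
  simpa [x_inv, mul_assoc] using eq_inv_of_mul_eq_one_left h

theorem x_zero_mul_x_two_left (w : W) : x 0 * (x 2 * w) = x 2 * (x 0 * w) := by
  simpa only [mul_assoc] using congrArg (· * w) x_zero_mul_x_two

theorem braid_zero_one_left (w : W) :
    x 0 * (x 1 * (x 0 * w)) = x 1 * (x 0 * (x 1 * w)) := by
  simpa only [mul_assoc] using congrArg (· * w) braid_zero_one

theorem braid_one_two_left (w : W) :
    x 1 * (x 2 * (x 1 * (x 2 * (x 1 * w)))) = x 2 * (x 1 * (x 2 * (x 1 * (x 2 * w)))) := by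
  simpa only [mul_assoc] using congrArg (· * w) braid_one_two

/-- Each simple reflection permutes the twelve left cosets of the parabolic subgroup
generated by `x 1` and `x 2`. -/
theorem x_mul_cosetRep (j : Fin 3) (i : Fin 12) :
    (∃ i', x j * cosetRep x i = cosetRep x i') ∨
      ∃ k, (k = 1 ∨ k = 2) ∧ x j * cosetRep x i = cosetRep x i * x k := by
  have h₅ : x 1 * (x 2 * (x 1 * (x 2 * (x 1 * x 0)))) =
      x 2 * (x 1 * (x 2 * (x 1 * (x 0 * x 2)))) := by
    rw [braid_one_two_left, x_zero_mul_x_two]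
  have h₆ : x 1 * (x 0 * (x 1 * (x 2 * (x 1 * x 0)))) =
      x 0 * (x 1 * (x 2 * (x 1 * (x 0 * x 1)))) := by
    rw [← braid_zero_one_left, x_zero_mul_x_two_left, braid_zero_one]
  have h₈ : x 0 * (x 1 * (x 0 * (x 2 * (x 1 * (x 2 * (x 1 * x 0)))))) =
      x 1 * (x 0 * (x 2 * (x 1 * (x 2 * (x 1 * (x 0 * x 2)))))) := by
    rw [braid_zero_one_left, h₅]
  have h₉ : x 0 * (x 2 * (x 1 * (x 0 * (x 2 * (x 1 * (x 2 * (x 1 * x 0))))))) =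
      x 2 * (x 1 * (x 0 * (x 2 * (x 1 * (x 2 * (x 1 * (x 0 * x 2))))))) := by
    rw [x_zero_mul_x_two_left, h₈]
  have h₁₀ : x 2 * (x 1 * (x 2 * (x 1 * (x 0 * (x 2 * (x 1 * (x 2 * (x 1 * x 0)))))))) =
      x 1 * (x 2 * (x 1 * (x 0 * (x 2 * (x 1 * (x 2 * (x 1 * (x 0 * x 1)))))))) := by
    rw [x_zero_mul_x_two_left, ← braid_one_two_left, h₆, ← x_zero_mul_x_two_left]
  have h₁₁ : x 1 * (x 0 * (x 1 * (x 2 * (x 1 * (x 0 * (x 2 * (x 1 * (x 2 * (x 1 * x 0))))))))) =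
      x 0 * (x 1 * (x 2 * (x 1 * (x 0 * (x 2 * (x 1 * (x 2 * (x 1 * (x 0 * x 2))))))))) := by
    rw [← braid_zero_one_left, x_zero_mul_x_two_left, h₈]
  have h₁₁' : x 2 * (x 0 * (x 1 * (x 2 * (x 1 * (x 0 * (x 2 * (x 1 * (x 2 * (x 1 * x 0))))))))) =
      x 0 * (x 1 * (x 2 * (x 1 * (x 0 * (x 2 * (x 1 * (x 2 * (x 1 * (x 0 * x 1))))))))) := by
    rw [← x_zero_mul_x_two_left, h₁₀]
  have h₃ : x 0 * (x 2 * (x 1 * x 0)) = x 2 * (x 1 * (x 0 * x 1)) := by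
    rw [x_zero_mul_x_two_left, braid_zero_one]
  fin_cases j <;> fin_cases i
  · exact Or.inl ⟨1, mul_one _⟩
  · exact Or.inl ⟨0, x_mul_self 0⟩
  · exact Or.inr ⟨1, Or.inl rfl, by simpa [cosetRep, mul_assoc] using braid_zero_one⟩
  · exact Or.inr ⟨1, Or.inl rfl, by simpa [cosetRep, mul_assoc] using h₃⟩
  · exact Or.inl ⟨6, rfl⟩
  · exact Or.inl ⟨7, rfl⟩
  · exact Or.inl ⟨4, x_mul_cancel_left 0 _⟩
  · exact Or.inl ⟨5, x_mul_cancel_left 0 _⟩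
  · exact Or.inr ⟨2, Or.inr rfl, by simpa [cosetRep, mul_assoc] using h₈⟩
  · exact Or.inr ⟨2, Or.inr rfl, by simpa [cosetRep, mul_assoc] using h₉⟩
  · exact Or.inl ⟨11, rfl⟩
  · exact Or.inl ⟨10, x_mul_cancel_left 0 _⟩
  · exact Or.inr ⟨1, Or.inl rfl, (mul_one _).trans (one_mul _).symm⟩
  · exact Or.inl ⟨2, rfl⟩
  · exact Or.inl ⟨1, x_mul_cancel_left 1 _⟩
  · exact Or.inl ⟨4, rfl⟩
  · exact Or.inl ⟨3, x_mul_cancel_left 1 _⟩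
  · exact Or.inr ⟨2, Or.inr rfl, by simpa [cosetRep, mul_assoc] using h₅⟩
  · exact Or.inr ⟨1, Or.inl rfl, by simpa [cosetRep, mul_assoc] using h₆⟩
  · exact Or.inl ⟨8, rfl⟩
  · exact Or.inl ⟨7, x_mul_cancel_left 1 _⟩
  · exact Or.inl ⟨10, rfl⟩
  · exact Or.inl ⟨9, x_mul_cancel_left 1 _⟩
  · exact Or.inr ⟨2, Or.inr rfl, by simpa [cosetRep, mul_assoc] using h₁₁⟩
  · exact Or.inr ⟨2, Or.inr rfl, (mul_one _).trans (one_mul _).symm⟩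
  · exact Or.inr ⟨2, Or.inr rfl, by simpa [cosetRep, mul_assoc] using x_zero_mul_x_two.symm⟩
  · exact Or.inl ⟨3, rfl⟩
  · exact Or.inl ⟨2, x_mul_cancel_left 2 _⟩
  · exact Or.inl ⟨5, rfl⟩
  · exact Or.inl ⟨4, x_mul_cancel_left 2 _⟩
  · exact Or.inl ⟨7, (x_zero_mul_x_two_left _).symm⟩
  · exact Or.inl ⟨6, (congrArg (x 2 * ·) (x_zero_mul_x_two_left _)).trans (x_mul_cancel_left 2 _)⟩
  · exact Or.inl ⟨9, rfl⟩
  · exact Or.inl ⟨8, x_mul_cancel_left 2 _⟩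
  · exact Or.inr ⟨1, Or.inl rfl, by simpa [cosetRep, mul_assoc] using h₁₀⟩
  · exact Or.inr ⟨1, Or.inl rfl, by simpa [cosetRep, mul_assoc] using h₁₁'⟩

/-- Every element of the Coxeter group of type `H₃` has a normal form. -/
theorem normalForm_x_surjective : Function.Surjective (normalForm x) := by
  have hr : x 1 * (x 1 * x 2) = (x 1 * x 2) ^ 4 * x 1 := by
    have h : (x 1 * x 2) ^ 4 = x 2 * x 1 := by
      have := eq_inv_of_mul_eq_one_left ((pow_succ _ 4).symm.trans x_one_mul_x_two_pow)
      simpa only [mul_inv_rev, x_inv] using this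
    rw [h, x_mul_cancel_left, mul_assoc, x_mul_self, mul_one]
  have hpow (k : ℕ) : x 1 * (x 1 * x 2) ^ k = (x 1 * x 2) ^ (4 * k) * x 1 := by
    rw [pow_mul]
    exact (SemiconjBy.pow_right (show SemiconjBy _ _ _ from hr) k)
  have hone (k e : ℕ) : x 1 * ((x 1 * x 2) ^ k * x 1 ^ e) =
      (x 1 * x 2) ^ (4 * k) * x 1 ^ (e + 1) := by
    rw [← mul_assoc, hpow, mul_assoc, ← pow_succ']
  have htwo (k e : ℕ) : x 2 * ((x 1 * x 2) ^ k * x 1 ^ e) =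
      (x 1 * x 2) ^ (4 * (k + 1)) * x 1 ^ (e + 1) := by
    rw [← hone, pow_succ', mul_assoc, mul_assoc, x_mul_cancel_left]
  have hnf (w : W) : ∃ i k e, cosetRep x i * ((x 1 * x 2) ^ k * x 1 ^ e) = w := by
    induction w using CoxeterMatrix.H₃.toCoxeterSystem.simple_induction_left with
    | one => exact ⟨0, 0, 0, by simp [cosetRep]⟩
    | mul_simple_left w j ih =>
      obtain ⟨i, k, e, rfl⟩ := ih
      change ∃ i' k' e', _ = x j * _
      obtain ⟨i', h⟩ | ⟨l, rfl | rfl, h⟩ := x_mul_cosetRep j i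
      · exact ⟨i', k, e, by rw [← h, mul_assoc]⟩
      · exact ⟨i, _, _, by rw [← mul_assoc (x j), h, mul_assoc, hone]⟩
      · exact ⟨i, _, _, by rw [← mul_assoc (x j), h, mul_assoc, htwo]⟩
  intro w
  obtain ⟨i, k, e, rfl⟩ := hnf w
  refine ⟨(i, Fin.ofNat 5 k, Fin.ofNat 2 e), ?_⟩
  have h₂ : x 1 ^ 2 = 1 := (pow_two _).trans (x_mul_self 1)
  simp only [normalForm, Fin.val_ofNat]
  rw [pow_eq_pow_mod k x_one_mul_x_two_pow, pow_eq_pow_mod e h₂]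

/-- A faithful model of the Coxeter group of type `H₃` inside `S₅ × {±1}`:
the images of the simple reflections. -/
def model : Fin 3 → Equiv.Perm (Fin 5) × ℤˣ :=
  ![(⟨![3, 2, 1, 0, 4], ![3, 2, 1, 0, 4], by decide, by decide⟩, -1),
    (⟨![0, 2, 1, 4, 3], ![0, 2, 1, 4, 3], by decide, by decide⟩, -1),
    (⟨![1, 0, 3, 2, 4], ![1, 0, 3, 2, 4], by decide, by decide⟩, -1)]

theorem isLiftable_model : CoxeterMatrix.H₃.IsLiftable model := by
  unfold CoxeterMatrix.IsLiftable
  decide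

/-- The homomorphism from the Coxeter group of type `H₃` to its model. -/
def toModel : W →* Equiv.Perm (Fin 5) × ℤˣ :=
  CoxeterMatrix.H₃.toCoxeterSystem.lift ⟨model, isLiftable_model⟩

theorem toModel_x (i : Fin 3) : toModel (x i) = model i :=
  CoxeterMatrix.H₃.toCoxeterSystem.lift_apply_simple isLiftable_model i

theorem toModel_normalForm (p : Fin 12 × Fin 5 × Fin 2) :
    toModel (normalForm x p) = normalForm model p := by
  rw [map_normalForm, show toModel ∘ x = model from funext toModel_x]

theorem normalForm_model_eq_one : ∀ p, normalForm model p = 1 → p = 0 := by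
  decide +kernel

theorem toModel_injective : Function.Injective toModel := by
  rw [injective_iff_map_eq_one]
  intro w hw
  obtain ⟨p, rfl⟩ := normalForm_x_surjective w
  rw [toModel_normalForm] at hw
  simp [normalForm_model_eq_one p hw, normalForm, cosetRep]

theorem isConj_iff_model {g h : W} : IsConj g h ↔
    ∃ p, normalForm model p * toModel g = toModel h * normalForm model p := by
  simp_rw [isConj_iff, normalForm_x_surjective.exists, mul_inv_eq_iff_eq_mul,
    ← toModel_injective.eq_iff, map_mul, toModel_normalForm]

/-- The images of the representatives in the model. -/
def repsModel : List (Equiv.Perm (Fin 5) × ℤˣ) :=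
  [model 0, model 0 * model 2, (model 1 * model 0 * model 2) ^ 5, model 0 * model 1,
    model 1 * model 2, (model 1 * model 2) ^ 2]

theorem map_toModel_reps : reps.map toModel = repsModel := by
  simp [reps, repsModel, toModel_x]

theorem repsModel_pairwise :
    repsModel.Pairwise fun a b => ¬ ∃ p, normalForm model p * a = b * normalForm model p := by
  decide +kernel

theorem reps_pairwise : reps.Pairwise fun a b => ¬ IsConj a b := by
  simp_rw [isConj_iff_model]
  rw [← List.pairwise_map (f := toModel)
    (R := fun a b => ¬ ∃ p, normalForm model p * a = b * normalForm model p), map_toModel_reps]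
  exact repsModel_pairwise

theorem normalForm_model_pow_six_or_ten :
    ∀ p, normalForm model p ^ 6 = 1 ∨ normalForm model p ^ 10 = 1 := by
  decide +kernel

theorem normalForm_model_pow (p : Fin 12 × Fin 5 × Fin 2) :
    normalForm model p ^ (2 * 3 * 5) = 1 := by
  obtain h | h := normalForm_model_pow_six_or_ten p
  · rw [show 2 * 3 * 5 = 6 * 5 from rfl, pow_mul, h, one_pow]
  · rw [show 2 * 3 * 5 = 10 * 3 from rfl, pow_mul, h, one_pow]

theorem exists_conj_repsModel_of_pow_two : ∀ p, normalForm model p ^ 2 = 1 →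
    normalForm model p = 1 ∨ ∃ r ∈ repsModel.take 3,
      ∃ q, normalForm model q * normalForm model p = r * normalForm model q := by
  decide +kernel

theorem exists_conj_repsModel_of_pow_three : ∀ p, normalForm model p ^ 3 = 1 →
    normalForm model p = 1 ∨
      ∃ q, normalForm model q * normalForm model p = model 0 * model 1 * normalForm model q := by
  decide +kernel

theorem exists_conj_repsModel_of_pow_five : ∀ p, normalForm model p ^ 5 = 1 →
    normalForm model p = 1 ∨ ∃ r ∈ repsModel.drop 4,
      ∃ q, normalForm model q * normalForm model p = r * normalForm model q := by
  decide +kernel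

theorem exists_isConj_reps (g : W) (hg : (orderOf g).Prime) : ∃ r ∈ reps, IsConj g r := by
  obtain ⟨p, rfl⟩ := normalForm_x_surjective g
  rw [← orderOf_injective toModel toModel_injective, toModel_normalForm] at hg
  have hdvd := orderOf_dvd_of_pow_eq_one (normalForm_model_pow p)
  have hpow := pow_orderOf_eq_one (normalForm model p)
  rw [hg.dvd_mul, hg.dvd_mul, Nat.prime_dvd_prime_iff_eq hg Nat.prime_two,
    Nat.prime_dvd_prime_iff_eq hg Nat.prime_three,
    Nat.prime_dvd_prime_iff_eq hg Nat.prime_five] at hdvd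
  have hcases : normalForm model p = 1 ∨ ∃ r ∈ repsModel,
      ∃ q, normalForm model q * normalForm model p = r * normalForm model q := by
    obtain (h | h) | h := hdvd <;> rw [h] at hpow
    · exact (exists_conj_repsModel_of_pow_two p hpow).imp_right fun ⟨r, hr, hq⟩ =>
        ⟨r, List.mem_of_mem_take hr, hq⟩
    · exact (exists_conj_repsModel_of_pow_three p hpow).imp_right fun hq =>
        ⟨_, by simp [repsModel], hq⟩
    · exact (exists_conj_repsModel_of_pow_five p hpow).imp_right fun ⟨r, hr, hq⟩ =>
        ⟨r, List.mem_of_mem_drop hr, hq⟩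
  obtain h | ⟨r, hr, hconj⟩ := hcases
  · exact absurd (orderOf_eq_one_iff.mpr h) hg.ne_one
  · rw [← map_toModel_reps, List.mem_map] at hr
    obtain ⟨r, hr, rfl⟩ := hr
    exact ⟨r, hr, isConj_iff_model.mpr (by simpa only [toModel_normalForm] using hconj)⟩

theorem orderOf_eq_of_toModel {g : W} {m : Equiv.Perm (Fin 5) × ℤˣ} {p : ℕ} (hp : p.Prime)
    (hg : toModel g = m) (hpow : m ^ p = 1) (hne : m ≠ 1) : orderOf g = p := by
  have := Fact.mk hp
  rw [← orderOf_injective toModel toModel_injective, hg]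
  exact orderOf_eq_prime hpow hne

/-- In the Coxeter group of type `H₃`, the six elements `x₁`, `x₁x₃`, `(x₂x₁x₃)⁵`,
`x₁x₂`, `x₂x₃`, `(x₂x₃)²` are pairwise non-conjugate, have orders `2,2,2,3,5,5`
respectively, and every element of prime order is conjugate to exactly one of them. -/
theorem conjClasses_prime_order_typeH3 :
    reps.Pairwise (fun a b => ¬ IsConj a b) ∧
    orderOf (x 0) = 2 ∧
    orderOf (x 0 * x 2) = 2 ∧
    orderOf ((x 1 * x 0 * x 2) ^ 5) = 2 ∧
    orderOf (x 0 * x 1) = 3 ∧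
    orderOf (x 1 * x 2) = 5 ∧
    orderOf ((x 1 * x 2) ^ 2) = 5 ∧
    (∀ g : W, (orderOf g).Prime → ∃! r, r ∈ reps ∧ IsConj g r) := by
  refine ⟨reps_pairwise, ?_, ?_, ?_, ?_, ?_, ?_, fun g hg => ?_⟩
  · exact orderOf_eq_of_toModel Nat.prime_two (toModel_x 0) (by decide) (by decide)
  · exact orderOf_eq_of_toModel (m := model 0 * model 2) Nat.prime_two
      (by simp only [map_mul, toModel_x]) (by decide +kernel) (by decide +kernel)
  · exact orderOf_eq_of_toModel (m := (model 1 * model 0 * model 2) ^ 5) Nat.prime_two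
      (by simp only [map_pow, map_mul, toModel_x]) (by decide +kernel) (by decide +kernel)
  · exact orderOf_eq_of_toModel (m := model 0 * model 1) Nat.prime_three
      (by simp only [map_mul, toModel_x]) (by decide +kernel) (by decide +kernel)
  · exact orderOf_eq_of_toModel (m := model 1 * model 2) Nat.prime_five
      (by simp only [map_mul, toModel_x]) (by decide +kernel) (by decide +kernel)
  · exact orderOf_eq_of_toModel (m := (model 1 * model 2) ^ 2) Nat.prime_five
      (by simp only [map_pow, map_mul, toModel_x]) (by decide +kernel) (by decide +kernel)
  · obtain ⟨r, hr, hgr⟩ := exists_isConj_reps g hg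
    refine ⟨r, ⟨hr, hgr⟩, fun r' ⟨hr', hgr'⟩ => ?_⟩
    by_contra hne
    have : Std.Symm fun a b : W => ¬ IsConj a b := ⟨fun _ _ h h' => h h'.symm⟩
    exact reps_pairwise.forall hr' hr hne (hgr'.symm.trans hgr)

end H3Reps
end
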